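/- arXiv:math/0105072 — 7 statements merged into one kernel-verified Lean document; each statement's English description precedes it below -/
import Mathlib

section
/- For all integers α ≥ 1, n ≥ 1 and ω ≥ 2n: A_{n,2α+1}(ω) = Σ_{s=1}^{α} α^{2n-2α+2s} Γ(s+1/2) K_s^α / ((n-α+s)! (2α)!), where a term with n-α+s < 0 is interpreted as 0 (i.e., 1/(n-α+s)! = 1/Γ(n-α+s+1) = 0 at nonpositive integer arguments of Γ). -/
open Finset

/-- Multiplicity of the k-th eigenvalue of the Laplacian on `S^d`. -/
noncomputable def sphMu (k d : ℕ) : ℝ :=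
  if k = 0 then 1 else
    ((2 * k + d : ℝ) - 1) * (Nat.factorial (k + d - 2)) /
      (Nat.factorial k * Nat.factorial (d - 1))

/-- The k-th eigenvalue of the Laplacian on `S^d`. -/
def sphLam (k d : ℕ) : ℕ := k * (k + d - 1)

/-- The expression `A_{n,d}(ω)` from the paper. -/
noncomputable def A (n d ω : ℕ) : ℝ :=
  ∑ j ∈ Icc 1 ω,
    (2 * (-1 : ℝ) ^ n * Real.Gamma ((ω : ℝ) + d / 2 + 1) /
      (Nat.factorial (ω - j) * Nat.factorial (j + n) * Nat.factorial (2 * j + d))) *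
    ∑ k ∈ Icc 1 j,
      (-1 : ℝ) ^ k * (Nat.choose (2 * j + d - 1) (j - k)) * sphMu k d *
        (sphLam k d : ℝ) ^ (j + n)

/-- The coefficients `K_s^α` defined by `Π_{β=0}^{α-1}(z²-β²) = Σ_{s=1}^{α} K_s^α z^{2s}`. -/
noncomputable def Kodd (α s : ℕ) : ℝ :=
  (∏ β ∈ Finset.range α, ((Polynomial.X : Polynomial ℝ) ^ 2 -
      Polynomial.C ((β : ℝ) ^ 2))).coeff (2 * s)

open Polynomial in
lemma hs_alt_poly (Q : ℝ[X]) (M : ℕ) (h : Q.natDegree < M) :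
    ∑ m ∈ range (M + 1), (-1 : ℝ) ^ m / ((M - m).factorial * m.factorial) * Q.eval (m : ℝ) = 0 := by
  have h1 := congrFun (Polynomial.fwdDiff_iter_eq_zero_of_degree_lt h) 0
  rw [fwdDiff_iter_eq_sum_shift] at h1
  simp only [zero_add, nsmul_eq_mul, mul_one, zsmul_eq_mul, Pi.zero_apply] at h1
  have h2 : ∀ m ∈ range (M + 1), (-1 : ℝ) ^ m / ((M - m).factorial * m.factorial) * Q.eval (m : ℝ)
      = (-1) ^ M / M.factorial * (((((-1 : ℤ) ^ (M - m) * (M.choose m : ℤ)) : ℤ) : ℝ) * Q.eval (m : ℝ)) := by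
    intro m hm
    have hm' : m ≤ M := by simpa [Nat.lt_succ_iff] using hm
    push_cast
    rw [Nat.cast_choose ℝ hm']
    have e1 : (M.factorial : ℝ) ≠ 0 := by positivity
    have e2 : ((-1 : ℝ)) ^ M = (-1) ^ m * (-1) ^ (M - m) := by
      rw [← pow_add, Nat.add_sub_cancel' hm']
    have e3 : ((-1 : ℝ)) ^ (M - m) * (-1) ^ (M - m) = 1 := by
      rw [← mul_pow]; simp
    rw [e2]
    field_simp
    linear_combination (-eval (m : ℝ) Q) * e3
  rw [Finset.sum_congr rfl h2, ← Finset.mul_sum, h1, mul_zero]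

lemma hs_gamma (N : ℕ) : ∀ x : ℝ, 0 < x →
    ∑ l ∈ range (N + 1), (-1 : ℝ) ^ l * (N.choose l : ℝ) / (x + l) =
      N.factorial * Real.Gamma x / Real.Gamma (x + N + 1) := by
  induction N with
  | zero =>
    intro x hx
    have : Real.Gamma x ≠ 0 := (Real.Gamma_pos_of_pos hx).ne'
    simp [Real.Gamma_add_one hx.ne']
    field_simp
  | succ N ih =>
    intro x hx
    have e : ∑ l ∈ range (N + 1 + 1), (-1 : ℝ) ^ l * ((N + 1).choose l : ℝ) / (x + l)
       = ∑ l ∈ range (N + 1), (-1 : ℝ) ^ l * (N.choose l : ℝ) / (x + l)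
        - ∑ l ∈ range (N + 1), (-1 : ℝ) ^ l * (N.choose l : ℝ) / (x + 1 + l) := by
      rw [Finset.sum_range_succ' _ (N + 1),
        Finset.sum_range_succ' (fun l => (-1 : ℝ) ^ l * (N.choose l : ℝ) / (x + l)) N]
      have : ∑ l ∈ range N, (-1 : ℝ) ^ (l + 1) * (N.choose (l + 1) : ℝ) / (x + (l + 1 : ℕ))
         = ∑ l ∈ range (N + 1), (-1 : ℝ) ^ (l + 1) * (N.choose (l + 1) : ℝ) / (x + (l + 1 : ℕ)) := by
        rw [Finset.sum_range_succ]; simp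
      rw [this]
      simp only [Nat.choose_succ_succ, Nat.cast_add, mul_add, add_div, Finset.sum_add_distrib]
      have : ∑ l ∈ range (N + 1), (-1 : ℝ) ^ (l + 1) * (N.choose l : ℝ) / (x + (l + (1 : ℕ)))
         = - ∑ l ∈ range (N + 1), (-1 : ℝ) ^ l * (N.choose l : ℝ) / (x + 1 + l) := by
        rw [← Finset.sum_neg_distrib]
        refine Finset.sum_congr rfl fun l _ => ?_
        rw [pow_succ, show x + ((l : ℝ) + (1 : ℕ)) = x + 1 + l by push_cast; ring]; ring
      rw [this]
      simp
      ring
    rw [e, ih x hx, ih (x + 1) (by linarith)]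
    have p : 0 < x + N + 1 := by positivity
    have h1 := Real.Gamma_add_one p.ne'
    have h2 := Real.Gamma_add_one hx.ne'
    have h3 : Real.Gamma (x + N + 1) ≠ 0 := (Real.Gamma_pos_of_pos p).ne'
    rw [show x + 1 + (N : ℝ) + 1 = x + N + 1 + 1 by ring,
      show x + ((N + 1 : ℕ) : ℝ) + 1 = x + N + 1 + 1 by push_cast; ring, h1, h2, Nat.factorial_succ]
    push_cast
    field_simp
    ring

/-- central difference of a monomial at zero -/
noncomputable def hsCd (m N : ℕ) : ℝ :=
  ∑ i ∈ range (2 * m + 1), (-1 : ℝ) ^ i * ((2 * m).choose i : ℝ) * ((m : ℝ) - i) ^ N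

open PowerSeries in
lemma hs_cd_coeff (m N : ℕ) : hsCd m N = N.factorial *
    coeff N ((exp ℝ + rescale (-1 : ℝ) (exp ℝ) - 2) ^ m) := by
  have h0 : exp ℝ * rescale (-1 : ℝ) (exp ℝ) = 1 := by
    simpa [evalNegHom] using exp_mul_exp_neg_eq_one (A := ℝ)
  have h1 : exp ℝ + rescale (-1 : ℝ) (exp ℝ) - 2 =
     rescale (-1 : ℝ) (exp ℝ) * ((-1 + exp ℝ) ^ 2) := by
    linear_combination (2 - exp ℝ) * h0
  have h2 : (rescale (-1 : ℝ) (exp ℝ)) ^ m = rescale (-m : ℝ) (exp ℝ) := by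
    rw [← map_pow, exp_pow_eq_rescale_exp, rescale_rescale]
    congr 2; ring
  rw [h1, mul_pow, ← pow_mul, add_pow, h2, Finset.mul_sum, map_sum, Finset.mul_sum, hsCd]
  refine Finset.sum_congr rfl fun i hi => ?_
  have hi' : i ≤ 2 * m := by simpa [Nat.lt_succ_iff] using hi
  have h3 : rescale (-m : ℝ) (exp ℝ) * ((-1) ^ i * exp ℝ ^ (2 * m - i) * ((2 * m).choose i : ℝ⟦X⟧))
     = C ((-1 : ℝ) ^ i * ((2 * m).choose i : ℝ)) * rescale ((m : ℝ) - i) (exp ℝ) := by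
    rw [exp_pow_eq_rescale_exp]
    have := exp_mul_exp_eq_exp_add (A := ℝ) (-m : ℝ) ((2 * m - i : ℕ) : ℝ)
    rw [show (-m : ℝ) + ((2 * m - i : ℕ) : ℝ) = (m : ℝ) - i by
      rw [Nat.cast_sub hi']; push_cast; ring] at this
    rw [← this]
    simp
    ring
  rw [h3, coeff_C_mul, coeff_rescale, coeff_exp]
  have : (N.factorial : ℝ) ≠ 0 := by positivity
  simp
  field_simp

open PowerSeries in
lemma hs_series : ∃ W : ℝ⟦X⟧, exp ℝ + rescale (-1 : ℝ) (exp ℝ) - 2 = X ^ 2 * (1 + X ^ 2 * W) := by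
  refine ⟨mk fun k => (1 + (-1) ^ k) / ((k + 4).factorial : ℝ), ?_⟩
  ext k
  have h2 : (2 : ℝ⟦X⟧) = C 2 := (map_ofNat C 2).symm
  rw [h2]
  rcases k with _ | _ | _ | _ | k
  · simp only [map_sub, map_add, coeff_rescale]; simp [coeff_exp, coeff_C, coeff_X_pow_mul']; norm_num
  · simp [coeff_exp, coeff_C, coeff_X_pow_mul']
  · simp [coeff_exp, coeff_C, coeff_X_pow_mul']; norm_num
  · simp [coeff_exp, coeff_C, coeff_X_pow_mul', coeff_one]; norm_num
  · simp [coeff_exp, coeff_C, coeff_X_pow_mul', coeff_one]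
    rw [pow_add]; ring

lemma hs_cd_lt (m N : ℕ) (h : N < 2 * m) : hsCd m N = 0 := by
  obtain ⟨W, hW⟩ := hs_series
  rw [hs_cd_coeff, hW, mul_pow, ← pow_mul, PowerSeries.coeff_X_pow_mul', if_neg (by omega), mul_zero]

lemma hs_cd_eq (m : ℕ) : hsCd m (2 * m) = (2 * m).factorial := by
  obtain ⟨W, hW⟩ := hs_series
  rw [hs_cd_coeff, hW, mul_pow, ← pow_mul, PowerSeries.coeff_X_pow_mul', if_pos le_rfl]
  simp

open Polynomial in
lemma hs_choose_poly (r : ℕ) : ∃ Q : ℝ[X], Q.natDegree ≤ r ∧ ∀ m : ℕ, Q.eval (m : ℝ) = (m.choose r : ℝ) := by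
  refine ⟨C ((r.factorial : ℝ)⁻¹) * descPochhammer ℝ r, ?_, fun m => ?_⟩
  · exact (natDegree_C_mul_le _ _).trans (descPochhammer_natDegree ℝ r).le
  · rw [eval_mul, eval_C, descPochhammer_eval_eq_descFactorial, Nat.descFactorial_eq_factorial_mul_choose]
    push_cast
    have : (r.factorial : ℝ) ≠ 0 := by positivity
    field_simp

open Polynomial in
lemma hs_cd_poly (e : ℕ) : ∃ Q : ℝ[X], Q.natDegree ≤ e ∧
    ∀ m : ℕ, hsCd m (2 * m + 2 * e) = (2 * m + 2 * e).factorial * Q.eval (m : ℝ) := by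
  obtain ⟨W, hW⟩ := hs_series
  choose B hB hB' using hs_choose_poly
  refine ⟨∑ r ∈ range (e + 1), C (PowerSeries.coeff (2 * e - 2 * r) (W ^ r)) * B r, ?_, fun m => ?_⟩
  · refine natDegree_sum_le_of_forall_le _ _ fun r hr => ?_
    have : r ≤ e := by simpa [Nat.lt_succ_iff] using hr
    exact (natDegree_C_mul_le _ _).trans ((hB r).trans this)
  · rw [hs_cd_coeff, hW, mul_pow, ← pow_mul, PowerSeries.coeff_X_pow_mul', if_pos (by omega),
      Nat.add_sub_cancel_left, add_comm 1, add_pow]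
    congr 1
    rw [eval_finsetSum, map_sum]
    have hf : ∀ r, PowerSeries.coeff (2 * e) ((PowerSeries.X ^ 2 * W) ^ r * 1 ^ (m - r) * (m.choose r : PowerSeries ℝ))
      = if r ≤ e then eval (m : ℝ) (C (PowerSeries.coeff (2 * e - 2 * r) (W ^ r)) * B r) else 0 := by
      intro r
      rw [one_pow, mul_one, mul_pow, ← pow_mul, mul_assoc, PowerSeries.coeff_X_pow_mul']
      have : (2 * r ≤ 2 * e) ↔ r ≤ e := by omega
      simp only [this]
      split_ifs
      · rw [show (m.choose r : PowerSeries ℝ) = PowerSeries.C (m.choose r : ℝ) by simp,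
          PowerSeries.coeff_mul_C, eval_mul, eval_C, hB']
      · rfl
    simp only [hf]
    rw [← Finset.sum_filter]
    have h1 : ∑ r ∈ range (e + 1), eval (m : ℝ) (C (PowerSeries.coeff (2 * e - 2 * r) (W ^ r)) * B r)
       = ∑ r ∈ (range (e + 1)).filter (· ≤ m), eval (m : ℝ) (C (PowerSeries.coeff (2 * e - 2 * r) (W ^ r)) * B r) := by
      rw [Finset.sum_filter]
      refine Finset.sum_congr rfl fun r _ => ?_
      split_ifs with h
      · rfl
      · rw [eval_mul, hB', Nat.choose_eq_zero_of_lt (by omega)]; simp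
    rw [h1]
    refine Finset.sum_congr ?_ fun _ _ => rfl
    ext r; simp only [Finset.mem_filter, Finset.mem_range]; omega

lemma hs_fact_id (m f : ℕ) : ((2 * m + 2 * (f + 1)).factorial : ℝ) * m.factorial =
    (2 * m + 1).factorial * (m + (f + 1)).factorial * 2 ^ (f + 1) *
      ∏ i ∈ range f, (2 * (m : ℝ) + (2 * i + 3)) := by
  induction f with
  | zero =>
    rw [show 2 * m + 2 * (0 + 1) = (2 * m + 1) + 1 by ring, Nat.factorial_succ (2 * m + 1),
      show m + (0 + 1) = m + 1 by ring, Nat.factorial_succ m]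
    push_cast
    simp
    ring
  | succ f ih =>
    rw [show 2 * m + 2 * (f + 1 + 1) = (2 * m + 2 * (f + 1) + 1) + 1 by ring, Nat.factorial_succ,
      Nat.factorial_succ (2 * m + 2 * (f + 1)), show m + (f + 1 + 1) = m + (f + 1) + 1 by ring,
      Nat.factorial_succ (m + (f + 1)), Finset.prod_range_succ]
    push_cast at ih ⊢
    linear_combination (2 * (m : ℝ) + 2 * (f + 1) + 1 + 1) * (2 * m + 2 * (f + 1) + 1) * ih

open Polynomial in
lemma hs_R_pos (s f M : ℕ) (h : 2 * (f + 1) + s ≤ M) :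
    ∑ m ∈ range (M + 1), (-1 : ℝ) ^ m / ((M - m).factorial * (2 * m + 1).factorial) *
      (if s ≤ m + (f + 1) then hsCd m (2 * m + 2 * (f + 1)) / ((m + (f + 1) - s).factorial : ℝ)
        else 0) = 0 := by
  obtain ⟨Q, hQ, hQ'⟩ := hs_cd_poly (f + 1)
  let R : ℝ[X] := C (2 ^ (f + 1)) * ((descPochhammer ℝ s).comp (X + C ((f + 1 : ℕ) : ℝ)) *
    ((∏ i ∈ range f, (C 2 * X + C (2 * (i : ℝ) + 3))) * Q))
  have hR : R.natDegree < M := by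
    have h1 : ((descPochhammer ℝ s).comp (X + C ((f + 1 : ℕ) : ℝ))).natDegree ≤ s := by
      rw [natDegree_comp, natDegree_X_add_C, descPochhammer_natDegree, mul_one]
    have h2 : (∏ i ∈ range f, (C 2 * X + C (2 * (i : ℝ) + 3))).natDegree ≤ f := by
      refine (natDegree_prod_le _ _).trans ?_
      refine (Finset.sum_le_sum (g := fun _ => 1) fun i _ => natDegree_linear_le).trans ?_
      simp
    have h3 : R.natDegree ≤ s + (f + (f + 1)) :=
      (natDegree_C_mul_le _ _).trans <| natDegree_mul_le.trans <| add_le_add h1 <|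
        natDegree_mul_le.trans <| add_le_add h2 hQ
    omega
  refine Eq.trans ?_ (hs_alt_poly R M hR)
  refine Finset.sum_congr rfl fun m hm => ?_
  have hRe : R.eval (m : ℝ) = 2 ^ (f + 1) * (((m + (f + 1)).descFactorial s : ℝ) *
      ((∏ i ∈ range f, (2 * (m : ℝ) + (2 * i + 3))) * Q.eval (m : ℝ))) := by
    simp only [R, eval_mul, eval_C, eval_comp, eval_add, eval_X, eval_prod]
    rw [← Nat.cast_add, descPochhammer_eval_eq_descFactorial]
  rw [hRe]
  have hid := hs_fact_id m f
  split_ifs with hs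
  · rw [hQ']
    have h4 := Nat.factorial_mul_descFactorial hs
    have h4' : ((m + (f + 1) - s).factorial : ℝ) * ((m + (f + 1)).descFactorial s : ℝ)
      = (m + (f + 1)).factorial := by exact_mod_cast h4
    rw [← h4'] at hid
    have e1 : ((M - m).factorial : ℝ) ≠ 0 := by positivity
    have e2 : ((2 * m + 1).factorial : ℝ) ≠ 0 := by positivity
    have e3 : ((m + (f + 1) - s).factorial : ℝ) ≠ 0 := by positivity
    have e4 : (m.factorial : ℝ) ≠ 0 := by positivity
    generalize ((2 * m + 2 * (f + 1)).factorial : ℝ) = a at *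
    generalize ((m + (f + 1) - s).factorial : ℝ) = b at *
    generalize ((2 * m + 1).factorial : ℝ) = c at *
    generalize (∏ i ∈ range f, (2 * (m : ℝ) + (2 * i + 3))) = d at *
    generalize ((M - m).factorial : ℝ) = g at *
    generalize ((m + (f + 1)).descFactorial s : ℝ) = t at *
    rw [div_mul_div_comm, div_mul_eq_mul_div, div_eq_div_iff (by positivity) (by positivity)]
    linear_combination ((-1) ^ m * eval (m : ℝ) Q * g) * hid
  · rw [Nat.descFactorial_of_lt (by omega)]; simp

lemma hs_R_zero (s M : ℕ) (h : s ≤ M) :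
    ∑ m ∈ range (M + 1), (-1 : ℝ) ^ m / ((M - m).factorial * (2 * m + 1).factorial) *
      (if s ≤ m then hsCd m (2 * m) / ((m - s).factorial : ℝ) else 0) =
      (-1) ^ s * Real.Gamma (s + 1 / 2) / (2 * Real.Gamma (M + 3 / 2)) := by
  obtain ⟨N, rfl⟩ := Nat.exists_eq_add_of_le h
  rw [add_assoc, Finset.sum_range_add]
  rw [Finset.sum_eq_zero (s := range s), zero_add]
  · have hg := hs_gamma N (s + 1 / 2) (by positivity)
    rw [show (s : ℝ) + 1 / 2 + N + 1 = ((s + N : ℕ) : ℝ) + 3 / 2 by push_cast; ring] at hg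
    have e1 : (N.factorial : ℝ) ≠ 0 := by positivity
    have : (-1 : ℝ) ^ s * Real.Gamma (s + 1 / 2) / (2 * Real.Gamma (((s + N : ℕ) : ℝ) + 3 / 2))
      = (-1) ^ s / (2 * N.factorial) *
        (N.factorial * Real.Gamma (s + 1 / 2) / Real.Gamma (((s + N : ℕ) : ℝ) + 3 / 2)) := by
      field_simp
    rw [this, ← hg, Finset.mul_sum]
    refine Finset.sum_congr rfl fun l hl => ?_
    have hl' : l ≤ N := by simpa [Nat.lt_succ_iff] using hl
    rw [if_pos (by omega), hs_cd_eq, Nat.add_sub_cancel_left, Nat.add_sub_add_left,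
      Nat.factorial_succ, Nat.cast_choose ℝ hl', pow_add]
    push_cast
    have e2 : (s : ℝ) + 1 / 2 + l ≠ 0 := by positivity
    have e3 : 2 * ((s : ℝ) + l) + 1 ≠ 0 := by positivity
    field_simp
    ring
  · intro m hm
    rw [if_neg (by simpa using hm), mul_zero]

open Polynomial in
lemma hs_P (α : ℕ) (hα : 1 ≤ α) (z : ℝ) : ∏ β ∈ range α, (z ^ 2 - (β : ℝ) ^ 2) =
    ∑ s ∈ Icc 1 α, Kodd α s * z ^ (2 * s) := by
  let p : ℝ[X] := ∏ β ∈ range α, (X - C ((β : ℝ) ^ 2))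
  have hp : (∏ β ∈ range α, ((X : ℝ[X]) ^ 2 - C ((β : ℝ) ^ 2))) = expand ℝ 2 p := by
    simp [p, map_prod]
  have hK : ∀ s, Kodd α s = p.coeff s := by
    intro s
    rw [Kodd, hp, mul_comm, coeff_expand_mul (by norm_num)]
  have hd : p.natDegree = α := by
    rw [natDegree_prod_of_monic _ _ fun i _ => monic_X_sub_C _]
    simp only [natDegree_X_sub_C]
    simp
  have h0 : p.coeff 0 = 0 := by
    rw [coeff_zero_eq_eval_zero, eval_prod]
    exact Finset.prod_eq_zero (i := 0) (Finset.mem_range.2 hα) (by simp)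
  have h1 : ∏ β ∈ range α, (z ^ 2 - (β : ℝ) ^ 2) = p.eval (z ^ 2) := by
    simp [p, eval_prod]
  rw [h1, eval_eq_sum_range, hd, Finset.sum_range_succ', h0, zero_mul, add_zero,
    Finset.range_eq_Ico, Finset.sum_Ico_add' (fun s => p.coeff s * (z ^ 2) ^ s) 0 α 1]
  refine Finset.sum_congr rfl fun s _ => ?_
  rw [hK, pow_mul]

lemma hs_prod (z b : ℕ) (h : b < z) : (∏ β ∈ range (b + 1), ((z : ℝ) ^ 2 - (β : ℝ) ^ 2)) *
    ((z - (b + 1)).factorial : ℝ) = z * (z + b).factorial := by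
  induction b with
  | zero =>
    obtain ⟨t, rfl⟩ := Nat.exists_eq_add_of_lt h
    simp [Nat.factorial_succ]
    ring
  | succ b ih =>
    have ih := ih (by omega)
    obtain ⟨t, rfl⟩ := Nat.exists_eq_add_of_lt h
    rw [Finset.prod_range_succ]
    rw [show b + 1 + t + 1 - (b + 1) = t + 1 by omega, Nat.factorial_succ] at ih
    rw [show b + 1 + t + 1 - (b + 1 + 1) = t by omega,
      show b + 1 + t + 1 + (b + 1) = (b + 1 + t + 1 + b) + 1 by omega, Nat.factorial_succ]
    push_cast at ih ⊢
    linear_combination (2 * (b : ℝ) + t + 3) * ih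

lemma hs_mu (k α : ℕ) (hk : 1 ≤ k) (hα : 1 ≤ α) : sphMu k (2 * α + 1) =
    2 / ((2 * α).factorial : ℝ) * ∏ β ∈ range α, (((k : ℝ) + α) ^ 2 - (β : ℝ) ^ 2) := by
  obtain ⟨b, rfl⟩ := Nat.exists_eq_add_of_le' hα
  have h := hs_prod (k + (b + 1)) b (by omega)
  rw [sphMu, if_neg (by omega)]
  rw [show k + (b + 1) - (b + 1) = k by omega] at h
  rw [show k + (2 * (b + 1) + 1) - 2 = k + (b + 1) + b by omega, Nat.add_sub_cancel]
  have e1 : (k.factorial : ℝ) ≠ 0 := by positivity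
  push_cast at h ⊢
  field_simp
  linear_combination -2 * h

lemma hs_inner (α j : ℕ) (f : ℝ → ℝ) (hf : ∀ z, f (-z) = f z) (h0 : ∀ i ≤ 2 * α, f ((α : ℝ) - (i : ℕ)) = 0) :
    ∑ i ∈ range (2 * (j + α) + 1), (-1 : ℝ) ^ i * ((2 * (j + α)).choose i : ℝ) * f (((j + α : ℕ) : ℝ) - i)
    = 2 * (-1) ^ j * ∑ k ∈ Icc 1 j, (-1) ^ k * ((2 * (j + α)).choose (j - k) : ℝ) * f (k + α) := by
  rw [show 2 * (j + α) + 1 = j + (2 * α + 1) + j by ring, Finset.sum_range_add, Finset.sum_range_add]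
  have h1 : ∑ x ∈ range (2 * α + 1), (-1 : ℝ) ^ (j + x) * ((2 * (j + α)).choose (j + x) : ℝ) *
      f (((j + α : ℕ) : ℝ) - (j + x : ℕ)) = 0 := by
    refine Finset.sum_eq_zero fun i hi => ?_
    have hi' : i ≤ 2 * α := by simpa [Nat.lt_succ_iff] using hi
    rw [show ((j + α : ℕ) : ℝ) - (j + i : ℕ) = α - i by push_cast; ring, h0 i hi', mul_zero]
  have hs : ∑ k ∈ Icc 1 j, (-1 : ℝ) ^ k * ((2 * (j + α)).choose (j - k) : ℝ) * f (k + α)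
     = ∑ k ∈ range j, (-1 : ℝ) ^ (k + 1) * ((2 * (j + α)).choose (j - (k + 1)) : ℝ) * f ((k + 1 : ℕ) + α) := by
    rw [Finset.range_eq_Ico, Finset.sum_Ico_add' (fun k : ℕ => (-1 : ℝ) ^ k * ((2 * (j + α)).choose (j - k) : ℝ) * f (k + α)) 0 j 1]
    rfl
  have h2 : ∑ x ∈ range j, (-1 : ℝ) ^ x * ((2 * (j + α)).choose x : ℝ) * f (((j + α : ℕ) : ℝ) - x)
     = (-1) ^ j * ∑ k ∈ Icc 1 j, (-1 : ℝ) ^ k * ((2 * (j + α)).choose (j - k) : ℝ) * f (k + α) := by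
    rw [hs, ← Finset.sum_range_reflect, Finset.mul_sum]
    refine Finset.sum_congr rfl fun k hk => ?_
    have hk' : k < j := by simpa using hk
    obtain ⟨t, rfl⟩ := Nat.exists_eq_add_of_lt hk'
    rw [show k + t + 1 - 1 - k = t by omega, show k + t + 1 - (k + 1) = t by omega,
      show ((k + t + 1 + α : ℕ) : ℝ) - t = (k + 1 : ℕ) + α by push_cast; ring]
    have : (-1 : ℝ) ^ (k + t + 1) * (-1) ^ (k + 1) = (-1) ^ t := by
      rw [← pow_add, show k + t + 1 + (k + 1) = 2 * (k + 1) + t by ring, pow_add, pow_mul]; simp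
    rw [← this]; ring
  have h3 : ∑ x ∈ range j, (-1 : ℝ) ^ (j + (2 * α + 1) + x) * ((2 * (j + α)).choose (j + (2 * α + 1) + x) : ℝ) *
      f (((j + α : ℕ) : ℝ) - (j + (2 * α + 1) + x : ℕ))
     = (-1) ^ j * ∑ k ∈ Icc 1 j, (-1 : ℝ) ^ k * ((2 * (j + α)).choose (j - k) : ℝ) * f (k + α) := by
    rw [hs, Finset.mul_sum]
    refine Finset.sum_congr rfl fun k hk => ?_
    have hk' : k < j := by simpa using hk
    rw [show ((j + α : ℕ) : ℝ) - (j + (2 * α + 1) + k : ℕ) = - ((k + 1 : ℕ) + α) by push_cast; ring, hf]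
    rw [← Nat.choose_symm (n := 2 * (j + α)) (k := j - (k + 1)) (by omega)]
    rw [show 2 * (j + α) - (j - (k + 1)) = j + (2 * α + 1) + k by omega]
    have : (-1 : ℝ) ^ (j + (2 * α + 1) + k) = (-1) ^ j * (-1) ^ (k + 1) := by
      rw [← pow_add, show j + (2 * α + 1) + k = 2 * α + (j + (k + 1)) by ring, pow_add, pow_mul]; simp
    rw [this]; ring
  rw [h1, h2, h3]; ring

/-- central difference of the full polynomial -/
noncomputable def hsE (α m l : ℕ) : ℝ :=
  ∑ i ∈ range (2 * m + 1), (-1 : ℝ) ^ i * ((2 * m).choose i : ℝ) *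
    ((∏ β ∈ range α, (((m : ℝ) - i) ^ 2 - (β : ℝ) ^ 2)) * (((m : ℝ) - i) ^ 2 - (α : ℝ) ^ 2) ^ l)

lemma hs_E_expand (α m l : ℕ) (hα : 1 ≤ α) : hsE α m l = ∑ s ∈ Icc 1 α, ∑ q ∈ range (l + 1),
    Kodd α s * ((-(α : ℝ) ^ 2) ^ q * (l.choose q : ℝ) * hsCd m (2 * s + 2 * (l - q))) := by
  unfold hsE
  have h : ∀ z : ℝ, (∏ β ∈ range α, (z ^ 2 - (β : ℝ) ^ 2)) * (z ^ 2 - (α : ℝ) ^ 2) ^ l =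
      ∑ s ∈ Icc 1 α, ∑ q ∈ range (l + 1),
        Kodd α s * ((-(α : ℝ) ^ 2) ^ q * (l.choose q : ℝ) * z ^ (2 * s + 2 * (l - q))) := by
    intro z
    rw [hs_P α hα, show z ^ 2 - (α : ℝ) ^ 2 = -(α : ℝ) ^ 2 + z ^ 2 by ring, add_pow, Finset.sum_mul_sum]
    refine Finset.sum_congr rfl fun s _ => Finset.sum_congr rfl fun q _ => ?_
    rw [pow_add, pow_mul z 2 (l - q)]; ring
  simp only [h, Finset.mul_sum]
  rw [Finset.sum_comm]
  refine Finset.sum_congr rfl fun s _ => ?_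
  rw [Finset.sum_comm]
  refine Finset.sum_congr rfl fun q _ => ?_
  rw [hsCd, Finset.mul_sum, Finset.mul_sum]
  refine Finset.sum_congr rfl fun i _ => ?_
  ring

lemma hs_van (α : ℕ) (z : ℝ) (β : ℕ) (hβ : β ≤ α) (l : ℕ) (hz : z ^ 2 = (β : ℝ) ^ 2) (hl : β = α → l ≠ 0) :
    (∏ β ∈ range α, (z ^ 2 - (β : ℝ) ^ 2)) * (z ^ 2 - (α : ℝ) ^ 2) ^ l = 0 := by
  rcases eq_or_lt_of_le hβ with h | h
  · rw [hz, h, sub_self, zero_pow (hl h), mul_zero]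
  · rw [Finset.prod_eq_zero (i := β) (by simpa using h) (by rw [hz, sub_self]), zero_mul]

lemma hs_van_int (α m : ℕ) (i : ℕ) (hi : i ≤ 2 * m) :
    ∃ β : ℕ, β ≤ m ∧ ((m : ℝ) - i) ^ 2 = (β : ℝ) ^ 2 := by
  rcases le_total i m with h | h
  · exact ⟨m - i, by omega, by rw [Nat.cast_sub h]⟩
  · exact ⟨i - m, by omega, by rw [Nat.cast_sub h]; ring⟩

lemma hs_E_zero (α m l : ℕ) (hm : m ≤ α) (hl : m = α → l ≠ 0) : hsE α m l = 0 := by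
  unfold hsE
  refine Finset.sum_eq_zero fun i hi => ?_
  obtain ⟨β, hβ, hz⟩ := hs_van_int α m i (by simpa [Nat.lt_succ_iff] using hi)
  rw [hs_van α _ β (hβ.trans hm) l hz (fun h => hl (by omega)), mul_zero]

lemma hs_E_inner (α j l : ℕ) (hα : 1 ≤ α) (hl : l ≠ 0) :
    2 * ∑ k ∈ Icc 1 j, (-1 : ℝ) ^ k * (Nat.choose (2 * j + (2 * α + 1) - 1) (j - k)) *
      sphMu k (2 * α + 1) * (sphLam k (2 * α + 1) : ℝ) ^ l =
    2 / ((2 * α).factorial : ℝ) * (-1) ^ j * hsE α (j + α) l := by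
  have h := hs_inner α j (fun z => (∏ β ∈ range α, (z ^ 2 - (β : ℝ) ^ 2)) * (z ^ 2 - (α : ℝ) ^ 2) ^ l)
    (fun z => by simp) (fun i hi => by
      obtain ⟨β, hβ, hz⟩ := hs_van_int α α i hi
      exact hs_van α _ β hβ l hz (fun _ => hl))
  rw [hsE, h]
  have hj : (-1 : ℝ) ^ j * (-1) ^ j = 1 := by rw [← mul_pow]; simp
  have : ∀ S : ℝ, 2 / ((2 * α).factorial : ℝ) * (-1) ^ j * (2 * (-1) ^ j * S)
    = 2 * (2 / ((2 * α).factorial : ℝ) * S) := by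
    intro S
    linear_combination (2 / ((2 * α).factorial : ℝ) * 2 * S) * hj
  rw [this]
  congr 1
  rw [Finset.mul_sum]
  refine Finset.sum_congr rfl fun k hk => ?_
  have hk1 : 1 ≤ k := (Finset.mem_Icc.1 hk).1
  rw [hs_mu k α hk1 hα, show 2 * j + (2 * α + 1) - 1 = 2 * (j + α) by omega]
  have : (sphLam k (2 * α + 1) : ℝ) = ((k : ℝ) + α) ^ 2 - (α : ℝ) ^ 2 := by
    rw [sphLam, show k + (2 * α + 1) - 1 = k + 2 * α by omega]; push_cast; ring
  rw [this]; ring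

/-- the m-th term after re-indexing by m = j + α -/
noncomputable def hsTerm (α n M m : ℕ) : ℝ :=
  if α ≤ m + n then (-1 : ℝ) ^ m / ((M - m).factorial * (2 * m + 1).factorial) *
    (hsE α m (m + n - α) / (m + n - α).factorial) else 0

lemma hs_A (α n ω : ℕ) (hα : 1 ≤ α) (hn : 1 ≤ n) : A n (2 * α + 1) ω =
    2 * (-1) ^ n * (-1) ^ α * Real.Gamma (((ω + α : ℕ) : ℝ) + 3 / 2) / ((2 * α).factorial : ℝ) *
      ∑ m ∈ range (ω + α + 1), hsTerm α n (ω + α) m := by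
  rw [show ω + α + 1 = (α + 1) + ω by ring, Finset.sum_range_add,
    Finset.sum_eq_zero (s := range (α + 1)), zero_add]
  · rw [Finset.mul_sum]
    have hA : A n (2 * α + 1) ω = ∑ x ∈ range ω,
      (2 * (-1 : ℝ) ^ n * Real.Gamma ((ω : ℝ) + (2 * α + 1 : ℕ) / 2 + 1) /
        (Nat.factorial (ω - (x + 1)) * Nat.factorial (x + 1 + n) * Nat.factorial (2 * (x + 1) + (2 * α + 1)))) *
      ∑ k ∈ Icc 1 (x + 1), (-1 : ℝ) ^ k * (Nat.choose (2 * (x + 1) + (2 * α + 1) - 1) (x + 1 - k)) *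
        sphMu k (2 * α + 1) * (sphLam k (2 * α + 1) : ℝ) ^ (x + 1 + n) := by
      rw [A, Finset.range_eq_Ico, Finset.sum_Ico_add' (fun j : ℕ =>
        (2 * (-1 : ℝ) ^ n * Real.Gamma ((ω : ℝ) + (2 * α + 1 : ℕ) / 2 + 1) /
        (Nat.factorial (ω - j) * Nat.factorial (j + n) * Nat.factorial (2 * j + (2 * α + 1)))) *
      ∑ k ∈ Icc 1 j, (-1 : ℝ) ^ k * (Nat.choose (2 * j + (2 * α + 1) - 1) (j - k)) *
        sphMu k (2 * α + 1) * (sphLam k (2 * α + 1) : ℝ) ^ (j + n)) 0 ω 1]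
      rfl
    rw [hA]
    refine Finset.sum_congr rfl fun x hx => ?_
    have h := hs_E_inner α (x + 1) (x + 1 + n) hα (by omega)
    rw [hsTerm, if_pos (by omega), show α + 1 + x + n - α = x + 1 + n by omega,
      show ω + α - (α + 1 + x) = ω - (x + 1) by omega,
      show 2 * (α + 1 + x) + 1 = 2 * (x + 1) + (2 * α + 1) by ring,
      show α + 1 + x = x + 1 + α by ring,
      show (ω : ℝ) + (2 * α + 1 : ℕ) / 2 + 1 = ((ω + α : ℕ) : ℝ) + 3 / 2 by push_cast; ring]
    generalize ∑ k ∈ Icc 1 (x + 1), (-1 : ℝ) ^ k * (Nat.choose (2 * (x + 1) + (2 * α + 1) - 1) (x + 1 - k)) *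
        sphMu k (2 * α + 1) * (sphLam k (2 * α + 1) : ℝ) ^ (x + 1 + n) = S at *
    have hS : S = 1 / ((2 * α).factorial : ℝ) * (-1) ^ (x + 1) * hsE α (x + 1 + α) (x + 1 + n) := by
      linear_combination h / 2
    have ha : (-1 : ℝ) ^ α * (-1) ^ α = 1 := by rw [← mul_pow]; simp
    rw [hS, pow_add _ (x + 1) α]
    generalize (-1 : ℝ) ^ α = u at *
    generalize Real.Gamma (((ω + α : ℕ) : ℝ) + 3 / 2) = G
    field_simp
    linear_combination (-G * hsE α (x + 1 + α) (x + 1 + n)) * ha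
  · intro m hm
    have hm' : m ≤ α := by simpa [Nat.lt_succ_iff] using hm
    rw [hsTerm]
    split_ifs
    · rw [hs_E_zero α m _ hm' (by omega)]; simp
    · rfl

/-- one summand, for fixed s and q -/
noncomputable def hsU (α n M s q m : ℕ) : ℝ :=
  (-1 : ℝ) ^ m / ((M - m).factorial * (2 * m + 1).factorial) *
    (if α + q ≤ m + n then hsCd m (2 * s + 2 * (m + n - α - q)) / ((m + n - α - q).factorial : ℝ) else 0)

lemma hs_term (α n ω m : ℕ) (hα : 1 ≤ α) (hm : m ≤ ω + α) : hsTerm α n (ω + α) m =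
    ∑ s ∈ Icc 1 α, ∑ q ∈ range (ω + n + 1),
      Kodd α s * ((-(α : ℝ) ^ 2) ^ q / q.factorial) * hsU α n (ω + α) s q m := by
  rw [hsTerm]
  split_ifs with h
  · rw [hs_E_expand α m _ hα, Finset.sum_div, Finset.mul_sum]
    refine Finset.sum_congr rfl fun s _ => ?_
    rw [Finset.sum_div, Finset.mul_sum]
    have hsub : range (m + n - α + 1) ⊆ range (ω + n + 1) := by
      intro q; simp only [Finset.mem_range]; omega
    rw [← Finset.sum_subset hsub]
    · refine Finset.sum_congr rfl fun q hq => ?_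
      have hq' : q ≤ m + n - α := by simpa [Nat.lt_succ_iff] using hq
      rw [hsU, if_pos (by omega), Nat.cast_choose ℝ hq']
      have e1 : ((m + n - α).factorial : ℝ) ≠ 0 := by positivity
      field_simp
    · intro q _ hq
      simp only [Finset.mem_range] at hq
      rw [hsU, if_neg (by omega)]; simp
  · symm
    refine Finset.sum_eq_zero fun s _ => Finset.sum_eq_zero fun q _ => ?_
    rw [hsU, if_neg (by omega)]; simp

lemma hs_U_sum (α n ω s q : ℕ) (hs : s ≤ α) (hω : 2 * n ≤ ω) :
    ∑ m ∈ range (ω + α + 1), hsU α n (ω + α) s q m = if α + q = s + n then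
      (-1) ^ s * Real.Gamma (s + 1 / 2) / (2 * Real.Gamma (((ω + α : ℕ) : ℝ) + 3 / 2)) else 0 := by
  rcases lt_trichotomy (α + q) (s + n) with h | h | h
  · rw [if_neg h.ne]
    obtain ⟨f, hf⟩ := Nat.exists_eq_add_of_lt h
    rw [← hs_R_pos s f (ω + α) (by omega)]
    refine Finset.sum_congr rfl fun m _ => ?_
    rw [hsU]
    congr 1
    by_cases hc : α + q ≤ m + n
    · rw [if_pos hc, if_pos (by omega), show m + n - α - q = m + (f + 1) - s by omega,
        show 2 * s + 2 * (m + (f + 1) - s) = 2 * m + 2 * (f + 1) by omega]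
    · rw [if_neg hc, if_neg (by omega)]
  · rw [if_pos h, ← hs_R_zero s (ω + α) (by omega)]
    refine Finset.sum_congr rfl fun m _ => ?_
    rw [hsU]
    congr 1
    by_cases hc : α + q ≤ m + n
    · rw [if_pos hc, if_pos (by omega), show m + n - α - q = m - s by omega,
        show 2 * s + 2 * (m - s) = 2 * m by omega]
    · rw [if_neg hc, if_neg (by omega)]
  · rw [if_neg h.ne']
    refine Finset.sum_eq_zero fun m _ => ?_
    rw [hsU]
    split_ifs
    · rw [hs_cd_lt _ _ (by omega)]; simp
    · simp

/-- the heat invariants of odd spheres,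
`A_{n,2α+1}(ω) = Σ_{s=1}^{α} α^{2n-2α+2s} Γ(s+1/2) K_s^α /((n-α+s)!(2α)!)`,
where `1/(n-α+s)! = 1/Γ(n-α+s+1)` vanishes for `n-α+s < 0`. -/
theorem heat_invariants_odd_spheres (α n ω : ℕ) (hα : 1 ≤ α) (hn : 1 ≤ n)
    (hω : 2 * n ≤ ω) :
    A n (2 * α + 1) ω =
      ∑ s ∈ Finset.Icc 1 α,
        (α : ℝ) ^ (2 * (n : ℤ) - 2 * (α : ℤ) + 2 * (s : ℤ)) *
          Real.Gamma ((s : ℝ) + 1 / 2) * Kodd α s /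
            (Real.Gamma ((n : ℝ) - (α : ℝ) + (s : ℝ) + 1) * Nat.factorial (2 * α)) := by
  rw [hs_A α n ω hα hn]
  have h1 : ∑ m ∈ range (ω + α + 1), hsTerm α n (ω + α) m = ∑ s ∈ Icc 1 α, ∑ q ∈ range (ω + n + 1),
      Kodd α s * ((-(α : ℝ) ^ 2) ^ q / q.factorial) *
        ∑ m ∈ range (ω + α + 1), hsU α n (ω + α) s q m := by
    rw [Finset.sum_congr rfl fun m hm => hs_term α n ω m hα (by
      simpa [Nat.lt_succ_iff] using hm), Finset.sum_comm]
    refine Finset.sum_congr rfl fun s _ => ?_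
    rw [Finset.sum_comm]
    refine Finset.sum_congr rfl fun q _ => ?_
    rw [Finset.mul_sum]
  rw [h1, Finset.mul_sum]
  refine Finset.sum_congr rfl fun s hs => ?_
  obtain ⟨hs1, hs2⟩ := Finset.mem_Icc.1 hs
  have hG : Real.Gamma (((ω + α : ℕ) : ℝ) + 3 / 2) ≠ 0 :=
    (Real.Gamma_pos_of_pos (by positivity)).ne'
  by_cases hc : α ≤ s + n
  · obtain ⟨q₀, hq₀⟩ := Nat.exists_eq_add_of_le hc
    rw [Finset.sum_eq_single q₀]
    · rw [hs_U_sum α n ω s q₀ hs2 hω, if_pos hq₀.symm]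
      have e1 : (n : ℝ) - α + s + 1 = (q₀ : ℝ) + 1 := by
        have : (s : ℝ) + n = α + q₀ := by exact_mod_cast hq₀
        linarith
      have e2 : 2 * (n : ℤ) - 2 * (α : ℤ) + 2 * (s : ℤ) = ((2 * q₀ : ℕ) : ℤ) := by
        push_cast; omega
      rw [e1, e2, Real.Gamma_nat_eq_factorial, zpow_natCast, neg_pow ((α : ℝ) ^ 2), ← pow_mul]
      have hsgn : (-1 : ℝ) ^ n * (-1) ^ α * (-1) ^ q₀ * (-1) ^ s = 1 := by
        rw [← pow_add, ← pow_add, ← pow_add]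
        exact Even.neg_one_pow ⟨s + n, by omega⟩
      generalize Real.Gamma (((ω + α : ℕ) : ℝ) + 3 / 2) = G at *
      generalize (-1 : ℝ) ^ n = u1 at *
      generalize (-1 : ℝ) ^ α = u2 at *
      generalize (-1 : ℝ) ^ q₀ = u3 at *
      generalize (-1 : ℝ) ^ s = u4 at *
      generalize Real.Gamma ((s : ℝ) + 1 / 2) = g at *
      generalize Kodd α s = K at *
      generalize (α : ℝ) ^ (2 * q₀) = p at *
      field_simp
      linear_combination (g * K * p) * hsgn
    · intro q _ hq
      rw [hs_U_sum α n ω s q hs2 hω, if_neg (by omega), mul_zero]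
    · intro h
      exact absurd (Finset.mem_range.2 (by omega)) h
  · rw [Finset.sum_eq_zero fun q _ => by
      rw [hs_U_sum α n ω s q hs2 hω, if_neg (by omega), mul_zero]]
    obtain ⟨t, ht⟩ := Nat.exists_eq_add_of_lt (not_le.1 hc)
    have e1 : (n : ℝ) - α + s + 1 = -(t : ℝ) := by
      have : (α : ℝ) = s + n + t + 1 := by exact_mod_cast ht
      linarith
    rw [e1, Real.Gamma_neg_nat_eq_zero]
    simp
end

section
/- For all integers n ≥ 1 and ω ≥ 2n: A_{n,5}(ω) = 4^{n-3}(6-n)√π / (3 · n!). -/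
open Finset

/-! ### Alternating binomial sums -/

/-- Alternating binomial sum. -/
noncomputable def altSum (N : ℕ) (f : ℕ → ℝ) : ℝ :=
  ∑ J ∈ range (N + 1), (-1 : ℝ) ^ J * (N.choose J : ℝ) * f J

lemma altSum_succ (N : ℕ) (f : ℕ → ℝ) :
    altSum (N + 1) f = altSum N f - altSum N (fun J => f (J + 1)) := by
  unfold altSum
  rw [Finset.sum_range_succ']
  simp only [Nat.choose_succ_succ, Nat.cast_add, mul_add, add_mul, Finset.sum_add_distrib]
  have h1 : ∑ J ∈ range (N + 1), (-1 : ℝ) ^ J * (N.choose J : ℝ) * f J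
      = ∑ J ∈ range (N + 1), (-1 : ℝ) ^ (J + 1) * (N.choose (J + 1) : ℝ) * f (J + 1)
        + f 0 := by
    have := Finset.sum_range_succ' (fun J => (-1 : ℝ) ^ J * (N.choose J : ℝ) * f J) (N + 1)
    rw [Finset.sum_range_succ] at this
    simpa using this
  rw [h1]
  simp only [pow_succ, Nat.choose_zero_right]
  have : ∑ x ∈ range (N + 1), (-1 : ℝ) ^ x * -1 * (N.choose x : ℝ) * f (x + 1)
      = - ∑ x ∈ range (N + 1), (-1 : ℝ) ^ x * (N.choose x : ℝ) * f (x + 1) := by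
    rw [← Finset.sum_neg_distrib]
    exact Finset.sum_congr rfl fun x _ => by ring
  rw [this]
  simp
  ring

lemma altSum_inv (N : ℕ) : ∀ x : ℝ, 0 < x →
    altSum N (fun J => 1 / (x + J)) * Real.Gamma (x + N + 1) = N.factorial * Real.Gamma x := by
  induction N with
  | zero =>
    intro x hx
    simp [altSum, Real.Gamma_add_one hx.ne']
    field_simp
  | succ N ih =>
    intro x hx
    rw [altSum_succ]
    have h1 := ih x hx
    have h2 := ih (x + 1) (by linarith)
    have e : (fun J : ℕ => 1 / (x + ((J + 1 : ℕ) : ℝ))) = fun J : ℕ => 1 / (x + 1 + (J : ℝ)) := by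
      funext J; push_cast; ring_nf
    rw [e, sub_mul]
    have g : Real.Gamma (x + (N + 1 : ℕ) + 1) = (x + N + 1) * Real.Gamma (x + N + 1) := by
      rw [← Real.Gamma_add_one (by positivity)]; push_cast; ring_nf
    have g2 : Real.Gamma (x + (N + 1 : ℕ) + 1) = Real.Gamma (x + 1 + N + 1) := by
      push_cast; ring_nf
    rw [g2, h2, ← g2, g, Real.Gamma_add_one hx.ne', Nat.factorial_succ]
    push_cast
    linear_combination (x + N + 1) * h1

lemma altSum_poly (N : ℕ) (P : Polynomial ℝ) (h : P.natDegree < N) :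
    altSum N (fun J => P.eval (J : ℝ)) = 0 := by
  have h1 := congrFun (Polynomial.fwdDiff_iter_eq_zero_of_degree_lt h) 0
  rw [fwdDiff_iter_eq_sum_shift] at h1
  simp only [Pi.zero_apply, zero_add, nsmul_eq_mul, mul_one, zsmul_eq_mul] at h1
  push_cast at h1
  have : altSum N (fun J => P.eval (J : ℝ)) = (-1) ^ N *
      ∑ x ∈ range (N + 1), (-1 : ℝ) ^ (N - x) * (N.choose x : ℝ) * Polynomial.eval (x : ℝ) P := by
    unfold altSum
    rw [Finset.mul_sum]
    refine Finset.sum_congr rfl fun x hx => ?_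
    have hx' : x ≤ N := by simpa [Nat.lt_succ_iff] using hx
    obtain ⟨y, rfl⟩ := Nat.exists_eq_add_of_le hx'
    have : (-1 : ℝ) ^ (x + y) * (-1) ^ (x + y - x) = (-1) ^ x := by
      rw [Nat.add_sub_cancel_left, pow_add, mul_assoc, ← mul_pow]; simp
    rw [← mul_assoc, ← mul_assoc, this]
  rw [this, h1, mul_zero]

lemma altSum_add (N : ℕ) (f g : ℕ → ℝ) :
    altSum N (fun J => f J + g J) = altSum N f + altSum N g := by
  simp [altSum, mul_add, Finset.sum_add_distrib]

lemma altSum_mul (N : ℕ) (c : ℝ) (f : ℕ → ℝ) :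
    altSum N (fun J => c * f J) = c * altSum N f := by
  simp only [altSum, Finset.mul_sum]
  exact Finset.sum_congr rfl fun x _ => by ring

lemma altSum_sum (N M : ℕ) (f : ℕ → ℕ → ℝ) :
    altSum N (fun J => ∑ t ∈ range M, f t J) = ∑ t ∈ range M, altSum N (f t) := by
  simp only [altSum, Finset.mul_sum]
  rw [Finset.sum_comm]

/-! ### The power series of `2 sinh (x/2)` -/

open PowerSeries in
/-- The series `2 sinh (x/2)`. -/
noncomputable def serE : PowerSeries ℝ :=
  rescale (1 / 2 : ℝ) (exp ℝ) - rescale (-1 / 2 : ℝ) (exp ℝ)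

/-- The series `2 sinh (x/2) / x`. -/
noncomputable def serG : PowerSeries ℝ := PowerSeries.mk fun k => PowerSeries.coeff (k + 1) serE

lemma serE_eq : serE = PowerSeries.X * serG := by
  ext k
  cases k with
  | zero => rw [PowerSeries.coeff_zero_X_mul]; simp [serE, PowerSeries.coeff_rescale, -PowerSeries.coeff_zero_eq_constantCoeff]
  | succ k => rw [PowerSeries.coeff_succ_X_mul]; simp [serG]

lemma serG_dvd : (PowerSeries.X : PowerSeries ℝ) ^ 2 ∣ serG - 1 := by
  rw [PowerSeries.X_pow_dvd_iff]
  intro m hm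
  interval_cases m
  · simp [serG, serE, PowerSeries.coeff_rescale, PowerSeries.coeff_exp]; norm_num
  · simp [serG, serE, PowerSeries.coeff_rescale, PowerSeries.coeff_exp, PowerSeries.coeff_one]; norm_num

lemma rescale_exp_pow (a : ℝ) (k : ℕ) :
    (PowerSeries.rescale a (PowerSeries.exp ℝ)) ^ k
      = PowerSeries.rescale (a * k) (PowerSeries.exp ℝ) := by
  rw [← map_pow, PowerSeries.exp_pow_eq_rescale_exp, PowerSeries.rescale_rescale, mul_comm]

/-- Central difference of a power. -/
noncomputable def cen (J r : ℕ) : ℝ :=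
  ∑ i ∈ range (2 * J + 1), (-1 : ℝ) ^ i * ((2 * J).choose i : ℝ) * ((J : ℝ) - i) ^ (2 * r)

lemma cen_eq_coeff (J r : ℕ) :
    cen J r = (2 * r).factorial * PowerSeries.coeff (2 * r) (serE ^ (2 * J)) := by
  have h : serE ^ (2 * J) = ∑ i ∈ range (2 * J + 1),
      PowerSeries.C ((-1 : ℝ) ^ i * ((2 * J).choose i : ℝ)) *
        PowerSeries.rescale ((J : ℝ) - i) (PowerSeries.exp ℝ) := by
    rw [serE, sub_eq_neg_add, add_pow]
    refine Finset.sum_congr rfl fun i hi => ?_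
    have hi' : i ≤ 2 * J := by simpa [Nat.lt_succ_iff] using hi
    rw [neg_pow, rescale_exp_pow, rescale_exp_pow, mul_assoc ((-1) ^ i),
      PowerSeries.exp_mul_exp_eq_exp_add, Nat.cast_sub hi']
    have : (-1 / 2 * (i : ℝ) + 1 / 2 * (((2 * J : ℕ) : ℝ) - i)) = (J : ℝ) - i := by
      push_cast; ring
    rw [this]
    simp
    ring
  rw [h, map_sum, Finset.mul_sum, cen]
  refine Finset.sum_congr rfl fun i _ => ?_
  rw [PowerSeries.coeff_C_mul, PowerSeries.coeff_rescale, PowerSeries.coeff_exp]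
  have := Nat.factorial_ne_zero (2 * r)
  simp
  field_simp

lemma cen_lt (J r : ℕ) (h : r < J) : cen J r = 0 := by
  rw [cen_eq_coeff, serE_eq, mul_pow, PowerSeries.coeff_X_pow_mul', if_neg (by omega), mul_zero]

lemma cen_ge (J s : ℕ) : cen J (J + s) =
    (2 * (J + s)).factorial * PowerSeries.coeff (2 * s) (serG ^ (2 * J)) := by
  rw [cen_eq_coeff, serE_eq, mul_pow, PowerSeries.coeff_X_pow_mul', if_pos (by omega)]
  congr 3
  omega

lemma coeff_serG_pow (s k : ℕ) : PowerSeries.coeff (2 * s) (serG ^ k) =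
    ∑ i ∈ range (s + 1), (k.choose i : ℝ) * PowerSeries.coeff (2 * s) ((serG - 1) ^ i) := by
  have hz : ∀ i, s < i → PowerSeries.coeff (2 * s) ((serG - 1) ^ i) = 0 := by
    intro i hi
    have : (PowerSeries.X : PowerSeries ℝ) ^ (2 * i) ∣ (serG - 1) ^ i := by
      rw [pow_mul]; exact pow_dvd_pow_of_dvd serG_dvd i
    exact PowerSeries.X_pow_dvd_iff.1 this _ (by omega)
  have h : serG ^ k = ∑ i ∈ range (k + 1), PowerSeries.C (k.choose i : ℝ) * (serG - 1) ^ i := by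
    conv_lhs => rw [← sub_add_cancel serG 1, add_pow]
    refine Finset.sum_congr rfl fun i _ => ?_
    simp [mul_comm]
  rw [h, map_sum]
  simp only [PowerSeries.coeff_C_mul]
  rw [← Finset.sum_subset (s₁ := range (min k s + 1)), ← Finset.sum_subset (s₁ := range (min k s + 1))
    (s₂ := range (s + 1))]
  · intro x hx; simp at *; omega
  · intro x hx hx'
    simp at hx hx'
    rw [Nat.choose_eq_zero_of_lt (by omega)]; simp
  · intro x hx; simp at *; omega
  · intro x hx hx'
    simp at hx hx'
    rw [hz x (by omega)]; simp

/-- The polynomial part. -/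
noncomputable def pp (s J : ℕ) : ℝ :=
  2 ^ s * (∏ l ∈ range s, (2 * (J : ℝ) + 2 * l + 1)) *
    PowerSeries.coeff (2 * s) (serG ^ (2 * J))

lemma fact_ratio (J s : ℕ) : ((2 * (J + s)).factorial : ℝ) * J.factorial =
    2 ^ s * (∏ l ∈ range s, (2 * (J : ℝ) + 2 * l + 1)) * (J + s).factorial * (2 * J).factorial := by
  induction s with
  | zero => simp; ring
  | succ s ih =>
    have : 2 * (J + (s + 1)) = 2 * (J + s) + 1 + 1 := by ring
    rw [this, Nat.factorial_succ, Nat.factorial_succ, Finset.prod_range_succ, ← add_assoc J s 1,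
      Nat.factorial_succ (J + s)]
    push_cast
    linear_combination (2 * ((J : ℝ) + s) + 1 + 1) * (2 * ((J : ℝ) + s) + 1) * ih

lemma pp_cen (s J : ℕ) :
    pp s J * ((J + s).factorial * (2 * J).factorial) = cen J (J + s) * J.factorial := by
  rw [cen_ge, pp]
  linear_combination -(PowerSeries.coeff (2 * s) (serG ^ (2 * J))) * fact_ratio J s

lemma pp_zero (J : ℕ) : pp 0 J = 1 := by
  rw [pp, coeff_serG_pow 0 (2 * J)]
  simp

lemma choose_poly (i : ℕ) : ∃ P : Polynomial ℝ, P.natDegree ≤ i ∧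
    ∀ J : ℕ, P.eval (J : ℝ) = ((2 * J).choose i : ℝ) := by
  refine ⟨Polynomial.C (1 / (i.factorial : ℝ)) *
    (descPochhammer ℝ i).comp (Polynomial.C 2 * Polynomial.X), ?_, ?_⟩
  · refine (Polynomial.natDegree_C_mul_le _ _).trans (Polynomial.natDegree_comp_le.trans ?_)
    rw [descPochhammer_natDegree, Polynomial.natDegree_C_mul_X _ two_ne_zero, mul_one]
  · intro J
    rw [Nat.cast_choose_eq_descPochhammer_div]
    simp
    field_simp

lemma pp_poly (s : ℕ) : ∃ P : Polynomial ℝ, P.natDegree ≤ 2 * s + 1 ∧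
    ∀ J : ℕ, P.eval (J : ℝ) * (2 * J + 1) = pp (s + 1) J := by
  choose Q hQ hQ' using choose_poly
  refine ⟨Polynomial.C (2 ^ (s + 1)) *
    (∏ l ∈ range s, (Polynomial.C 2 * Polynomial.X + Polynomial.C (2 * ((l : ℝ) + 1) + 1))) *
    ∑ i ∈ range (s + 1 + 1),
      Polynomial.C (PowerSeries.coeff (2 * (s + 1)) ((serG - 1) ^ i)) * Q i, ?_, ?_⟩
  · refine Polynomial.natDegree_mul_le.trans ?_
    have h1 : (Polynomial.C ((2 : ℝ) ^ (s + 1)) * (∏ l ∈ range s,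
        (Polynomial.C 2 * Polynomial.X + Polynomial.C (2 * ((l : ℝ) + 1) + 1)))).natDegree ≤ s := by
      refine (Polynomial.natDegree_C_mul_le _ _).trans ?_
      refine (Polynomial.natDegree_prod_le _ _).trans ?_
      refine (Finset.sum_le_card_nsmul _ _ 1 fun l _ => ?_).trans (by simp)
      exact Polynomial.natDegree_linear_le
    have h2 : (∑ i ∈ range (s + 1 + 1),
      Polynomial.C (PowerSeries.coeff (2 * (s + 1)) ((serG - 1) ^ i)) * Q i).natDegree ≤ s + 1 := by
      refine Polynomial.natDegree_sum_le_of_forall_le _ _ fun i hi => ?_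
      refine (Polynomial.natDegree_C_mul_le _ _).trans ((hQ i).trans ?_)
      simp at hi; omega
    omega
  · intro J
    rw [pp, coeff_serG_pow, Finset.prod_range_succ']
    simp only [Polynomial.eval_mul, Polynomial.eval_C, Polynomial.eval_prod, Polynomial.eval_add,
      Polynomial.eval_X, Polynomial.eval_finsetSum, hQ']
    have e1 : ∏ j ∈ range s, (2 * (J : ℝ) + (2 * ((j : ℝ) + 1) + 1)) =
        ∏ k ∈ range s, (2 * (J : ℝ) + 2 * ((k + 1 : ℕ) : ℝ) + 1) :=
      Finset.prod_congr rfl fun k _ => by push_cast; ring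
    have e2 : ∑ x ∈ range (s + 1 + 1),
        PowerSeries.coeff (2 * (s + 1)) ((serG - 1) ^ x) * ((2 * J).choose x : ℝ) =
        ∑ i ∈ range (s + 1 + 1), ((2 * J).choose i : ℝ) *
          PowerSeries.coeff (2 * (s + 1)) ((serG - 1) ^ i) :=
      Finset.sum_congr rfl fun k _ => by ring
    rw [e1, e2]
    push_cast
    ring

lemma alt_one (N s : ℕ) (h : 2 * s + 4 ≤ N) : altSum N
    (fun J => ((J : ℝ) + (s + 1)) * (J + s) * pp (s + 1) J / (2 * J + 1)) = 0 := by
  obtain ⟨P, hP, hP'⟩ := pp_poly s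
  rw [← altSum_poly N ((Polynomial.X + Polynomial.C ((s : ℝ) + 1)) *
    (Polynomial.X + Polynomial.C (s : ℝ)) * P)]
  · congr 1
    funext J
    have : (2 * (J : ℝ) + 1) ≠ 0 := by positivity
    rw [← hP']
    simp
    field_simp
  · refine lt_of_le_of_lt Polynomial.natDegree_mul_le ?_
    have := Polynomial.natDegree_mul_le (p := (Polynomial.X + Polynomial.C ((s : ℝ) + 1)))
      (q := (Polynomial.X + Polynomial.C (s : ℝ)))
    rw [Polynomial.natDegree_X_add_C, Polynomial.natDegree_X_add_C] at this
    omega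

lemma alt_two (N s : ℕ) (h : 2 * s + 3 ≤ N) : altSum N
    (fun J => ((J : ℝ) + (s + 1)) * pp (s + 1) J / (2 * J + 1)) = 0 := by
  obtain ⟨P, hP, hP'⟩ := pp_poly s
  rw [← altSum_poly N ((Polynomial.X + Polynomial.C ((s : ℝ) + 1)) * P)]
  · congr 1
    funext J
    have : (2 * (J : ℝ) + 1) ≠ 0 := by positivity
    rw [← hP']
    simp
    field_simp
  · refine lt_of_le_of_lt Polynomial.natDegree_mul_le ?_
    rw [Polynomial.natDegree_X_add_C]
    omega


/-! ### The combination of the polynomial parts -/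

/-- Combination of polynomial parts. -/
noncomputable def Phi (n J : ℕ) : ℝ :=
  ∑ t ∈ range (n + 2), (-4 : ℝ) ^ t / t.factorial *
      (((J : ℝ) + (n + 1 - t : ℕ)) * ((J : ℝ) + (n + 1 - t : ℕ) - 1) * pp (n + 1 - t) J)
  - ∑ t ∈ range (n + 1), (-4 : ℝ) ^ t / t.factorial * (((J : ℝ) + (n - t : ℕ)) * pp (n - t) J)

lemma alt_zero_one (N : ℕ) (h : 2 ≤ N) :
    altSum N (fun J => (J : ℝ) * (J - 1) * pp 0 J / (2 * J + 1)) =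
      3 / 4 * altSum N (fun J => 1 / (2 * (J : ℝ) + 1)) := by
  have h0 := altSum_poly N (Polynomial.C (1 / 2) * Polynomial.X + Polynomial.C (-3 / 4))
    (lt_of_le_of_lt Polynomial.natDegree_linear_le (by omega))
  rw [← altSum_mul, ← add_zero (altSum N (fun J => 3 / 4 * _)), ← h0, ← altSum_add]
  congr 1
  funext J
  have : (2 * (J : ℝ) + 1) ≠ 0 := by positivity
  rw [pp_zero]
  simp
  field_simp
  ring

lemma alt_zero_two (N : ℕ) (h : 2 ≤ N) :
    altSum N (fun J => (J : ℝ) * pp 0 J / (2 * J + 1)) =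
      -1 / 2 * altSum N (fun J => 1 / (2 * (J : ℝ) + 1)) := by
  have h0 := altSum_poly N (Polynomial.C (1 / 2)) (by rw [Polynomial.natDegree_C]; omega)
  rw [← altSum_mul, ← add_zero (altSum N (fun J => -1 / 2 * _)), ← h0, ← altSum_add]
  congr 1
  funext J
  have : (2 * (J : ℝ) + 1) ≠ 0 := by positivity
  rw [pp_zero]
  simp
  field_simp
  ring

lemma alt_Phi (n N : ℕ) (h : 2 * n + 4 ≤ N) :
    altSum N (fun J => Phi n J / (2 * J + 1)) =
      ((-4 : ℝ) ^ (n + 1) / (n + 1).factorial * (3 / 4) + (-4 : ℝ) ^ n / n.factorial * (1 / 2)) *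
        altSum N (fun J => 1 / (2 * (J : ℝ) + 1)) := by
  have e : (fun J : ℕ => Phi n J / (2 * (J : ℝ) + 1)) = fun J : ℕ =>
      (∑ t ∈ range (n + 2), (-4 : ℝ) ^ t / t.factorial *
        (((J : ℝ) + (n + 1 - t : ℕ)) * ((J : ℝ) + (n + 1 - t : ℕ) - 1) * pp (n + 1 - t) J
          / (2 * J + 1)))
      + (-1) * ∑ t ∈ range (n + 1), (-4 : ℝ) ^ t / t.factorial *
        (((J : ℝ) + (n - t : ℕ)) * pp (n - t) J / (2 * J + 1)) := by
    funext J
    rw [Phi, sub_div, Finset.sum_div, Finset.sum_div, neg_one_mul, ← sub_eq_add_neg]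
    congr 1 <;> exact Finset.sum_congr rfl fun t _ => by ring
  rw [e, altSum_add, altSum_mul, altSum_sum, altSum_sum]
  simp only [altSum_mul]
  rw [Finset.sum_range_succ, Finset.sum_eq_zero, Finset.sum_range_succ _ n, Finset.sum_eq_zero]
  · have h1 := alt_zero_one N (by omega)
    have h2 := alt_zero_two N (by omega)
    simp only [Nat.sub_self, Nat.cast_zero, add_zero]
    rw [h1, h2]
    ring
  · intro t ht
    simp only [mem_range] at ht
    obtain ⟨s, rfl⟩ := Nat.exists_eq_add_of_lt ht
    have hs : t + s + 1 - t = s + 1 := by omega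
    have := alt_two N s (by omega)
    rw [hs]
    push_cast
    rw [this, mul_zero]
  · intro t ht
    simp only [mem_range] at ht
    obtain ⟨s, hs'⟩ := Nat.exists_eq_add_of_lt ht
    have hs : n + 1 - t = s + 1 := by omega
    have := alt_one N s (by omega)
    rw [hs]
    push_cast
    have e2 : ∀ J : ℕ, (J : ℝ) + ((s : ℝ) + 1) - 1 = J + s := fun J => by ring
    simp only [e2]
    rw [this, mul_zero]

lemma pp_val_zero (s : ℕ) : pp (s + 1) 0 = 0 := by
  simp [pp, PowerSeries.coeff_one]

lemma Phi_zero (n : ℕ) : Phi n 0 = 0 := by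
  unfold Phi
  rw [Finset.sum_eq_zero, Finset.sum_eq_zero, sub_zero]
  · intro t ht
    rcases Nat.eq_zero_or_pos (n - t) with h | h
    · simp [h]
    · obtain ⟨s, hs⟩ := Nat.exists_eq_add_of_lt h
      rw [hs, zero_add, pp_val_zero]; simp
  · intro t ht
    rcases Nat.eq_zero_or_pos (n + 1 - t) with h | h
    · simp [h]
    · obtain ⟨s, hs⟩ := Nat.exists_eq_add_of_lt h
      rw [hs, zero_add, pp_val_zero]; simp

lemma pp_val_one (s : ℕ) : pp s 1 * (s + 1).factorial = 1 := by
  have h := pp_cen s 1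
  have h2 : cen 1 (1 + s) = 2 := by
    simp [cen, Finset.sum_range_succ]
    rw [pow_mul]
    norm_num
  rw [h2, add_comm 1 s] at h
  simp at h
  linarith

lemma Phi_one (n : ℕ) : Phi n 1 = 0 := by
  unfold Phi
  rw [Finset.sum_range_succ, Nat.sub_self]
  rw [sub_eq_zero]
  simp only [Nat.cast_one, Nat.cast_zero, add_zero, sub_self, mul_zero, zero_mul]
  refine Finset.sum_congr rfl fun t ht => ?_
  simp only [mem_range] at ht
  obtain ⟨s, rfl⟩ := Nat.exists_eq_add_of_le (Nat.lt_succ_iff.1 ht)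
  have e1 : t + s + 1 - t = s + 1 := by omega
  have e2 : t + s - t = s := by omega
  rw [e1, e2]
  have h1 := pp_val_one s
  have h2 := pp_val_one (s + 1)
  rw [Nat.factorial_succ (s + 1)] at h2
  have hf : ((s + 1).factorial : ℝ) ≠ 0 := by exact_mod_cast Nat.factorial_ne_zero _
  congr 1
  apply mul_right_cancel₀ hf
  push_cast at h2 ⊢
  linear_combination ((s : ℝ) + 1) * h2 - (1 + (s : ℝ)) * h1

lemma cen_exp (j n : ℕ) :
    ∑ i ∈ range (2 * (j + 2) + 1), (-1 : ℝ) ^ i * ((2 * (j + 2)).choose i : ℝ) *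
      ((((j + 2 : ℕ) : ℝ) - i) ^ 2 * ((((j + 2 : ℕ) : ℝ) - i) ^ 2 - 1) *
        ((((j + 2 : ℕ) : ℝ) - i) ^ 2 - 4) ^ (j + n)) =
    ∑ t ∈ range (j + n + 1), ((j + n).choose t : ℝ) * (-4) ^ t *
      (cen (j + 2) (j + n - t + 2) - cen (j + 2) (j + n - t + 1)) := by
  have hx : ∀ x : ℝ, x ^ 2 * (x ^ 2 - 1) * (x ^ 2 - 4) ^ (j + n) =
      ∑ t ∈ range (j + n + 1), ((j + n).choose t : ℝ) * (-4) ^ t *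
        (x ^ (2 * (j + n - t + 2)) - x ^ (2 * (j + n - t + 1))) := by
    intro x
    rw [sub_eq_neg_add (x ^ 2) 4, add_pow, Finset.mul_sum]
    refine Finset.sum_congr rfl fun t _ => ?_
    rw [pow_mul, pow_mul]
    ring
  simp only [hx, cen, ← Finset.sum_sub_distrib, Finset.mul_sum]
  rw [Finset.sum_comm]
  refine Finset.sum_congr rfl fun t _ => Finset.sum_congr rfl fun i _ => ?_
  ring

lemma sum_first (j n : ℕ) :
    (∑ t ∈ range (j + (n + 1) + 1), ((j + (n + 1)).choose t : ℝ) * (-4) ^ t *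
      cen (j + 2) (j + (n + 1) - t + 2)) * (j + 2).factorial =
    (∑ t ∈ range (n + 2), (-4 : ℝ) ^ t / t.factorial *
      ((((j + 2 : ℕ) : ℝ) + (n + 1 - t : ℕ)) * (((j + 2 : ℕ) : ℝ) + (n + 1 - t : ℕ) - 1) *
        pp (n + 1 - t) (j + 2))) * ((j + (n + 1)).factorial * (2 * (j + 2)).factorial) := by
  rw [← Finset.sum_subset (s₁ := range (n + 2)), Finset.sum_mul, Finset.sum_mul]
  · refine Finset.sum_congr rfl fun t ht => ?_
    simp only [mem_range] at ht
    obtain ⟨s, hs⟩ := Nat.exists_eq_add_of_le (show t ≤ n + 1 by omega)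
    have e1 : n + 1 - t = s := by omega
    have e2 : j + (n + 1) - t + 2 = j + 2 + s := by omega
    rw [e1, e2]
    have hp := pp_cen s (j + 2)
    have hc := Nat.choose_mul_factorial_mul_factorial (show t ≤ j + (n + 1) by omega)
    have e3 : j + (n + 1) - t = j + s := by omega
    rw [e3] at hc
    have hc' : ((j + (n + 1)).choose t : ℝ) * t.factorial * (j + s).factorial
      = (j + (n + 1)).factorial := by exact_mod_cast hc
    have hf : ((j + 2 + s).factorial : ℝ) = (j + s + 2) * (j + s + 1) * (j + s).factorial := by
      have : j + 2 + s = j + s + 1 + 1 := by ring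
      rw [this, Nat.factorial_succ, Nat.factorial_succ]; push_cast; ring
    rw [hf] at hp
    have ht0 : (t.factorial : ℝ) ≠ 0 := by exact_mod_cast Nat.factorial_ne_zero t
    rw [← hc']
    push_cast
    field_simp
    push_cast at hp
    linear_combination -((j + (n + 1)).choose t : ℝ) * hp
  · intro x hx; simp at *; omega
  · intro x hx hx'
    simp at hx hx'
    rw [cen_lt _ _ (by omega), mul_zero]

lemma sum_second (j n : ℕ) :
    (∑ t ∈ range (j + (n + 1) + 1), ((j + (n + 1)).choose t : ℝ) * (-4) ^ t *
      cen (j + 2) (j + (n + 1) - t + 1)) * (j + 2).factorial =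
    (∑ t ∈ range (n + 1), (-4 : ℝ) ^ t / t.factorial *
      ((((j + 2 : ℕ) : ℝ) + (n - t : ℕ)) *
        pp (n - t) (j + 2))) * ((j + (n + 1)).factorial * (2 * (j + 2)).factorial) := by
  rw [← Finset.sum_subset (s₁ := range (n + 1)), Finset.sum_mul, Finset.sum_mul]
  · refine Finset.sum_congr rfl fun t ht => ?_
    simp only [mem_range] at ht
    obtain ⟨s, hs⟩ := Nat.exists_eq_add_of_le (show t ≤ n by omega)
    have e1 : n - t = s := by omega
    have e2 : j + (n + 1) - t + 1 = j + 2 + s := by omega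
    rw [e1, e2]
    have hp := pp_cen s (j + 2)
    have hc := Nat.choose_mul_factorial_mul_factorial (show t ≤ j + (n + 1) by omega)
    have e3 : j + (n + 1) - t = j + s + 1 := by omega
    rw [e3] at hc
    have hc' : ((j + (n + 1)).choose t : ℝ) * t.factorial * (j + s + 1).factorial
      = (j + (n + 1)).factorial := by exact_mod_cast hc
    have hf : ((j + 2 + s).factorial : ℝ) = (j + s + 2) * (j + s + 1).factorial := by
      have : j + 2 + s = j + s + 1 + 1 := by ring
      rw [this, Nat.factorial_succ]; push_cast; ring
    rw [hf] at hp
    have ht0 : (t.factorial : ℝ) ≠ 0 := by exact_mod_cast Nat.factorial_ne_zero t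
    rw [← hc']
    push_cast
    field_simp
    push_cast at hp
    linear_combination -((j + (n + 1)).choose t : ℝ) * hp
  · intro x hx; simp at *; omega
  · intro x hx hx'
    simp at hx hx'
    rw [cen_lt _ _ (by omega), mul_zero]

/-- The symmetric inner sum. -/
noncomputable def symS (j n : ℕ) : ℝ :=
  ∑ i ∈ range (2 * (j + 2) + 1), (-1 : ℝ) ^ i * ((2 * (j + 2)).choose i : ℝ) *
      ((((j + 2 : ℕ) : ℝ) - i) ^ 2 * ((((j + 2 : ℕ) : ℝ) - i) ^ 2 - 1) *
        ((((j + 2 : ℕ) : ℝ) - i) ^ 2 - 4) ^ (j + n))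

lemma symS_Phi (j n : ℕ) : symS j (n + 1) * (j + 2).factorial =
    Phi n (j + 2) * ((j + (n + 1)).factorial * (2 * (j + 2)).factorial) := by
  rw [symS, cen_exp, Phi, sub_mul, ← sum_first, ← sum_second, ← sub_mul,
    ← Finset.sum_sub_distrib]
  simp only [mul_sub]

lemma sum_sym (M : ℕ) (F : ℕ → ℝ) (h : ∀ i ≤ 2 * M, F (2 * M - i) = F i) (h0 : F M = 0) :
    ∑ i ∈ range (2 * M + 1), F i = 2 * ∑ i ∈ range M, F i := by
  have e : 2 * M + 1 = M + (M + 1) := by ring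
  rw [e, Finset.sum_range_add, ← Finset.sum_range_reflect (fun x => F (M + x)),
    Finset.sum_range_succ, two_mul]
  simp only [Nat.add_sub_cancel, Nat.sub_self, add_zero, h0]
  congr 1
  refine Finset.sum_congr rfl fun i hi => ?_
  simp only [mem_range] at hi
  rw [← h i (by omega)]
  congr 1
  omega

lemma inner_symS (j n : ℕ) :
    2 * ∑ k ∈ Icc 1 j, (-1 : ℝ) ^ k * (Nat.choose (2 * j + 5 - 1) (j - k)) * sphMu k 5 *
        (sphLam k 5 : ℝ) ^ (j + (n + 1)) = (-1) ^ j / 12 * symS j (n + 1) := by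
  rw [symS, sum_sym]
  · rw [Finset.sum_range_succ, Finset.sum_range_succ]
    have z1 : ((j + 2 : ℕ) : ℝ) - j = 2 := by push_cast; ring
    have z2 : ((j + 2 : ℕ) : ℝ) - (j + 1 : ℕ) = 1 := by push_cast; ring
    rw [z1, z2]
    have z3 : ((2 : ℝ) ^ 2 - 4) ^ (j + (n + 1)) = 0 := by
      rw [← add_assoc, pow_succ]; norm_num
    rw [z3]
    simp only [one_pow, sub_self, mul_zero, zero_mul, add_zero]
    rw [← mul_assoc, mul_comm _ (2 : ℝ), mul_assoc]
    congr 1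
    rw [Finset.mul_sum]
    refine Finset.sum_bij' (fun k _ => j - k) (fun i _ => j - i) ?_ ?_ ?_ ?_ ?_
    · intro k hk; simp at *; omega
    · intro k hk; simp at *; omega
    · intro k hk; simp at *; omega
    · intro k hk; simp at *; omega
    · intro k hk
      simp only [mem_Icc] at hk
      obtain ⟨i, rfl⟩ := Nat.exists_eq_add_of_le hk.2
      have e1 : k + i - k = i := by omega
      have e2 : 2 * (k + i) + 5 - 1 = 2 * (k + i + 2) := by omega
      have e3 : ((k + i + 2 : ℕ) : ℝ) - i = k + 2 := by push_cast; ring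
      rw [e1, e2, e3]
      have hmu : sphMu k 5 = (k + 2 : ℝ) ^ 2 * ((k + 2) ^ 2 - 1) / 12 := by
        have : k + 5 - 2 = k + 1 + 1 + 1 := by omega
        rw [sphMu, if_neg (by omega), this, Nat.factorial_succ, Nat.factorial_succ,
          Nat.factorial_succ]
        have hk0 : (k.factorial : ℝ) ≠ 0 := by exact_mod_cast Nat.factorial_ne_zero k
        have h4 : ((5 - 1).factorial : ℝ) = 24 := by norm_num [Nat.factorial]
        rw [h4]
        push_cast
        field_simp
        ring
      have hlam : (sphLam k 5 : ℝ) = (k + 2 : ℝ) ^ 2 - 4 := by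
        have : k + 5 - 1 = k + 4 := by omega
        rw [sphLam, this]; push_cast; ring
      have hs : (-1 : ℝ) ^ (k + i) * (-1) ^ i = (-1) ^ k := by
        rw [pow_add, mul_assoc, ← mul_pow]; simp
      rw [hmu, hlam, ← hs]
      ring
  · intro i hi
    have c : ((2 * (j + 2) - i : ℕ) : ℝ) = 2 * ((j + 2 : ℕ) : ℝ) - i := by
      rw [Nat.cast_sub hi]; push_cast; ring
    have s1 : (-1 : ℝ) ^ (2 * (j + 2) - i) = (-1) ^ i := by
      have : (-1 : ℝ) ^ (2 * (j + 2) - i) * (-1) ^ i = 1 := by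
        rw [← pow_add, Nat.sub_add_cancel hi, pow_mul]; simp
      rcases neg_one_pow_eq_or ℝ i with h | h <;> rw [h] at this ⊢ <;> linarith
    rw [c, Nat.choose_symm hi, s1]
    have : ((j + 2 : ℕ) : ℝ) - (2 * ((j + 2 : ℕ) : ℝ) - i) = -(((j + 2 : ℕ) : ℝ) - i) := by ring
    rw [this, neg_sq]
  · simp

lemma Phi_two (n : ℕ) : Phi n 2 = 0 := by
  have h1 := inner_symS 0 n
  have h2 := symS_Phi 0 n
  simp at h1
  rw [h1] at h2
  simp at h2
  rcases h2 with h | h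
  · exact h
  · rcases h with h | h
    · exact absurd h (Nat.factorial_ne_zero _)
    · exact absurd h (Nat.factorial_ne_zero _)

lemma A_eq (n ω : ℕ) : A (n + 1) 5 ω =
    (-1) ^ (n + 1) * Real.Gamma ((ω : ℝ) + 7 / 2) / (12 * (ω + 2).factorial) *
      altSum (ω + 2) (fun J => Phi n J / (2 * J + 1)) := by
  have hg : (ω : ℝ) + (5 : ℕ) / 2 + 1 = ω + 7 / 2 := by push_cast; ring
  rw [A, hg, altSum, Finset.sum_range_succ', Finset.sum_range_succ', Finset.sum_range_succ']
  simp only [zero_add, Phi_zero, Phi_one, Phi_two, Nat.reduceAdd, zero_div, mul_zero, add_zero]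
  rw [Finset.mul_sum]
  refine Finset.sum_bij' (fun j _ => j - 1) (fun i _ => i + 1) ?_ ?_ ?_ ?_ ?_
  · intro k hk; simp at *; omega
  · intro k hk; simp at *; omega
  · intro k hk; simp at *; omega
  · intro k hk; simp at *
  · intro j hj
    simp only [mem_Icc] at hj
    have e : j - 1 + 1 + 1 + 1 = j + 2 := by omega
    rw [e]
    have h1 := inner_symS j n
    have h2 := symS_Phi j n
    obtain ⟨m, rfl⟩ := Nat.exists_eq_add_of_le hj.2
    have h3 := Nat.choose_mul_factorial_mul_factorial (show j + 2 ≤ j + m + 2 by omega)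
    have e3 : j + m + 2 - (j + 2) = m := by omega
    rw [e3] at h3
    have h3' : ((j + m + 2).choose (j + 2) : ℝ) * (j + 2).factorial * m.factorial =
      (j + m + 2).factorial := by exact_mod_cast h3
    have e4 : j + m - j = m := by omega
    have e5 : 2 * j + 5 = 2 * (j + 2) + 1 := by ring
    have n1 : ((j + 2).factorial : ℝ) ≠ 0 := by exact_mod_cast Nat.factorial_ne_zero _
    have n2 : (m.factorial : ℝ) ≠ 0 := by exact_mod_cast Nat.factorial_ne_zero _
    have n3 : ((j + (n + 1)).factorial : ℝ) ≠ 0 := by exact_mod_cast Nat.factorial_ne_zero _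
    have n4 : ((2 * (j + 2)).factorial : ℝ) ≠ 0 := by exact_mod_cast Nat.factorial_ne_zero _
    have n5 : ((j + m + 2).choose (j + 2) : ℝ) ≠ 0 := by
      exact_mod_cast (Nat.choose_pos (by omega)).ne'
    have n6 : (2 * ((j + 2 : ℕ) : ℝ) + 1) ≠ 0 := by positivity
    have h1' := (eq_div_iff (two_ne_zero (α := ℝ))).2 ((mul_comm _ _).trans h1)
    rw [h1', eq_div_of_mul_eq n1 h2, ← h3', e4]
    have hf : ((2 * j + 5).factorial : ℝ) = (2 * ((j + 2 : ℕ) : ℝ) + 1) * (2 * (j + 2)).factorial := by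
      rw [e5, Nat.factorial_succ]; push_cast; ring
    rw [hf, pow_add (-1 : ℝ) j 2]
    field_simp
open Real in
/-- `A_{n,5}(ω) = 4^{n-3}(6-n)√π/(3·n!)` for `n ≥ 1`, `ω ≥ 2n`. -/
theorem heat_invariants_S5 (n ω : ℕ) (hn : 1 ≤ n) (hω : 2 * n ≤ ω) :
    A n 5 ω = (4 : ℝ) ^ ((n : ℤ) - 3) * (6 - (n : ℝ)) * Real.sqrt π /
      (3 * Nat.factorial n) := by
  obtain ⟨n, rfl⟩ := Nat.exists_eq_add_of_le' hn
  rw [A_eq, alt_Phi n (ω + 2) (by omega)]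
  have hW := altSum_inv (ω + 2) (1 / 2) (by norm_num)
  have hg : (1 / 2 : ℝ) + (ω + 2 : ℕ) + 1 = ω + 7 / 2 := by push_cast; ring
  rw [hg, Real.Gamma_one_half_eq] at hW
  have e : (fun J : ℕ => 1 / ((1 / 2 : ℝ) + J)) = fun J : ℕ => 2 * (1 / (2 * (J : ℝ) + 1)) := by
    funext J
    have : (2 * (J : ℝ) + 1) ≠ 0 := by positivity
    have : ((1 / 2 : ℝ) + J) ≠ 0 := by positivity
    field_simp
    ring
  rw [e, altSum_mul] at hW
  set W := altSum (ω + 2) (fun J : ℕ => 1 / (2 * (J : ℝ) + 1))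
  set Γ := Real.Gamma ((ω : ℝ) + 7 / 2)
  have n1 : ((ω + 2).factorial : ℝ) ≠ 0 := by exact_mod_cast Nat.factorial_ne_zero _
  have n2 : (n.factorial : ℝ) ≠ 0 := by exact_mod_cast Nat.factorial_ne_zero _
  have n3 : ((n : ℝ) + 1) ≠ 0 := by positivity
  have hs : √π = 2 * W * Γ / (ω + 2).factorial := by
    rw [hW]; field_simp
  have hz : (4 : ℝ) ^ (((n + 1 : ℕ) : ℤ) - 3) = 4 ^ n / 16 := by
    rw [show (((n + 1 : ℕ) : ℤ) - 3) = (n : ℤ) - 2 by push_cast; ring,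
      zpow_sub₀ (by norm_num), zpow_natCast]
    norm_num
  have h4 : (-4 : ℝ) ^ n = (-1) ^ n * 4 ^ n := by rw [← mul_pow]; norm_num
  have h1 : (-1 : ℝ) ^ n * (-1) ^ n = 1 := by rw [← mul_pow]; simp
  rw [hs, hz, pow_succ, pow_succ, h4, Nat.factorial_succ n]
  push_cast
  field_simp
  ring_nf
  rw [mul_comm n 2, pow_mul]
  norm_num
end

section
/- For all integers n ≥ 1 and ω ≥ 2n: A_{n,7}(ω) = 3^{2n-6}(16n² - 286n + 1215)√π / (640 · n!). -/
open Finset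

/-- Multiplicity as a polynomial. -/
lemma sphMu_seven (k : ℕ) : sphMu k 7 =
    ((k : ℝ) + 3) * ((k + 1) * (k + 2) * (k + 3) * (k + 4) * (k + 5)) / 360 := by
  unfold sphMu
  split_ifs with h
  · subst h; norm_num
  · have h1 : k + 7 - 2 = k + 5 := by omega
    have hk : (Nat.factorial k : ℝ) ≠ 0 := by positivity
    rw [h1]
    simp only [Nat.factorial_succ]
    push_cast
    norm_num [Nat.factorial]
    field_simp
    ring

/-- The inner sum, including the term `k = 0`. -/
noncomputable def innerT (j e : ℕ) : ℝ :=
  ∑ k ∈ range (j + 1), (-1 : ℝ) ^ k * (Nat.choose (2 * j + 6) (j - k)) * sphMu k 7 *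
    ((k : ℝ) * (k + 6)) ^ e

lemma innerT_partial (j : ℕ) (hj : 1 ≤ j) (m : ℕ) (hm : m ≤ j) :
    ∑ k ∈ range (m + 1), (-1 : ℝ) ^ k * (Nat.choose (2 * j + 6) (j - k)) * sphMu k 7
      = (-1 : ℝ) ^ m * (Nat.choose (2 * j + 6) (j - m)) * ((j : ℝ) - m) *
        ((m + 1) * (m + 2) * (m + 3) * (m + 4) * (m + 5) * (m + 6)) / (720 * j) := by
  have hj0 : (j : ℝ) ≠ 0 := by positivity
  induction m with
  | zero =>
    simp [sphMu]
    field_simp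
    ring
  | succ m ih =>
    rw [sum_range_succ, ih (by omega), sphMu_seven]
    obtain ⟨c, rfl⟩ : ∃ c, j = m + 1 + c := ⟨j - (m + 1), by omega⟩
    have e1 : m + 1 + c - m = c + 1 := by omega
    have e2 : m + 1 + c - (m + 1) = c := by omega
    rw [e1, e2]
    have h := Nat.choose_succ_right_eq (2 * (m + 1 + c) + 6) c
    have e3 : 2 * (m + 1 + c) + 6 - c = 2 * m + 8 + c := by omega
    rw [e3] at h
    have h' : ((2 * (m + 1 + c) + 6).choose (c + 1) : ℝ) * (c + 1) =
      ((2 * (m + 1 + c) + 6).choose c : ℝ) * (2 * m + 8 + c) := by exact_mod_cast h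
    push_cast at hj0 ⊢
    set a : ℝ := ((2 * (m + 1 + c) + 6).choose (c + 1) : ℝ)
    set b : ℝ := ((2 * (m + 1 + c) + 6).choose c : ℝ)
    field_simp
    rw [pow_succ]
    linear_combination ((-1 : ℝ)^m * ((m + 1) * (m + 2) * (m + 3) * (m + 4) * (m + 5) * (m + 6)) * 360) * h'

lemma innerT_zero (j : ℕ) (hj : 1 ≤ j) : innerT j 0 = 0 := by
  have := innerT_partial j hj j le_rfl
  simp only [innerT, pow_zero, mul_one]
  rw [this]; simp

lemma innerT_succ (j e : ℕ) : innerT (j + 1) (e + 1) =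
    ((j : ℝ) + 1) * (j + 7) * innerT (j + 1) e - (2 * j + 8) * (2 * j + 7) * innerT j e := by
  unfold innerT
  rw [sum_range_succ, sum_range_succ _ (j + 1), mul_add (((j : ℝ) + 1) * (j + 7)), mul_sum, mul_sum, add_sub_right_comm,
    ← sum_sub_distrib]
  congr 1
  · apply sum_congr rfl
    intro k hk
    rw [mem_range] at hk
    obtain ⟨c, rfl⟩ : ∃ c, j = k + c := ⟨j - k, by omega⟩
    have e1 : k + c + 1 - k = c + 1 := by omega
    have e2 : k + c - k = c := by omega
    rw [e1, e2]
    have h1 := Nat.add_one_mul_choose_eq (2 * (k + c) + 7) c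
    have h2 := Nat.choose_mul_succ_eq (2 * (k + c) + 6) c
    have e3 : 2 * (k + c) + 6 + 1 - c = 2 * k + c + 7 := by omega
    rw [e3] at h2
    have h1' : (2 * ((k : ℝ) + c) + 8) * ((2 * (k + c) + 7).choose c : ℝ) =
      ((2 * (k + c + 1) + 6).choose (c + 1) : ℝ) * (c + 1) := by exact_mod_cast h1
    have h2' : ((2 * (k + c) + 6).choose c : ℝ) * (2 * ((k : ℝ) + c) + 7) =
      ((2 * (k + c) + 7).choose c : ℝ) * (2 * k + c + 7) := by exact_mod_cast h2
    set a : ℝ := ((2 * (k + c + 1) + 6).choose (c + 1) : ℝ)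
    set b : ℝ := ((2 * (k + c) + 7).choose c : ℝ)
    set d : ℝ := ((2 * (k + c) + 6).choose c : ℝ)
    push_cast
    rw [pow_succ]
    linear_combination ((-1 : ℝ)^k * sphMu k 7 * ((k : ℝ) * (k + 6)) ^ e) *
      ((2 * k + c + 7) * h1' + (2 * ((k : ℝ) + c) + 8) * h2')
  · push_cast
    ring

/-- If `H` satisfies the recursion of the complete homogeneous symmetric functions, it is the
normalised inner sum. -/
lemma innerT_eq (H : ℕ → ℝ → ℝ) (h0 : ∀ x, H 0 x = 1) (hz : ∀ n, H (n + 1) 0 = 0)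
    (hr : ∀ n x, H (n + 1) x - H (n + 1) (x - 1) = x * (x + 6) * H n x) (n j : ℕ) :
    innerT j (j + n) = (-1 : ℝ) ^ j * (Nat.factorial (2 * j + 6)) / 720 * H n j := by
  have hlt : ∀ e j : ℕ, e < j → innerT j e = 0 := by
    intro e
    induction e with
    | zero => intro j hj; exact innerT_zero j hj
    | succ e ih =>
      intro j hj
      obtain ⟨i, rfl⟩ : ∃ i, j = i + 1 := ⟨j - 1, by omega⟩
      rw [innerT_succ, ih _ (by omega), ih _ (by omega)]; simp
  have hfac : ∀ j : ℕ, (Nat.factorial (2 * (j + 1) + 6) : ℝ) =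
      (2 * j + 8) * (2 * j + 7) * Nat.factorial (2 * j + 6) := by
    intro j
    have : 2 * (j + 1) + 6 = 2 * j + 6 + 1 + 1 := by ring
    rw [this, Nat.factorial_succ, Nat.factorial_succ]; push_cast; ring
  have hj0 : ∀ n, innerT 0 (0 + n) = H n 0 := by
    intro n
    cases n with
    | zero => simp [innerT, h0, sphMu]
    | succ n => simp [innerT, hz]
  induction n generalizing j with
  | zero =>
    induction j with
    | zero => rw [hj0]; norm_num [Nat.factorial]
    | succ j ih =>
      rw [add_zero] at ih ⊢
      rw [innerT_succ, hlt _ _ (by omega), ih, hfac, h0, h0]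
      ring
  | succ n ihn =>
    induction j with
    | zero => rw [hj0]; norm_num [Nat.factorial]
    | succ j ih =>
      have : j + 1 + (n + 1) = (j + (n + 1)) + 1 := by ring
      rw [this, innerT_succ, ih]
      have e2 : j + (n + 1) = j + 1 + n := by ring
      rw [e2, ihn, hfac]
      have := hr n ((j : ℝ) + 1)
      rw [add_sub_cancel_right] at this
      push_cast
      rw [sub_eq_iff_eq_add.1 this]
      ring

lemma fwdDiff_inv (n : ℕ) : ∀ x : ℝ, 0 < x → (fwdDiff (1 : ℝ))^[n] (fun y : ℝ => y⁻¹) x =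
    (-1) ^ n * Nat.factorial n * Real.Gamma x / Real.Gamma (x + n + 1) := by
  induction n with
  | zero =>
    intro x hx
    have := (Real.Gamma_pos_of_pos hx).ne'
    simp [Real.Gamma_add_one hx.ne']
    field_simp
  | succ n ih =>
    intro x hx
    rw [Function.iterate_succ_apply', fwdDiff, ih _ hx, ih _ (by linarith),
      Real.Gamma_add_one hx.ne']
    have h1 : x + 1 + n + 1 = (x + n + 1) + 1 := by ring
    have h2 : x + ((n + 1 : ℕ) : ℝ) + 1 = (x + n + 1) + 1 := by push_cast; ring
    have hp : 0 < x + n + 1 := by positivity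
    rw [h1, h2, Real.Gamma_add_one hp.ne', Nat.factorial_succ]
    have := (Real.Gamma_pos_of_pos hp).ne'
    push_cast
    field_simp
    ring

lemma alt_sum (p : Polynomial ℝ) (w : ℕ) (hp : p.natDegree ≤ w) (hw : 1 ≤ w) (x : ℝ) (hx : 0 < x) :
    ∑ j ∈ range (w + 1), (-1 : ℝ) ^ j * (Nat.choose w j) * (p.eval (j : ℝ) / (j + x)) =
      p.eval (-x) * (Nat.factorial w * Real.Gamma x / Real.Gamma (x + w + 1)) := by
  have key : ∀ (f : ℝ → ℝ) (y : ℝ), (fwdDiff (1 : ℝ))^[w] f y =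
      (-1) ^ w * ∑ j ∈ range (w + 1), (-1 : ℝ) ^ j * (Nat.choose w j) * f (y + j) := by
    intro f y
    rw [fwdDiff_iter_eq_sum_shift, mul_sum]
    apply sum_congr rfl
    intro j hj
    rw [mem_range] at hj
    obtain ⟨c, rfl⟩ : ∃ c, w = j + c := ⟨w - j, by omega⟩
    rw [Nat.add_sub_cancel_left, pow_add]
    simp only [zsmul_eq_mul, nsmul_eq_mul, mul_one]
    push_cast
    have : ((-1 : ℝ) ^ j * (-1) ^ j) = 1 := by rw [← mul_pow]; simp
    linear_combination (-(-1 : ℝ) ^ c * ((j + c).choose j) * f (y + j)) * this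
  set q := p.divByMonic (Polynomial.X - Polynomial.C (-x)) with hq
  have hdiv : ∀ y, p.eval y = p.eval (-x) + (y + x) * q.eval y := by
    intro y
    have := Polynomial.modByMonic_add_div p (Polynomial.X - Polynomial.C (-x))
    rw [Polynomial.modByMonic_X_sub_C_eq_C_eval] at this
    conv_lhs => rw [← this]
    simp [hq]
  have hqd : q.natDegree < w := by
    rw [hq, Polynomial.natDegree_divByMonic _ (Polynomial.monic_X_sub_C _)]
    rw [Polynomial.natDegree_X_sub_C]; omega
  have k1 := key (fun y => q.eval y) 0
  rw [Polynomial.fwdDiff_iter_eq_zero_of_degree_lt hqd] at k1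
  have k2 := key (fun y => y⁻¹) x
  rw [fwdDiff_inv w x hx] at k2
  have hs : ((-1 : ℝ) ^ w) ≠ 0 := by simp
  have k1' : ∑ j ∈ range (w + 1), (-1 : ℝ) ^ j * (Nat.choose w j) * q.eval (j : ℝ) = 0 := by
    simpa using k1
  have k2' : ∑ j ∈ range (w + 1), (-1 : ℝ) ^ j * (Nat.choose w j) * (x + (j : ℝ))⁻¹ =
      Nat.factorial w * Real.Gamma x / Real.Gamma (x + w + 1) := by
    apply mul_left_cancel₀ hs
    rw [← k2]; ring
  rw [← k2', mul_sum, ← sub_eq_zero, ← k1', ← sum_sub_distrib]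
  apply sum_congr rfl
  intro j _
  have hjx : (j : ℝ) + x ≠ 0 := by positivity
  rw [hdiv j, add_comm x]
  field_simp
  ring

open Polynomial in
lemma opL_degree (n : ℕ) (N : ℕ) (p : ℝ[X]) (hp : p ∈ degreeLT ℝ N) :
    (X + C ((n : ℝ) + 1)) * p - X * p.comp (X - C 1) ∈ degreeLT ℝ N := by
  rw [mem_degreeLT] at hp ⊢
  by_cases h0 : p = 0
  · subst h0; simpa using hp
  have e : (X + C ((n : ℝ) + 1)) * p - X * p.comp (X - C 1) =
      C ((n : ℝ) + 1) * p + X * (p - p.comp (X - C 1)) := by ring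
  have hnd : (p.comp (X - C 1)).natDegree = p.natDegree := by
    rw [natDegree_comp, natDegree_X_sub_C, mul_one]
  have hlc : (p.comp (X - C 1)).leadingCoeff = p.leadingCoeff := by
    rw [leadingCoeff_comp (by rw [natDegree_X_sub_C]; simp), leadingCoeff_X_sub_C]; simp
  have hne : p.comp (X - C 1) ≠ 0 := by
    intro h; rw [h] at hlc; exact h0 (leadingCoeff_eq_zero.1 (by rw [← hlc, leadingCoeff_zero]))
  have hdeg : p.degree = (p.comp (X - C 1)).degree := by
    rw [degree_eq_natDegree h0, degree_eq_natDegree hne, hnd]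
  have hlt := degree_sub_lt_left hdeg h0 hlc.symm
  rw [e]
  refine lt_of_le_of_lt ?_ hp
  refine (degree_add_le _ _).trans (max_le ?_ ?_)
  · exact le_of_eq (degree_C_mul (by positivity))
  · by_cases hd : p - p.comp (X - C 1) = 0
    · rw [hd]; simp
    · rw [degree_mul, degree_X, degree_eq_natDegree hd, degree_eq_natDegree h0]
      rw [degree_eq_natDegree hd, degree_eq_natDegree h0] at hlt
      have : (p - p.comp (X - C 1)).natDegree < p.natDegree := by exact_mod_cast hlt
      have : 1 + (p - p.comp (X - C 1)).natDegree ≤ p.natDegree := by omega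
      exact_mod_cast this

open Polynomial in
/-- The operator `p ↦ (X+n+1) p(X) - X p(X-1)`. -/
noncomputable def opL (n : ℕ) : ℝ[X] →ₗ[ℝ] ℝ[X] where
  toFun p := (X + C ((n : ℝ) + 1)) * p - X * p.comp (X - C 1)
  map_add' p q := by rw [add_comp]; ring
  map_smul' c p := by rw [smul_comp]; simp [smul_eq_C_mul]; ring

open Polynomial in
lemma opL_surj (n : ℕ) (N : ℕ) (q : ℝ[X]) (hq : q ∈ degreeLT ℝ N) :
    ∃ p ∈ degreeLT ℝ N, (X + C ((n : ℝ) + 1)) * p - X * p.comp (X - C 1) = q := by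
  have hmem : ∀ p ∈ degreeLT ℝ N, opL n p ∈ degreeLT ℝ N := fun p hp => opL_degree n N p hp
  haveI : FiniteDimensional ℝ (degreeLT ℝ N) :=
    Module.Finite.equiv (degreeLTEquiv ℝ N).symm
  have hinj : Function.Injective ((opL n).restrict hmem) := by
    rw [injective_iff_map_eq_zero]
    rintro ⟨p, hp⟩ h
    have h' : (X + C ((n : ℝ) + 1)) * p - X * p.comp (X - C 1) = 0 := congrArg Subtype.val h
    have hk : ∀ k : ℕ, p.eval (k : ℝ) = 0 := by
      intro k
      have h1 := congrArg (eval (k : ℝ)) h'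
      simp at h1
      induction k with
      | zero =>
        simp at h1
        rcases h1 with h1 | h1
        · exact absurd h1 (by positivity)
        · simpa using h1
      | succ k ih =>
        have h2 := congrArg (eval (k : ℝ)) h'
        simp at h2
        push_cast at h1
        rw [add_sub_cancel_right, ih h2, mul_zero, sub_zero] at h1
        rcases mul_eq_zero.1 h1 with h1 | h1
        · exact absurd h1 (by positivity)
        · push_cast; exact h1
    have : p = 0 := by
      apply eq_zero_of_infinite_isRoot
      apply (Set.infinite_range_of_injective (Nat.cast_injective (R := ℝ))).mono
      rintro _ ⟨k, rfl⟩
      exact hk k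
    exact Subtype.ext this
  obtain ⟨⟨p, hp⟩, h⟩ := (LinearMap.injective_iff_surjective.1 hinj) ⟨q, hq⟩
  exact ⟨p, hp, congrArg Subtype.val h⟩

open Polynomial in
lemma exists_p : ∃ p : ℕ → ℝ[X], p 0 = 1 ∧ (∀ n, (p n).natDegree ≤ 2 * n) ∧
    ∀ n (x : ℝ), (x + (n + 1)) * (p (n + 1)).eval x - x * (p (n + 1)).eval (x - 1) =
      x * (x + 6) * (p n).eval x := by
  have step : ∀ (n : ℕ) (q : ℝ[X]), ∃ r : ℝ[X], (q.natDegree ≤ 2 * n → r.natDegree ≤ 2 * (n + 1)) ∧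
      (X + C ((n : ℝ) + 1)) * r - X * r.comp (X - C 1) = X * (X + C 6) * q := by
    intro n q
    obtain ⟨r, hr, h⟩ := opL_surj n (q.natDegree + 3) (X * (X + C 6) * q) (by
      rw [mem_degreeLT]
      refine lt_of_le_of_lt degree_le_natDegree ?_
      have : (X * (X + C 6) * q).natDegree ≤ q.natDegree + 2 := by
        refine natDegree_mul_le.trans ?_
        have : (X * (X + C 6) : ℝ[X]).natDegree ≤ 2 := by
          refine natDegree_mul_le.trans ?_
          rw [natDegree_X, natDegree_X_add_C]
        omega
      exact_mod_cast (by omega : (X * (X + C 6) * q).natDegree < q.natDegree + 3))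
    refine ⟨r, fun hq => ?_, h⟩
    rw [mem_degreeLT] at hr
    have h3 : r.natDegree ≤ q.natDegree + 2 := by
      apply natDegree_le_of_degree_le
      by_contra hc
      push Not at hc
      have h4 : ((q.natDegree + 2 : ℕ) : WithBot ℕ) < r.degree := hc
      have h0 : r ≠ 0 := by rintro rfl; simp at h4
      rw [degree_eq_natDegree h0] at h4 hr
      have h5 : q.natDegree + 2 < r.natDegree := by exact_mod_cast h4
      have h6 : r.natDegree < q.natDegree + 3 := by exact_mod_cast hr
      omega
    omega
  choose f hf1 hf2 using step
  let p : ℕ → ℝ[X] := fun n => Nat.rec 1 (fun n q => f n q) n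
  have hp : ∀ n, p (n + 1) = f n (p n) := fun n => rfl
  refine ⟨p, rfl, ?_, ?_⟩
  · intro n
    induction n with
    | zero => simp [p]
    | succ n ih => rw [hp]; exact hf1 n _ ih
  · intro n x
    have := congrArg (eval x) (hf2 n (p n))
    rw [← hp] at this
    simpa using this

open Polynomial in
/-- Reflection argument: the square of the generating function at `-7/2`. -/
lemma gen_sq (H : ℕ → ℝ[X]) (h0 : H 0 = 1) (hz : ∀ n, (H (n + 1)).eval 0 = 0)
    (hr : ∀ n (x : ℝ), (H (n + 1)).eval x - (H (n + 1)).eval (x - 1) =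
      x * (x + 6) * (H n).eval x) :
    (PowerSeries.mk (fun n => (H n).eval (-7/2 : ℝ))) ^ 2 =
      ((1 + PowerSeries.C (5 : ℝ) * PowerSeries.X) * (1 + PowerSeries.C (8 : ℝ) * PowerSeries.X)) ^ 2
        * (1 + PowerSeries.C (9 : ℝ) * PowerSeries.X) := by
  set G : ℝ → PowerSeries ℝ := fun x => PowerSeries.mk (fun n => (H n).eval x) with hG
  have hrec : ∀ x, G (x - 1) = (1 - PowerSeries.C (x * (x + 6)) * PowerSeries.X) * G x := by
    intro x
    ext n
    rw [sub_mul, one_mul, map_sub, mul_assoc, PowerSeries.coeff_C_mul]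
    cases n with
    | zero => simp [hG, h0]
    | succ n =>
      rw [PowerSeries.coeff_succ_X_mul]
      simp only [hG, PowerSeries.coeff_mk]
      linarith [hr n x]
  have hG0 : G 0 = 1 := by
    ext n
    cases n with
    | zero => simp [hG, h0]
    | succ n => simp [hG, hz, PowerSeries.coeff_one]
  have hper : ∀ x, G (x - 1) * G (-7 - (x - 1)) = G x * G (-7 - x) := by
    intro x
    have h1 := hrec (-6 - x)
    have e1 : -6 - x - 1 = -7 - x := by ring
    have e2 : -7 - (x - 1) = -6 - x := by ring
    have e3 : (-6 - x) * (-6 - x + 6) = x * (x + 6) := by ring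
    rw [e1, e3] at h1
    rw [hrec x, e2, h1]; ring
  have hnat : ∀ k : ℕ, G k * G (-7 - k) = G 0 * G (-7 - 0) := by
    intro k
    induction k with
    | zero => simp
    | succ k ih =>
      rw [← ih, ← hper]; push_cast; rw [add_sub_cancel_right]
  have hconst : ∀ x, G x * G (-7 - x) = G 0 * G (-7 - 0) := by
    intro x
    ext n
    set P : ℝ[X] := ∑ ij ∈ antidiagonal n, H ij.1 * (H ij.2).comp (C (-7) - X) with hP
    have hPe : ∀ y, P.eval y = PowerSeries.coeff n (G y * G (-7 - y)) := by
      intro y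
      rw [PowerSeries.coeff_mul, hP, eval_finsetSum]
      apply sum_congr rfl
      intro ij _
      simp [hG]
    have : P = C (PowerSeries.coeff n (G 0 * G (-7 - 0))) := by
      apply eq_of_infinite_eval_eq
      apply (Set.infinite_range_of_injective (Nat.cast_injective (R := ℝ))).mono
      rintro _ ⟨k, rfl⟩
      simp only [Set.mem_ofPred_eq, eval_C]
      rw [hPe, hnat]
    rw [← hPe, this, eval_C]
  have hfin := hconst (-7/2)
  rw [show (-7 : ℝ) - -7/2 = -7/2 by norm_num, hG0, one_mul] at hfin
  have r0 := hrec 0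
  have r1 := hrec (-1)
  have r2 := hrec (-2)
  have r3 := hrec (-3)
  have r4 := hrec (-4)
  have r5 := hrec (-5)
  have r6 := hrec (-6)
  norm_num at r0 r1 r2 r3 r4 r5 r6
  rw [pow_two]
  change G (-7/2) * G (-7/2) = _
  rw [hfin, sub_zero, r6, r5, r4, r3, r2, r1, r0, hG0]
  simp only [map_ofNat]
  ring

lemma ring_choose_half (n : ℕ) : Ring.choose (1/2 : ℝ) n =
    (∏ i ∈ range n, ((1/2 : ℝ) - i)) / Nat.factorial n := by
  rw [Ring.choose_eq_smul, smul_eq_mul, inv_mul_eq_div]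
  congr 1
  induction n with
  | zero => simp
  | succ n ih =>
    rw [prod_range_succ, ← ih, descPochhammer_succ_right, Polynomial.smeval_mul]
    simp [Polynomial.smeval_sub, Polynomial.smeval_natCast]

/-- The explicit square root. -/
noncomputable def rootCoeff (n : ℕ) : ℝ :=
  (∏ i ∈ range n, ((5/2 : ℝ) - i)) * 9 ^ n * (16 * (n : ℝ) ^ 2 - 286 * n + 1215) /
    (1215 * Nat.factorial n)

lemma root_sq : (PowerSeries.mk rootCoeff) ^ 2 =
      ((1 + PowerSeries.C (5 : ℝ) * PowerSeries.X) * (1 + PowerSeries.C (8 : ℝ) * PowerSeries.X)) ^ 2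
        * (1 + PowerSeries.C (9 : ℝ) * PowerSeries.X) := by
  set B := PowerSeries.rescale (9 : ℝ) (PowerSeries.binomialSeries ℝ (1/2 : ℝ)) with hB
  have hB2 : B ^ 2 = 1 + PowerSeries.C (9 : ℝ) * PowerSeries.X := by
    rw [hB, pow_two, ← map_mul, ← PowerSeries.binomialSeries_add]
    have := PowerSeries.binomialSeries_nat (R := ℝ) (A := ℝ) 1
    rw [show (1/2 : ℝ) + 1/2 = ((1 : ℕ) : ℝ) by norm_num, this]
    simp [PowerSeries.rescale_X]
  have hBc : ∀ n, PowerSeries.coeff n B =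
      9 ^ n * ((∏ i ∈ range n, ((1/2 : ℝ) - i)) / Nat.factorial n) := by
    intro n
    rw [hB, PowerSeries.coeff_rescale, PowerSeries.binomialSeries_coeff, ring_choose_half]
    simp
  have hR : PowerSeries.mk rootCoeff =
      (1 + PowerSeries.C (5 : ℝ) * PowerSeries.X) * (1 + PowerSeries.C (8 : ℝ) * PowerSeries.X) * B := by
    have e : (1 + PowerSeries.C (5 : ℝ) * PowerSeries.X) *
        (1 + PowerSeries.C (8 : ℝ) * PowerSeries.X) * B =
        B + PowerSeries.C (13 : ℝ) * (PowerSeries.X * B) +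
        PowerSeries.C (40 : ℝ) * (PowerSeries.X * (PowerSeries.X * B)) := by
      simp only [map_ofNat]; ring
    rw [e]
    ext n
    rw [map_add, map_add, PowerSeries.coeff_C_mul, PowerSeries.coeff_C_mul, PowerSeries.coeff_mk]
    rcases n with _ | _ | n
    · simp only [PowerSeries.coeff_zero_X_mul, hBc, rootCoeff]; norm_num
    · rw [PowerSeries.coeff_succ_X_mul, PowerSeries.coeff_succ_X_mul]
      simp only [PowerSeries.coeff_zero_X_mul, hBc, rootCoeff]; norm_num
    · rw [PowerSeries.coeff_succ_X_mul, PowerSeries.coeff_succ_X_mul, PowerSeries.coeff_succ_X_mul,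
        hBc, hBc, hBc, rootCoeff, prod_range_succ', prod_range_succ']
      rw [prod_range_succ _ (n + 1), prod_range_succ _ n]
      have : ∀ i ∈ range n, ((5/2 : ℝ) - ((i + 1 + 1 : ℕ) : ℝ)) = 1/2 - i := by
        intro i _; push_cast; ring
      rw [prod_congr rfl this]
      simp only [Nat.factorial_succ]
      push_cast
      have hf : (Nat.factorial n : ℝ) ≠ 0 := by positivity
      set Q := ∏ i ∈ range n, ((1/2 : ℝ) - i)
      field_simp
      ring
  rw [hR, mul_pow, hB2]

open Polynomial in
lemma gen_value (H : ℕ → ℝ[X]) (h0 : H 0 = 1) (hz : ∀ n, (H (n + 1)).eval 0 = 0)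
    (hr : ∀ n (x : ℝ), (H (n + 1)).eval x - (H (n + 1)).eval (x - 1) =
      x * (x + 6) * (H n).eval x) (n : ℕ) :
    (H n).eval (-7/2 : ℝ) = rootCoeff n := by
  have h := (gen_sq H h0 hz hr).trans root_sq.symm
  rcases sq_eq_sq_iff_eq_or_eq_neg.1 h with h | h
  · simpa using congrArg (PowerSeries.coeff n) h
  · exfalso
    have := congrArg (PowerSeries.coeff 0) h
    rw [map_neg, PowerSeries.coeff_mk, PowerSeries.coeff_mk, h0] at this
    norm_num [rootCoeff] at this

open Real in
/-- `A_{n,7}(ω) = 3^{2n-6}(16n²-286n+1215)√π/(640·n!)` for `n ≥ 1`, `ω ≥ 2n`. -/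
theorem heat_invariants_S7 (n ω : ℕ) (hn : 1 ≤ n) (hω : 2 * n ≤ ω) :
    A n 7 ω = (3 : ℝ) ^ (2 * (n : ℤ) - 6) *
        (16 * (n : ℝ) ^ 2 - 286 * (n : ℝ) + 1215) * Real.sqrt π /
      (640 * Nat.factorial n) := by
  obtain ⟨p, hp0, hpd, hpr⟩ := exists_p
  let H : ℕ → Polynomial ℝ := fun n =>
    (∏ i ∈ range n, (Polynomial.X + Polynomial.C ((i : ℝ) + 1))) * p n
  have hHe : ∀ n x, (H n).eval x = (∏ i ∈ range n, (x + (i + 1))) * (p n).eval x := by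
    intro n x
    simp [H, Polynomial.eval_prod]
  have hH0 : H 0 = 1 := by simp [H, hp0]
  have hp00 : ∀ n, (p (n + 1)).eval 0 = 0 := by
    intro n
    have := hpr n 0
    simp at this
    rcases this with h | h
    · exact absurd h (by positivity)
    · exact h
  have hHz : ∀ n, (H (n + 1)).eval 0 = 0 := by
    intro n; rw [hHe, hp00, mul_zero]
  have hHr : ∀ n (x : ℝ), (H (n + 1)).eval x - (H (n + 1)).eval (x - 1) =
      x * (x + 6) * (H n).eval x := by
    intro n x
    rw [hHe, hHe, hHe, prod_range_succ, prod_range_succ']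
    have : ∀ i ∈ range n, (x - 1 + (((i + 1 : ℕ) : ℝ) + 1)) = x + (i + 1) := by
      intro i _; push_cast; ring
    rw [prod_congr rfl this]
    push_cast
    linear_combination (∏ i ∈ range n, (x + ((i : ℝ) + 1))) * hpr n x
  have hT := innerT_eq (fun n x => (H n).eval x) (by intro x; simp [hH0]) hHz hHr
  have hval := gen_value H hH0 hHz hHr n
  -- the value of `p n` at `-7/2`
  have hpv : (p n).eval (-(7/2) : ℝ) =
      (-1) ^ n * 9 ^ n * (16 * (n : ℝ) ^ 2 - 286 * n + 1215) / (1215 * Nat.factorial n) := by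
    rw [hHe, rootCoeff] at hval
    have e1 : ∏ i ∈ range n, ((-7/2 : ℝ) + (i + 1)) =
        (-1) ^ n * ∏ i ∈ range n, ((5/2 : ℝ) - i) := by
      rw [← card_range n, ← prod_const, card_range, ← prod_mul_distrib]
      apply prod_congr rfl; intro i _; ring
    have e2 : ∏ i ∈ range n, ((5/2 : ℝ) - i) ≠ 0 := by
      rw [prod_ne_zero_iff]
      intro i _ h
      have h5 : (5 : ℝ) = 2 * i := by linarith
      have : 5 = 2 * i := by exact_mod_cast h5
      omega
    have e3 : ((-1 : ℝ) ^ n) * (-1) ^ n = 1 := by rw [← mul_pow]; simp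
    rw [e1, show (-7/2 : ℝ) = -(7/2) by ring] at hval
    apply mul_left_cancel₀ e2
    linear_combination ((-1 : ℝ) ^ n) * hval - (∏ i ∈ range n, ((5/2 : ℝ) - i)) * (p n).eval (-(7/2) : ℝ) * e3
  obtain ⟨m, rfl⟩ : ∃ m, n = m + 1 := ⟨n - 1, by omega⟩
  have hsum := alt_sum (p (m + 1)) ω ((hpd _).trans hω) (by omega) (7/2) (by norm_num)
  rw [hpv] at hsum
  have hGpos : Real.Gamma ((ω : ℝ) + 7 / 2 + 1) ≠ 0 :=
    (Real.Gamma_pos_of_pos (by positivity)).ne'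
  have hG72 : Real.Gamma (7/2) = 15 / 8 * √π := by
    rw [show (7/2 : ℝ) = 1/2 + 1 + 1 + 1 by norm_num, Real.Gamma_add_one (by norm_num),
      Real.Gamma_add_one (by norm_num), Real.Gamma_add_one (by norm_num), Real.Gamma_one_half_eq]
    ring
  have hA : A (m + 1) 7 ω = (-1) ^ (m + 1) * Real.Gamma ((ω : ℝ) + 7 / 2 + 1) /
      (720 * Nat.factorial ω) *
      ∑ j ∈ range (ω + 1), (-1 : ℝ) ^ j * (Nat.choose ω j) *
        ((p (m + 1)).eval (j : ℝ) / (j + 7/2)) := by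
    unfold A
    rw [mul_sum, range_eq_Ico, sum_eq_sum_Ico_succ_bot (by omega)]
    rw [Nat.cast_zero, hp00 m, zero_div, mul_zero, mul_zero, zero_add]
    have hI : Icc 1 ω = Ico (0 + 1) (ω + 1) := by ext; simp [Nat.lt_succ_iff]
    rw [hI]
    apply sum_congr rfl
    intro j hj
    rw [mem_Ico] at hj
    have hin : ∑ k ∈ Icc 1 j, (-1 : ℝ) ^ k * (Nat.choose (2 * j + 7 - 1) (j - k)) * sphMu k 7 *
        (sphLam k 7 : ℝ) ^ (j + (m + 1)) = innerT j (j + (m + 1)) := by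
      unfold innerT
      rw [range_eq_Ico, sum_eq_sum_Ico_succ_bot (by omega)]
      have hI : Icc 1 j = Ico (0 + 1) (j + 1) := by ext; simp [Nat.lt_succ_iff]
      rw [hI]
      simp [sphLam]
    rw [hin, hT, hHe]
    have hprod : (∏ i ∈ range (m + 1), ((j : ℝ) + (i + 1))) * Nat.factorial j =
        Nat.factorial (j + (m + 1)) := by
      generalize m + 1 = l
      induction l with
      | zero => simp
      | succ l ih =>
        rw [prod_range_succ, ← add_assoc j l 1, Nat.factorial_succ]
        push_cast
        rw [← ih]; ring
    have hch : (Nat.choose ω j : ℝ) * (Nat.factorial j) * (Nat.factorial (ω - j)) =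
        Nat.factorial ω := by
      exact_mod_cast Nat.choose_mul_factorial_mul_factorial (by omega : j ≤ ω)
    have hf7 : (Nat.factorial (2 * j + 7) : ℝ) = (2 * j + 7) * Nat.factorial (2 * j + 6) := by
      rw [Nat.factorial_succ]; push_cast; ring
    rw [← hprod, ← hch, hf7]
    have n1 : (Nat.factorial j : ℝ) ≠ 0 := by positivity
    have n2 : (Nat.factorial (ω - j) : ℝ) ≠ 0 := by positivity
    have n3 : (Nat.factorial (2 * j + 6) : ℝ) ≠ 0 := by positivity
    have n4 : (Nat.choose ω j : ℝ) ≠ 0 := by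
      exact_mod_cast (Nat.choose_pos (by omega : j ≤ ω)).ne'
    have n5 : (∏ i ∈ range (m + 1), ((j : ℝ) + (i + 1))) ≠ 0 := by positivity
    have n6 : (2 * (j : ℝ) + 7) ≠ 0 := by positivity
    have n7 : ((j : ℝ) + 7 / 2) = (2 * j + 7) / 2 := by ring
    rw [n7]
    push_cast
    field_simp
  rw [hA, hsum, hG72, show (7/2 : ℝ) + ω + 1 = ω + 7/2 + 1 by ring]
  have hz : (3 : ℝ) ^ (2 * ((m + 1 : ℕ) : ℤ) - 6) = 9 ^ (m + 1) / 729 := by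
    rw [zpow_sub₀ (by norm_num), zpow_mul]
    norm_num
    norm_cast
  rw [hz]
  have n1 : (Nat.factorial ω : ℝ) ≠ 0 := by positivity
  have n2 : (Nat.factorial (m + 1) : ℝ) ≠ 0 := by positivity
  have e3 : ((-1 : ℝ) ^ (m + 1)) * (-1) ^ (m + 1) = 1 := by rw [← mul_pow]; simp
  generalize ((-1 : ℝ) ^ (m + 1)) = s at e3 ⊢
  field_simp
  rw [pow_two, e3]
  ring
end

section
/- For all integers ν ≥ 1, n ≥ 1 and ω ≥ 2n: A_{n,2ν}(ω) = (1/(2ν-1)!) · [ Σ_{t=0}^{ν-1} ((ν-1-t)!/(n-t)!) (ν-1/2)^{2n-2t} K_t^ν + Σ_{t=0}^{ν-1} K_t^ν Σ_{p=ν-t}^{n-t} (-1)^{p+ν-t-1} (ν-1/2)^{2n-2t-2p} B_{2p} (2^{1-2p} - 1) / (p · (n-t-p)! · (p-ν+t)!) ], where 1/(n-t)! is interpreted as 0 when n < t and the inner sum over p is empty when ν - t > n - t. -/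
open Finset

/-- The coefficients `K_t^ν` defined by
`Π_{i=0}^{ν-2}(z² - (i+1/2)²) = Σ_{t=0}^{ν-1} K_t^ν z^{2ν-2-2t}`. -/
noncomputable def Keven (ν t : ℕ) : ℝ :=
  (∏ i ∈ Finset.range (ν - 1), ((Polynomial.X : Polynomial ℝ) ^ 2 -
      Polynomial.C (((i : ℝ) + 1 / 2) ^ 2))).coeff (2 * ν - 2 - 2 * t)


namespace HeatAux
open PowerSeries

noncomputable def EX (a : ℝ) : PowerSeries ℝ := rescale a (exp ℝ)

lemma EX_mul (a b : ℝ) : EX a * EX b = EX (a + b) := exp_mul_exp_eq_exp_add a b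

lemma EX_zero : EX 0 = 1 := by
  simp [EX]

lemma EX_pow (a : ℝ) (k : ℕ) : EX a ^ k = EX (k * a) := by
  induction k with
  | zero => simp [EX_zero]
  | succ k ih => rw [pow_succ, ih, EX_mul]; congr 1; push_cast; ring

lemma coeff_EX (a : ℝ) (n : ℕ) : coeff n (EX a) = a ^ n / n.factorial := by
  simp [EX, coeff_rescale, coeff_exp]; rfl

noncomputable def Ls : PowerSeries ℝ := EX (1/2) - EX (-(1/2))

noncomputable def sig : PowerSeries ℝ := PowerSeries.mk fun n => coeff (n + 1) Ls

lemma Ls_eq : Ls = X * sig := by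
  ext n
  cases n with
  | zero => rw [Ls, map_sub, coeff_EX, coeff_EX]; simp
  | succ n => rw [coeff_succ_X_mul]; simp [sig]

noncomputable def tau : PowerSeries ℝ :=
  2 * rescale (1/2 : ℝ) (bernoulliPowerSeries ℝ) - bernoulliPowerSeries ℝ

lemma coeff_tau (n : ℕ) : coeff n tau = (2 * (1/2 : ℝ) ^ n - 1) * (bernoulli n : ℚ) / n.factorial := by
  have h2 : (2 : PowerSeries ℝ) = C (2 : ℝ) := (map_ofNat C 2).symm
  rw [tau, map_sub, h2, coeff_C_mul, coeff_rescale]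
  simp [bernoulliPowerSeries]
  ring

lemma tau_mul_Ls : tau * Ls = X := by
  have hb : bernoulliPowerSeries ℝ * (EX 1 - 1) = X := by
    simpa [EX] using bernoulliPowerSeries_mul_exp_sub_one ℝ
  have hb1 : 2 * rescale (1/2 : ℝ) (bernoulliPowerSeries ℝ) * (EX (1/2) - 1) = X := by
    have := congrArg (rescale (1/2 : ℝ)) (bernoulliPowerSeries_mul_exp_sub_one ℝ)
    rw [map_mul, map_sub, map_one, rescale_X] at this
    rw [mul_assoc]
    unfold EX
    rw [this]
    have h2 : (2 : PowerSeries ℝ) = C (2 : ℝ) := (map_ofNat C 2).symm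
    rw [h2, ← mul_assoc, ← map_mul]; norm_num
  have h1 : EX 1 = EX (1/2) * EX (1/2) := by rw [EX_mul]; norm_num
  have h0 : EX (1/2) * EX (-(1/2)) = 1 := by rw [EX_mul]; norm_num [EX_zero]
  rw [h1] at hb
  unfold tau Ls
  generalize 2 * rescale (1/2 : ℝ) (bernoulliPowerSeries ℝ) = b1 at *
  generalize bernoulliPowerSeries ℝ = b at *
  generalize EX (1/2) = u at *
  generalize EX (-(1/2)) = v at *
  linear_combination v * (u + 1) * hb1 - v * hb + (X - u * (b1 - b)) * h0

lemma tau_mul_sig : tau * sig = 1 := by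
  have h := tau_mul_Ls
  rw [Ls_eq] at h
  have : X * (tau * sig) = X * (1 : PowerSeries ℝ) := by rw [mul_one]; linear_combination h
  exact mul_left_cancel₀ X_ne_zero this

noncomputable def Ws : PowerSeries ℝ := PowerSeries.mk fun n => coeff (n + 2) (sig ^ 2)

lemma sig_sq : sig ^ 2 = 1 + X ^ 2 * Ws := by
  have c0 : coeff 0 sig = 1 := by simp [sig, Ls, coeff_EX]; norm_num
  have c1 : coeff 1 sig = 0 := by simp [sig, Ls, coeff_EX]
  ext n
  rw [map_add, coeff_X_pow_mul']
  match n with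
  | 0 => rw [coeff_zero_eq_constantCoeff] at c0 ⊢; simp [c0]
  | 1 => 
    simp only [sq, coeff_mul, coeff_one]
    rw [Finset.Nat.sum_antidiagonal_eq_sum_range_succ_mk]
    simp [Finset.sum_range_succ, c1]
  | n + 2 => simp [Ws, coeff_one]

/-- the polynomial in `N` whose values are `coeff (2p) (sig^(2N-1))` -/
noncomputable def Cp (p : ℕ) : Polynomial ℝ :=
  ∑ i ∈ Finset.range (p + 1),
    Polynomial.C (coeff (2 * p - 2 * i) (tau * Ws ^ i) / i.factorial) * descPochhammer ℝ i

lemma Cp_natDegree (p : ℕ) : (Cp p).natDegree ≤ p := by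
  unfold Cp
  apply Polynomial.natDegree_sum_le_of_forall_le
  intro i hi
  refine (Polynomial.natDegree_C_mul_le _ _).trans ?_
  rw [descPochhammer_natDegree]
  simp at hi; omega

lemma Cp_eval (p N : ℕ) : (Cp p).eval (N : ℝ) = coeff (2 * p) (tau * (sig ^ 2) ^ N) := by
  have h1 : ∀ i ∈ Finset.range (p + 1), (Polynomial.C (coeff (2 * p - 2 * i) (tau * Ws ^ i) / i.factorial) * descPochhammer ℝ i).eval (N : ℝ)
     = (N.choose i : ℝ) * coeff (2 * p) (X ^ (2 * i) * (tau * Ws ^ i)) := by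
    intro i hi
    simp at hi
    rw [Polynomial.eval_mul, Polynomial.eval_C, descPochhammer_eval_eq_descFactorial, coeff_X_pow_mul', if_pos (by omega),
      Nat.descFactorial_eq_factorial_mul_choose]
    have : (i.factorial : ℝ) ≠ 0 := by positivity
    push_cast
    field_simp
  have h2 : ∀ i, p + 1 ≤ i → (N.choose i : ℝ) * coeff (2 * p) (X ^ (2 * i) * (tau * Ws ^ i)) = 0 := by
    intro i hi
    rw [coeff_X_pow_mul', if_neg (by omega), mul_zero]
  have h3 : ∀ i, N + 1 ≤ i → (N.choose i : ℝ) * coeff (2 * p) (X ^ (2 * i) * (tau * Ws ^ i)) = 0 := by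
    intro i hi
    rw [Nat.choose_eq_zero_of_lt (by omega)]; simp
  rw [Cp, Polynomial.eval_finsetSum, Finset.sum_congr rfl h1, sig_sq, add_comm (1 : PowerSeries ℝ), add_pow, Finset.mul_sum, map_sum]
  rw [Finset.sum_subset (s₁ := Finset.range (p+1)) (s₂ := Finset.range (p + 1 + N + 1)) (by intro i; simp; omega)
     (by intro i _ hi; simp at hi; exact h2 i (by omega))] 
  rw [← Finset.sum_subset (s₁ := Finset.range (N+1)) (s₂ := Finset.range (p + 1 + N + 1)) (by intro i; simp; omega)
     (by intro i _ hi; simp at hi; exact h3 i (by omega))] 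
  apply Finset.sum_congr rfl
  intro i hi
  have h2 : (N.choose i : PowerSeries ℝ) = C (N.choose i : ℝ) := by simp
  rw [← coeff_C_mul, ← h2]
  congr 1
  simp only [one_pow, mul_pow, ← pow_mul]
  ring

/-- central differences of powers at 0 -/
noncomputable def Dc (r k : ℕ) : ℝ :=
  ∑ i ∈ Finset.range (r + 1), (-1 : ℝ) ^ i * (r.choose i) * ((r : ℝ) / 2 - i) ^ k

lemma Dc_eq (r k : ℕ) : Dc r k = k.factorial * coeff k (Ls ^ r) := by
  have : Ls ^ r = ∑ i ∈ Finset.range (r + 1), C ((-1 : ℝ) ^ i * (r.choose i)) * EX ((r : ℝ) / 2 - i) := by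
    rw [Ls, sub_eq_add_neg, add_comm, add_pow]
    apply Finset.sum_congr rfl
    intro i hi
    simp at hi
    rw [neg_pow, EX_pow, EX_pow, mul_assoc ((-1) ^ i), EX_mul]
    have : ((i:ℝ) * -(1/2) + ((r - i : ℕ) : ℝ) * (1/2)) = (r : ℝ) / 2 - i := by
      rw [Nat.cast_sub (by omega)]; ring
    rw [this]
    simp
    ring
  rw [this, map_sum, Dc, Finset.mul_sum]
  apply Finset.sum_congr rfl
  intro i hi
  rw [coeff_C_mul, coeff_EX]
  have : (k.factorial : ℝ) ≠ 0 := by positivity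
  field_simp

lemma Dc_eq_zero (r k : ℕ) (h : k < r) : Dc r k = 0 := by
  rw [Dc_eq, Ls_eq, mul_pow, coeff_X_pow_mul', if_neg (by omega), mul_zero]

lemma Dc_eq_Cp (N p : ℕ) (hN : 1 ≤ N) :
    Dc (2 * N - 1) (2 * N - 1 + 2 * p) = (2 * N - 1 + 2 * p).factorial * (Cp p).eval (N : ℝ) := by
  rw [Dc_eq, Ls_eq, mul_pow, coeff_X_pow_mul', if_pos (by omega), Cp_eval]
  congr 2
  · congr 1; omega
  · obtain ⟨m, rfl⟩ : ∃ m, N = m + 1 := ⟨N - 1, by omega⟩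
    rw [← pow_mul, show 2 * (m + 1) = (2 * (m + 1) - 1) + 1 by omega, pow_succ']
    rw [← mul_assoc, tau_mul_sig, one_mul]
    simp

lemma Cp_eval_zero (p : ℕ) : (Cp p).eval 0 = (2 * (1/2 : ℝ) ^ (2 * p) - 1) * (bernoulli (2 * p) : ℚ) / (2 * p).factorial := by
  have := Cp_eval p 0
  simp only [Nat.cast_zero, pow_zero, mul_one] at this
  rw [this, coeff_tau]

lemma altsum (F : Polynomial ℝ) (M : ℕ) (hF : F.natDegree < M) :
    ∑ N ∈ Finset.range (M + 1), (-1 : ℝ) ^ N * (M.choose N) * F.eval (N : ℝ) = 0 := by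
  have h := congrFun (Polynomial.fwdDiff_iter_eq_zero_of_degree_lt hF) 0
  rw [fwdDiff_iter_eq_sum_shift] at h
  have h' := congrArg (fun x => (-1 : ℝ) ^ M * x) h
  simp only [Finset.mul_sum, Pi.zero_apply, mul_zero] at h'
  rw [← h']
  apply Finset.sum_congr rfl
  intro N hN
  simp at hN
  obtain ⟨m, rfl⟩ : ∃ m, M = N + m := ⟨M - N, by omega⟩
  simp
  rw [← mul_assoc, ← mul_assoc]
  congr 2
  rw [pow_add, mul_assoc, ← mul_pow]; simp

/-- the polynomial F -/
noncomputable def Fp (a p : ℕ) : Polynomial ℝ :=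
  Polynomial.C ((2 : ℝ) ^ p / 2) * (∏ i ∈ Finset.range p, (Polynomial.C 2 * Polynomial.X + Polynomial.C (2 * (i : ℝ) + 1))) *
    ((descPochhammer ℝ (a - 1)).comp (Polynomial.X + Polynomial.C ((p : ℝ) - 1))) * Cp p

lemma Fp_natDegree (a p : ℕ) : (Fp a p).natDegree ≤ p + (a - 1) + p := by
  unfold Fp
  refine Polynomial.natDegree_mul_le_of_le (Polynomial.natDegree_mul_le_of_le ?_ ?_) (Cp_natDegree p)
  · refine (Polynomial.natDegree_C_mul_le _ _).trans ?_
    refine (Polynomial.natDegree_prod_le _ _).trans ?_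
    refine (Finset.sum_le_card_nsmul _ _ 1 ?_).trans (by simp)
    intro i hi
    exact Polynomial.natDegree_linear_le
  · rw [Polynomial.natDegree_comp, descPochhammer_natDegree, Polynomial.natDegree_X_add_C, mul_one]

lemma fact_aux (N p : ℕ) : ((2 * N + 2 * p).factorial : ℝ) =
    (2 * N).factorial * (2 : ℝ) ^ p * (∏ i ∈ Finset.range p, (2 * (N : ℝ) + (2 * (i : ℝ) + 1))) * (N + p).factorial / N.factorial := by
  have : (N.factorial : ℝ) ≠ 0 := by positivity
  induction p with
  | zero => simp; field_simp
  | succ p ih =>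
    rw [show 2 * N + 2 * (p + 1) = (2 * N + 2 * p) + 1 + 1 by ring, Nat.factorial_succ, Nat.factorial_succ, prod_range_succ,
      ← add_assoc N p 1, Nat.factorial_succ]
    push_cast
    rw [ih]
    field_simp
    ring

lemma Fp_eval (a p N : ℕ) (ha : 1 ≤ a) (hN : 1 ≤ N) (h : a ≤ N + p) :
    (Fp a p).eval (N : ℝ) = N.factorial / ((N + p - a).factorial * (2 * N).factorial) * Dc (2 * N - 1) (2 * N - 1 + 2 * p) := by
  rw [Dc_eq_Cp _ _ hN, Fp]
  have e : (N : ℝ) + ((p : ℝ) - 1) = ((N + p - 1 : ℕ) : ℝ) := by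
    rw [Nat.cast_sub (by omega)]; push_cast; ring
  simp only [Polynomial.eval_mul, Polynomial.eval_C, Polynomial.eval_comp, Polynomial.eval_prod, Polynomial.eval_add, Polynomial.eval_X, e]
  rw [descPochhammer_eval_eq_descFactorial, ← mul_assoc]
  congr 1
  have h1 := fact_aux N p
  obtain ⟨m, rfl⟩ : ∃ m, N = m + 1 := ⟨N - 1, by omega⟩
  have h2 := Nat.factorial_mul_descFactorial (n := m + 1 + p - 1) (k := a - 1) (by omega)
  rw [show m + 1 + p - 1 - (a - 1) = m + 1 + p - a by omega, show m + 1 + p - 1 = m + p by omega] at h2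
  rw [show m + 1 + p - 1 = m + p by omega]
  rw [show 2 * (m + 1) + 2 * p = (2 * (m + 1) - 1 + 2 * p) + 1 by omega, Nat.factorial_succ, 
    show m + 1 + p = m + p + 1 by ring, Nat.factorial_succ, ← h2] at h1
  have h3 : (((2 * (m + 1) - 1 + 2 * p) + 1 : ℕ) : ℝ) = 2 * ((m + p + 1 : ℕ) : ℝ) := by
    rw [show (2 * (m + 1) - 1 + 2 * p) + 1 = 2 * (m + p + 1) by omega]; push_cast; ring
  rw [Nat.cast_mul, h3] at h1
  have : ((2 * (m + 1)).factorial : ℝ) ≠ 0 := by positivity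
  have : ((m + 1).factorial : ℝ) ≠ 0 := by positivity
  have : ((m + 1 + p - a).factorial : ℝ) ≠ 0 := by positivity
  have h4 : (((m + p + 1 : ℕ) : ℝ)) ≠ 0 := by positivity
  rw [Nat.cast_mul, Nat.cast_mul] at h1
  have h5 : ((2 * (m + 1) - 1 + 2 * p).factorial : ℝ) = (2 * (m + 1)).factorial * (2 : ℝ) ^ p *
   (∏ i ∈ Finset.range p, (2 * ((m + 1 : ℕ) : ℝ) + (2 * (i : ℝ) + 1))) * ((m + 1 + p - a).factorial * (m + p).descFactorial (a - 1)) / (m + 1).factorial / 2 := by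
    field_simp at h1 ⊢
    linear_combination h1
  rw [h5]
  field_simp

lemma Fp_eval_zero' (a p N : ℕ) (hN : 1 ≤ N + p) (h : N + p < a) :
    (Fp a p).eval (N : ℝ) = 0 := by
  rw [Fp]
  have e : (N : ℝ) + ((p : ℝ) - 1) = ((N + p - 1 : ℕ) : ℝ) := by
    rw [Nat.cast_sub (by omega)]; push_cast; ring
  simp only [Polynomial.eval_mul, Polynomial.eval_C, Polynomial.eval_comp, Polynomial.eval_prod, Polynomial.eval_add, Polynomial.eval_X, e]
  rw [descPochhammer_eval_eq_descFactorial, Nat.descFactorial_of_lt (by omega)]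
  simp

lemma Fp_zero_zero (a : ℕ) : (Fp a 0).eval 0 = (-1 : ℝ) ^ (a - 1) * (a - 1).factorial / 2 := by
  rw [Fp]
  simp only [Polynomial.eval_mul, Cp_eval_zero, Polynomial.eval_comp]
  have : ∀ k : ℕ, (descPochhammer ℝ k).eval (-1) = (-1 : ℝ) ^ k * k.factorial := by
    intro k
    induction k with
    | zero => simp
    | succ k ih => rw [descPochhammer_succ_eval, ih, Nat.factorial_succ]; push_cast; ring
  simp [this]
  ring

lemma Fp_zero (a p : ℕ) (ha : 1 ≤ a) (h : a ≤ p) :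
    (Fp a p).eval 0 = (2 * (1/2 : ℝ) ^ (2 * p) - 1) * (bernoulli (2 * p) : ℚ) / (2 * p * (p - a).factorial) := by
  rw [Fp]
  have e : (0 : ℝ) + ((p : ℝ) - 1) = ((p - 1 : ℕ) : ℝ) := by
    rw [Nat.cast_sub (by omega)]; push_cast; ring
  simp only [Polynomial.eval_mul, Polynomial.eval_C, Polynomial.eval_comp, Polynomial.eval_prod, Polynomial.eval_add, Polynomial.eval_X, e, Cp_eval_zero]
  rw [descPochhammer_eval_eq_descFactorial]
  have h1 := fact_aux 0 p
  have h2 := Nat.factorial_mul_descFactorial (n := p - 1) (k := a - 1) (by omega)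
  rw [show p - 1 - (a - 1) = p - a by omega] at h2
  have h3 : (p.factorial : ℝ) = p * ((p - a).factorial * (p - 1).descFactorial (a - 1)) := by
    rw [← Nat.mul_factorial_pred (by omega : p ≠ 0), ← h2]; push_cast; ring
  simp only [mul_zero, zero_add, Nat.factorial_zero, Nat.cast_zero] at h1
  simp only [mul_zero, zero_add]
  rw [h1, h3]
  have : ((p - a).factorial : ℝ) ≠ 0 := by positivity
  have : (p : ℝ) ≠ 0 := by
    have : 0 < p := by omega
    positivity
  have h6 : ((p - 1).descFactorial (a - 1) : ℝ) ≠ 0 := by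
    have := Nat.descFactorial_eq_zero_iff_lt (n := p - 1) (k := a - 1)
    norm_cast
    rw [this]; omega
  have h7 : (∏ i ∈ Finset.range p, (2 * (i : ℝ) + 1)) ≠ 0 := by
    apply ne_of_gt
    apply Finset.prod_pos
    intro i _; positivity
  field_simp

/-- the inner sum over `N` -/
lemma U_eq (a p M : ℕ) (ha : 1 ≤ a) (hM : 2 * p + a - 1 < M) :
    ∑ N ∈ (Finset.Icc 1 M).filter (fun N => a ≤ N + p), (-1 : ℝ) ^ N * (M.factorial / ((M - N).factorial * (N + p - a).factorial * (2 * N).factorial))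
      * Dc (2 * N - 1) (2 * N - 1 + 2 * p) = - (Fp a p).eval 0 := by
  have h := altsum (Fp a p) M (lt_of_le_of_lt (Fp_natDegree a p) (by omega))
  rw [Finset.range_eq_Ico, Finset.sum_eq_sum_Ico_succ_bot (by omega)] at h
  simp only [pow_zero, Nat.choose_zero_right, Nat.cast_zero, Nat.cast_one, one_mul, zero_add] at h
  rw [← sub_eq_zero, sub_neg_eq_add, add_comm]
  refine Eq.trans ?_ h
  congr 1
  rw [show Finset.Ico 1 (M + 1) = Finset.Icc 1 M by ext; simp]
  rw [Finset.sum_filter]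
  apply Finset.sum_congr rfl
  intro N hN
  simp at hN
  split_ifs with hc
  · rw [Fp_eval a p N ha hN.1 hc, Nat.cast_choose ℝ hN.2]
    have : (N.factorial : ℝ) ≠ 0 := by positivity
    field_simp
  · rw [Fp_eval_zero' a p N (by omega) (by omega)]; simp
end HeatAux

namespace HeatAux

lemma Keven_sum (ν : ℕ) (hν : 1 ≤ ν) (x : ℝ) :
    ∏ i ∈ Finset.range (ν - 1), (x ^ 2 - ((i : ℝ) + 1 / 2) ^ 2) =
      ∑ t ∈ Finset.range ν, Keven ν t * x ^ (2 * (ν - 1 - t)) := by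
  set R : Polynomial ℝ := ∏ i ∈ Finset.range (ν - 1), ((Polynomial.X : Polynomial ℝ) -
      Polynomial.C (((i : ℝ) + 1 / 2) ^ 2)) with hR
  have hexp : (∏ i ∈ Finset.range (ν - 1), ((Polynomial.X : Polynomial ℝ) ^ 2 -
      Polynomial.C (((i : ℝ) + 1 / 2) ^ 2))) = Polynomial.expand ℝ 2 R := by
    rw [hR, map_prod]
    apply Finset.prod_congr rfl
    intro i _
    rw [map_sub, Polynomial.expand_X, Polynomial.expand_C]
  have hdeg : R.natDegree < ν := by
    rw [hR, Polynomial.natDegree_prod_of_monic _ _ (fun i _ => Polynomial.monic_X_sub_C _)]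
    simp only [Polynomial.natDegree_X_sub_C]
    simp; omega
  have hK : ∀ t ∈ Finset.range ν, Keven ν t * x ^ (2 * (ν - 1 - t)) =
      (fun j => R.coeff j * (x ^ 2) ^ j) (ν - 1 - t) := by
    intro t ht
    simp at ht
    simp only [Keven, hexp]
    rw [show 2 * ν - 2 - 2 * t = (ν - 1 - t) * 2 by omega, Polynomial.coeff_expand_mul (by norm_num), pow_mul]
  rw [Finset.sum_congr rfl hK, Finset.sum_range_reflect (fun j => R.coeff j * (x ^ 2) ^ j), ← Polynomial.eval_eq_sum_range' hdeg, hR, Polynomial.eval_prod]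
  simp

lemma prod_fact (c r : ℕ) (h : r ≤ c) :
    ((c - r).factorial : ℝ) * ∏ i ∈ Finset.range r, (((c : ℝ) + 1 + i) * (c - i)) = (c + r).factorial := by
  induction r with
  | zero => simp
  | succ r ih =>
    have := ih (by omega)
    rw [prod_range_succ, ← add_assoc, Nat.factorial_succ]
    push_cast
    rw [← this, show c - r = (c - (r + 1)) + 1 by omega, Nat.factorial_succ]
    have e : ((c - (r + 1) + 1 : ℕ) : ℝ) = c - r := by
      rw [show c - (r + 1) + 1 = c - r by omega, Nat.cast_sub (by omega)]
    rw [Nat.cast_mul, e]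
    ring

lemma sphMu_eq (ν k : ℕ) (hν : 1 ≤ ν) (hk : 1 ≤ k) :
    sphMu k (2 * ν) = 2 / (2 * ν - 1).factorial * (((k + ν : ℕ) : ℝ) - 1 / 2) *
      ∏ i ∈ Finset.range (ν - 1), ((((k + ν : ℕ) : ℝ) - 1 / 2) ^ 2 - ((i : ℝ) + 1 / 2) ^ 2) := by
  rw [sphMu, if_neg (by omega)]
  have h := prod_fact (k + (ν - 1)) (ν - 1) (by omega)
  rw [show k + (ν - 1) - (ν - 1) = k by omega, show k + (ν - 1) + (ν - 1) = k + 2 * ν - 2 by omega] at h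
  rw [← h]
  have e : ((k + (ν - 1) : ℕ) : ℝ) = (k : ℝ) + ν - 1 := by
    push_cast [Nat.cast_sub hν]; ring
  have hp : ∀ i ∈ Finset.range (ν - 1), (((((k + (ν - 1) : ℕ)) : ℝ) + 1 + i) * (((k + (ν - 1) : ℕ) : ℝ) - i)) =
     ((((k + ν : ℕ) : ℝ) - 1 / 2) ^ 2 - ((i : ℝ) + 1 / 2) ^ 2) := by
    intro i _
    rw [e]; push_cast; ring
  rw [Finset.prod_congr rfl hp]
  have : (k.factorial : ℝ) ≠ 0 := by positivity
  push_cast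
  field_simp

/-- the odd polynomial -/
noncomputable def gg (ν e : ℕ) (x : ℝ) : ℝ :=
  x * (∏ i ∈ Finset.range (ν - 1), (x ^ 2 - ((i : ℝ) + 1 / 2) ^ 2)) * (x ^ 2 - ((ν : ℝ) - 1 / 2) ^ 2) ^ e

lemma gg_odd (ν e : ℕ) (x : ℝ) : gg ν e (-x) = - gg ν e x := by
  unfold gg; simp only [neg_sq]; ring

lemma gg_zero (ν e m : ℕ) (hm : 1 ≤ m) (h : m < ν) : gg ν e ((m : ℝ) - 1 / 2) = 0 := by
  unfold gg
  rw [Finset.prod_eq_zero (i := m - 1) (by simp; omega)]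
  · simp
  · rw [Nat.cast_sub hm]; push_cast; ring

lemma gg_zero' (ν e : ℕ) (he : 1 ≤ e) : gg ν e ((ν : ℝ) - 1 / 2) = 0 := by
  unfold gg
  rw [sub_self, zero_pow (by omega), mul_zero]

lemma half_sum (N : ℕ) (hN : 1 ≤ N) (f : ℝ → ℝ) (hf : ∀ x, f (-x) = - f x) :
    ∑ m ∈ Finset.Icc 1 N, (-1 : ℝ) ^ m * ((2 * N - 1).choose (N - m)) * f ((m : ℝ) - 1 / 2) =
    (-1 : ℝ) ^ N / 2 * ∑ i ∈ Finset.range (2 * N - 1 + 1), (-1 : ℝ) ^ i * ((2 * N - 1).choose i) * f (((2 * N - 1 : ℕ) : ℝ) / 2 - i) := by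
  have hc : ((2 * N - 1 : ℕ) : ℝ) / 2 = N - 1 / 2 := by
    rw [Nat.cast_sub (by omega)]; push_cast; ring
  rw [hc, show 2 * N - 1 + 1 = N + N by omega, Finset.sum_range_add]
  rw [← Finset.sum_range_reflect (fun x => (-1 : ℝ) ^ (N + x) * ((2 * N - 1).choose (N + x)) * f ((N : ℝ) - 1 / 2 - ((N + x : ℕ) : ℝ)))]
  rw [← Finset.sum_add_distrib, Finset.mul_sum]
  rw [show Finset.Icc 1 N = Finset.Ico 1 (N + 1) by ext; simp, Finset.sum_Ico_eq_sum_range, ← Finset.sum_range_reflect]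
  simp only [Nat.add_sub_cancel]
  apply Finset.sum_congr rfl
  intro l hl
  simp at hl
  rw [show 1 + (N - 1 - l) = N - l by omega, show N - (N - l) = l by omega]
  rw [show (2 * N - 1).choose (N + (N - 1 - l)) = (2 * N - 1).choose l by
    rw [← Nat.choose_symm (by omega : l ≤ 2 * N - 1)]; congr 1; omega]
  have e1 : (N : ℝ) - 1 / 2 - ((N + (N - 1 - l) : ℕ) : ℝ) = - ((N : ℝ) - 1 / 2 - l) := by
    have : ((N + (N - 1 - l) : ℕ) : ℝ) = 2 * N - 1 - l := by
      rw [show N + (N - 1 - l) = 2 * N - 1 - l by omega, Nat.cast_sub (by omega), Nat.cast_sub (by omega)]; push_cast; ring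
    rw [this]; ring
  rw [e1, hf, Nat.cast_sub (by omega), show (N : ℝ) - l - 1 / 2 = (N : ℝ) - 1 / 2 - l by ring]
  obtain ⟨j, rfl⟩ : ∃ j, N = l + 1 + j := ⟨N - (l + 1), by omega⟩
  rw [show l + 1 + j - l = j + 1 by omega, show l + 1 + j + (l + 1 + j - 1 - l) = l + 2 * j + 1 by omega]
  have : ((-1 : ℝ) ^ j) ^ 2 = 1 := by rw [← pow_mul, mul_comm, pow_mul]; simp
  have h2 : ((-1 : ℝ) ^ l) ^ 2 = 1 := by rw [← pow_mul, mul_comm, pow_mul]; simp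
  have h3 : (-1 : ℝ) ^ (l + 2 * j + 1) = - (-1) ^ l := by
    rw [pow_succ, pow_add, pow_mul]; simp
  have h4 : (-1 : ℝ) ^ (l + 1 + j) = - (-1) ^ l * (-1) ^ j := by
    rw [pow_add, pow_succ]; ring
  have h5 : (-1 : ℝ) ^ (j + 1) = - (-1) ^ j := by
    rw [pow_succ]; ring
  rw [h3, h4, h5]
  generalize f _ = y
  generalize ((2 * (l + 1 + j) - 1).choose l : ℝ) = c
  linear_combination ((-1) ^ j * c * y) * h2

lemma gg_diff (ν e r : ℕ) (hν : 1 ≤ ν) :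
    ∑ i ∈ Finset.range (r + 1), (-1 : ℝ) ^ i * (r.choose i) * gg ν e ((r : ℝ) / 2 - i) =
    ∑ t ∈ Finset.range ν, Keven ν t * ∑ q ∈ Finset.range (e + 1), (e.choose q) * (-((ν : ℝ) - 1 / 2) ^ 2) ^ q *
      Dc r (2 * (ν - 1 - t) + 1 + 2 * (e - q)) := by
  have h : ∀ x, gg ν e x = ∑ t ∈ Finset.range ν, Keven ν t * ∑ q ∈ Finset.range (e + 1), (e.choose q) * (-((ν : ℝ) - 1 / 2) ^ 2) ^ q *
      x ^ (2 * (ν - 1 - t) + 1 + 2 * (e - q)) := by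
    intro x
    rw [gg, Keven_sum ν hν, sub_eq_add_neg (x ^ 2), add_comm (x ^ 2), add_pow, Finset.mul_sum (Finset.range ν), Finset.sum_mul]
    apply Finset.sum_congr rfl
    intro t _
    rw [Finset.mul_sum, Finset.mul_sum]
    apply Finset.sum_congr rfl
    intro q _
    rw [pow_add, pow_add, pow_one, pow_mul x 2 (e - q)]
    ring
  simp only [h, Dc, Finset.mul_sum]
  rw [Finset.sum_comm]
  apply Finset.sum_congr rfl
  intro t _
  rw [Finset.sum_comm]
  apply Finset.sum_congr rfl
  intro q _
  apply Finset.sum_congr rfl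
  intro i _
  ring

lemma reindex (ν n N t : ℕ) (y : ℝ) (hN : 1 ≤ N) (ht : t < ν) (h : ν ≤ N + n) :
    1 / ((N + n - ν).factorial : ℝ) * ∑ q ∈ Finset.range (N + n - ν + 1), ((N + n - ν).choose q) * y ^ q *
      Dc (2 * N - 1) (2 * (ν - 1 - t) + 1 + 2 * (N + n - ν - q)) =
    ∑ p ∈ Finset.range (n + 1), if t + p ≤ n ∧ ν ≤ N + t + p then y ^ (n - t - p) / ((n - t - p).factorial * (N + t + p - ν).factorial)
      * Dc (2 * N - 1) (2 * N - 1 + 2 * p) else 0 := by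
  rw [← Finset.sum_filter, Finset.mul_sum]
  rw [← Finset.sum_subset (s₁ := (Finset.range (N + n - ν + 1)).filter (fun q => q + t ≤ n)) (Finset.filter_subset _ _)]
  · refine Finset.sum_bij' (fun q _ => n - t - q) (fun p _ => n - t - p) ?_ ?_ ?_ ?_ ?_
    · intro q hq; simp at hq ⊢; omega
    · intro q hq; simp at hq ⊢; omega
    · intro q hq; simp at hq ⊢; omega
    · intro q hq; simp at hq ⊢; omega
    · intro q hq
      simp at hq
      rw [Nat.cast_choose ℝ (show q ≤ N + n - ν by omega)]
      rw [show n - t - (n - t - q) = q by omega, show N + t + (n - t - q) - ν = N + n - ν - q by omega,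
        show 2 * (ν - 1 - t) + 1 + 2 * (N + n - ν - q) = 2 * N - 1 + 2 * (n - t - q) by omega]
      have : ((N + n - ν).factorial : ℝ) ≠ 0 := by positivity
      field_simp
  · intro q hq hq'
    simp at hq hq'
    rw [Dc_eq_zero _ _ (by have := hq' hq; omega)]
    simp

lemma A_eq1 (ν n ω : ℕ) (hν : 1 ≤ ν) (hn : 1 ≤ n) :
    A n (2 * ν) ω = 4 * (-1 : ℝ) ^ (n + ν) / (2 * ν - 1).factorial *
      ∑ N ∈ (Finset.Icc 1 (ω + ν)).filter (fun N => ν ≤ N + n),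
        (ω + ν).factorial / ((ω + ν - N).factorial * (N + n - ν).factorial * (2 * N).factorial : ℝ) *
          ∑ m ∈ Finset.Icc 1 N, (-1 : ℝ) ^ m * ((2 * N - 1).choose (N - m)) * gg ν (N + n - ν) ((m : ℝ) - 1 / 2) := by
  have hs : Finset.Icc (1 + ν) (ω + ν) ⊆ (Finset.Icc 1 (ω + ν)).filter (fun N => ν ≤ N + n) := by
    intro N hN; simp at hN ⊢; omega
  rw [← Finset.sum_subset hs]
  · rw [A, Finset.mul_sum, ← Finset.map_add_right_Icc, Finset.sum_map]
    apply Finset.sum_congr rfl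
    intro j hj
    simp at hj
    simp only [addRightEmbedding_apply]
    have hG : Real.Gamma ((ω : ℝ) + ((2 * ν : ℕ) : ℝ) / 2 + 1) = (ω + ν).factorial := by
      rw [← Real.Gamma_nat_eq_factorial]; congr 1; push_cast; ring
    rw [hG, show ω + ν - (j + ν) = ω - j by omega, show j + ν + n - ν = j + n by omega, show 2 * (j + ν) = 2 * j + 2 * ν by ring]
    have hs2 : Finset.Icc (1 + ν) (j + ν) ⊆ Finset.Icc 1 (j + ν) := by
      intro N hN; simp at hN ⊢; omega
    rw [← Finset.sum_subset hs2]
    · rw [← Finset.map_add_right_Icc, Finset.sum_map, Finset.mul_sum, Finset.mul_sum, Finset.mul_sum]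
      apply Finset.sum_congr rfl
      intro k hk
      simp at hk
      simp only [addRightEmbedding_apply]
      rw [sphMu_eq ν k hν hk.1, show j + ν - (k + ν) = j - k by omega, gg]
      have hl : (sphLam k (2 * ν) : ℝ) = (((k + ν : ℕ) : ℝ) - 1 / 2) ^ 2 - ((ν : ℝ) - 1 / 2) ^ 2 := by
        rw [sphLam, Nat.cast_mul, Nat.cast_sub (by omega)]; push_cast; ring
      rw [hl]
      have e : (-1 : ℝ) ^ (n + ν) * (-1) ^ (k + ν) = (-1) ^ n * (-1) ^ k := by
        rw [pow_add, pow_add]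
        have : ((-1 : ℝ) ^ ν) ^ 2 = 1 := by rw [← pow_mul, mul_comm, pow_mul]; simp
        linear_combination ((-1) ^ n * (-1) ^ k) * this
      generalize (∏ i ∈ Finset.range (ν - 1), ((((k + ν : ℕ) : ℝ) - 1 / 2) ^ 2 - ((i : ℝ) + 1 / 2) ^ 2)) = P
      generalize ((((k + ν : ℕ) : ℝ) - 1 / 2) ^ 2 - ((ν : ℝ) - 1 / 2) ^ 2) ^ (j + n) = Q
      generalize (((k + ν : ℕ) : ℝ) - 1 / 2) = x
      field_simp
      linear_combination (-4 * x * P * Q * ((2 * j + 2 * ν - 1).choose (j - k))) * e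
    · intro m hm hm'
      simp at hm hm'
      rcases lt_or_eq_of_le (show m ≤ ν by omega) with h | rfl
      · rw [gg_zero _ _ _ hm.1 h]; simp
      · rw [gg_zero' _ _ (by omega)]; simp
  · intro N hN hN'
    simp at hN hN'
    rw [Finset.sum_eq_zero, mul_zero]
    intro m hm
    simp at hm
    rcases lt_or_eq_of_le (show m ≤ ν by omega) with h | rfl
    · rw [gg_zero _ _ _ hm.1 h]; simp
    · rw [gg_zero' _ _ (by omega)]; simp

lemma A_eq2 (ν n ω : ℕ) (hν : 1 ≤ ν) (hn : 1 ≤ n) (hω : 2 * n ≤ ω) :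
    A n (2 * ν) ω = 2 * (-1 : ℝ) ^ (n + ν) / (2 * ν - 1).factorial *
      ∑ t ∈ Finset.range ν, Keven ν t * ∑ p ∈ Finset.range (n + 1), if t + p ≤ n then
        (-((ν : ℝ) - 1 / 2) ^ 2) ^ (n - t - p) / (n - t - p).factorial * (-(Fp (ν - t) p).eval 0) else 0 := by
  rw [A_eq1 ν n ω hν hn]
  set y : ℝ := (-((ν : ℝ) - 1 / 2) ^ 2) with hy
  have key : ∀ N ∈ (Finset.Icc 1 (ω + ν)).filter (fun N => ν ≤ N + n),
      (ω + ν).factorial / ((ω + ν - N).factorial * (N + n - ν).factorial * (2 * N).factorial : ℝ) *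
          ∑ m ∈ Finset.Icc 1 N, (-1 : ℝ) ^ m * ((2 * N - 1).choose (N - m)) * gg ν (N + n - ν) ((m : ℝ) - 1 / 2) =
      1 / 2 * ∑ t ∈ Finset.range ν, ∑ p ∈ Finset.range (n + 1), Keven ν t * (if t + p ≤ n ∧ ν ≤ N + t + p then 
        y ^ (n - t - p) / (n - t - p).factorial * ((-1 : ℝ) ^ N * ((ω + ν).factorial / ((ω + ν - N).factorial * (N + p - (ν - t)).factorial * (2 * N).factorial : ℝ)) * Dc (2 * N - 1) (2 * N - 1 + 2 * p)) else 0) := by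
    intro N hN
    simp at hN
    rw [half_sum N hN.1.1 _ (gg_odd ν _), gg_diff _ _ _ hν, ← hy]
    simp only [Finset.mul_sum]
    apply Finset.sum_congr rfl
    intro t ht
    simp at ht
    have hr := reindex ν n N t y hN.1.1 ht hN.2
    have : ∀ a b c d : ℝ, a = c → a = c := fun _ _ _ _ h => h
    rw [← Finset.mul_sum, ← Finset.mul_sum, ← Finset.mul_sum, ← Finset.mul_sum, ← Finset.mul_sum]
    trans (((ω + ν).factorial / ((ω + ν - N).factorial * (2 * N).factorial : ℝ) * ((-1) ^ N / 2)) * Keven ν t * (∑ p ∈ Finset.range (n + 1), if t + p ≤ n ∧ ν ≤ N + t + p then y ^ (n - t - p) / ((n - t - p).factorial * (N + t + p - ν).factorial)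
      * Dc (2 * N - 1) (2 * N - 1 + 2 * p) else 0))
    · rw [← hr]
      field_simp
    · simp only [Finset.mul_sum]
      apply Finset.sum_congr rfl
      intro p _
      split_ifs with hc
      · rw [show N + t + p - ν = N + p - (ν - t) by omega]
        field_simp
      · simp
  rw [Finset.sum_congr rfl key, ← Finset.mul_sum]
  rw [Finset.sum_comm]
  have fin : ∀ t ∈ Finset.range ν, ∑ N ∈ (Finset.Icc 1 (ω + ν)).filter (fun N => ν ≤ N + n), ∑ p ∈ Finset.range (n + 1), Keven ν t * (if t + p ≤ n ∧ ν ≤ N + t + p then 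
        y ^ (n - t - p) / (n - t - p).factorial * ((-1 : ℝ) ^ N * ((ω + ν).factorial / ((ω + ν - N).factorial * (N + p - (ν - t)).factorial * (2 * N).factorial : ℝ)) * Dc (2 * N - 1) (2 * N - 1 + 2 * p)) else 0)
      = Keven ν t * ∑ p ∈ Finset.range (n + 1), if t + p ≤ n then
        y ^ (n - t - p) / (n - t - p).factorial * (-(Fp (ν - t) p).eval 0) else 0 := by
    intro t ht
    simp at ht
    rw [Finset.sum_comm, Finset.mul_sum]
    apply Finset.sum_congr rfl
    intro p hp
    rw [← Finset.mul_sum]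
    congr 1
    split_ifs with hc
    · rw [← U_eq (ν - t) p (ω + ν) (by omega) (by omega), Finset.mul_sum, Finset.sum_filter, Finset.sum_filter]
      apply Finset.sum_congr rfl
      intro N hN
      by_cases h : ν ≤ N + t + p
      · rw [if_pos (by omega), if_pos ⟨hc, h⟩, if_pos (by omega)]
      · rw [if_neg (by omega : ¬ (ν - t ≤ N + p)), if_neg (show ¬ (t + p ≤ n ∧ ν ≤ N + t + p) by omega)]; simp
    · apply Finset.sum_eq_zero
      intro N hN
      rw [if_neg (by tauto)]
  rw [Finset.sum_congr rfl fin]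
  ring

end HeatAux

open HeatAux in
/-- the heat invariants of even spheres `S^{2ν}`. -/
theorem heat_invariants_even_spheres (ν n ω : ℕ) (hν : 1 ≤ ν) (hn : 1 ≤ n)
    (hω : 2 * n ≤ ω) :
    A n (2 * ν) ω =
      (1 / (Nat.factorial (2 * ν - 1) : ℝ)) *
        ((∑ t ∈ Finset.range ν,
            ((Nat.factorial (ν - 1 - t) : ℝ) / Real.Gamma ((n : ℝ) - (t : ℝ) + 1)) *
              ((ν : ℝ) - 1 / 2) ^ (2 * (n : ℤ) - 2 * (t : ℤ)) * Keven ν t) +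
          ∑ t ∈ Finset.range ν, Keven ν t *
            ∑ p ∈ Finset.Icc (ν - t) (n - t),
              (-1 : ℝ) ^ (p + ν - t - 1) *
                ((ν : ℝ) - 1 / 2) ^ (2 * (n : ℤ) - 2 * (t : ℤ) - 2 * (p : ℤ)) *
                ((bernoulli (2 * p) : ℚ) : ℝ) * ((2 : ℝ) ^ (1 - 2 * (p : ℤ)) - 1) /
                  ((p : ℝ) * Nat.factorial (n - t - p) * Nat.factorial (p - (ν - t)))) := by
  rw [A_eq2 ν n ω hν hn hω, ← Finset.sum_add_distrib, Finset.mul_sum, Finset.mul_sum]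
  apply Finset.sum_congr rfl
  intro t ht
  simp at ht
  have hh : ((ν : ℝ) - 1 / 2) ≠ 0 := by
    have : (1 : ℝ) ≤ ν := by exact_mod_cast hν
    intro h; linarith
  rcases lt_or_ge n t with hlt | hle
  · -- everything vanishes
    rw [Finset.sum_eq_zero (s := Finset.range (n + 1))]
    · rw [Finset.Icc_eq_empty (by omega)]
      have : (n : ℝ) - t + 1 = - ((t - n - 1 : ℕ) : ℝ) := by
        rw [Nat.cast_sub (by omega), Nat.cast_sub (by omega)]; push_cast; ring
      rw [this, Real.Gamma_neg_nat_eq_zero]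
      simp
    · intro p _
      rw [if_neg (by omega)]
  · have hG : Real.Gamma ((n : ℝ) - t + 1) = (n - t).factorial := by
      rw [← Real.Gamma_nat_eq_factorial, Nat.cast_sub hle]
    rw [hG]
    have hsub : insert 0 (Finset.Icc (ν - t) (n - t)) ⊆ Finset.range (n + 1) := by
      intro p hp; simp at hp ⊢; omega
    rw [← Finset.sum_subset hsub]
    · rw [Finset.sum_insert (by simp; omega)]
      have s1 : ∀ k : ℕ, ((-1 : ℝ) ^ k) * (-1) ^ k = 1 := by
        intro k; rw [← mul_pow]; simp
      have e0 : ((ν : ℝ) - 1 / 2) ^ (2 * (n : ℤ) - 2 * (t : ℤ)) = (((ν : ℝ) - 1 / 2) ^ 2) ^ (n - t) := by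
        rw [← pow_mul, ← zpow_natCast]; congr 1; push_cast [Nat.cast_sub hle]; ring
      have hz : 2 * (-1 : ℝ) ^ (n + ν) * ((-((ν : ℝ) - 1 / 2) ^ 2) ^ (n - t) / (n - t).factorial * (-(Fp (ν - t) 0).eval 0)) =
          ((Nat.factorial (ν - 1 - t) : ℝ) / (n - t).factorial) * ((ν : ℝ) - 1 / 2) ^ (2 * (n : ℤ) - 2 * (t : ℤ)) := by
        rw [Fp_zero_zero, e0, neg_pow (((ν : ℝ) - 1 / 2) ^ 2), show ν - t - 1 = ν - 1 - t by omega]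
        obtain ⟨a, rfl⟩ : ∃ a, n = t + a := ⟨n - t, by omega⟩
        obtain ⟨b, rfl⟩ : ∃ b, ν = t + 1 + b := ⟨ν - 1 - t, by omega⟩
        rw [show t + a - t = a by omega, show t + 1 + b - 1 - t = b by omega]
        have : (-1 : ℝ) ^ (t + a + (t + 1 + b)) * (-1) ^ a * (-1) ^ b = -1 := by
          rw [← pow_add, ← pow_add, show t + a + (t + 1 + b) + a + b = 2 * (t + a + b) + 1 by ring, pow_succ, pow_mul]
          simp
        generalize (((((t + 1 + b : ℕ)) : ℝ) - 1 / 2) ^ 2) ^ a = z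
        field_simp
        linear_combination (-z) * this
      have hp : ∀ p ∈ Finset.Icc (ν - t) (n - t), 
          2 * (-1 : ℝ) ^ (n + ν) * (if t + p ≤ n then
            (-((ν : ℝ) - 1 / 2) ^ 2) ^ (n - t - p) / (n - t - p).factorial * (-(Fp (ν - t) p).eval 0) else 0) =
          (-1 : ℝ) ^ (p + ν - t - 1) *
                ((ν : ℝ) - 1 / 2) ^ (2 * (n : ℤ) - 2 * (t : ℤ) - 2 * (p : ℤ)) *
                ((bernoulli (2 * p) : ℚ) : ℝ) * ((2 : ℝ) ^ (1 - 2 * (p : ℤ)) - 1) /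
                  ((p : ℝ) * Nat.factorial (n - t - p) * Nat.factorial (p - (ν - t))) := by
        intro p hp
        rw [Finset.mem_Icc] at hp
        have hp0 : (p : ℝ) ≠ 0 := by
          have : 0 < p := by omega
          positivity
        rw [if_pos (by omega), Fp_zero _ _ (by omega) hp.1, neg_pow (((ν : ℝ) - 1 / 2) ^ 2)]
        have e1 : ((ν : ℝ) - 1 / 2) ^ (2 * (n : ℤ) - 2 * (t : ℤ) - 2 * (p : ℤ)) = (((ν : ℝ) - 1 / 2) ^ 2) ^ (n - t - p) := by
          rw [← pow_mul, ← zpow_natCast]; congr 1; push_cast [Nat.cast_sub hle, Nat.cast_sub (show p ≤ n - t by omega)]; ring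
        have e2 : (2 : ℝ) ^ (1 - 2 * (p : ℤ)) = 2 * (1 / 2) ^ (2 * p) := by
          rw [zpow_sub₀ (by norm_num), zpow_one, one_div, inv_pow, div_eq_mul_inv]
          congr 2
        rw [e1, e2]
        obtain ⟨a, rfl⟩ : ∃ a, n = t + p + a := ⟨n - t - p, by omega⟩
        obtain ⟨b, rfl⟩ : ∃ b, ν = t + 1 + b := ⟨ν - 1 - t, by omega⟩
        have : (-1 : ℝ) ^ (t + p + a + (t + 1 + b)) * (-1) ^ a = - (-1) ^ (p + b) := by
          rw [← pow_add, show t + p + a + (t + 1 + b) + a = 2 * (t + a) + 1 + (p + b) by ring, pow_add, pow_succ, pow_mul]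
          simp
        rw [show p + (t + 1 + b) - t - 1 = p + b by omega, show t + p + a - t - p = a by omega]
        generalize (((((t + 1 + b : ℕ)) : ℝ) - 1 / 2) ^ 2) ^ a = z
        generalize 2 * (1 / 2 : ℝ) ^ (2 * p) - 1 = w
        generalize ((bernoulli (2 * p) : ℚ) : ℝ) = B
        field_simp
        linear_combination (-z * w * B) * this
      rw [← Finset.sum_congr rfl hp, ← Finset.mul_sum]
      rw [if_pos (by omega)]
      simp only [Nat.sub_zero] at hz ⊢
      rw [← hz]
      ring
    · intro p hp hp'
      simp at hp hp'
      split_ifs with hc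
      · have := Fp_eval_zero' (ν - t) p 0 (by omega) (by omega)
        rw [Nat.cast_zero] at this
        rw [this]; simp
      · rfl
end

section
/- For all integers n ≥ 1 and ω ≥ 2n: A_{n,2}(ω) = (1/(n! 2^{2n})) Σ_{r=0}^{n} (-1)^r binom(n,r) (2 - 2^{2r}) B_{2r}. -/
open Finset

namespace HeatS2

/-- The power series of `e^{at}`. -/
noncomputable def ex (a : ℝ) : PowerSeries ℝ := PowerSeries.rescale a (PowerSeries.exp ℝ)

/-- `2 sinh (t/2)`. -/
noncomputable def E : PowerSeries ℝ := ex (1/2) - ex (-(1/2))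

/-- `2 sinh (t/2) / t`. -/
noncomputable def H : PowerSeries ℝ := PowerSeries.mk fun n => PowerSeries.coeff (n + 1) E

/-- `(t/2) / sinh (t/2)`. -/
noncomputable def V : PowerSeries ℝ :=
  2 * PowerSeries.rescale (1/2 : ℝ) (bernoulliPowerSeries ℝ) - bernoulliPowerSeries ℝ

lemma coeff_ex (a : ℝ) (K : ℕ) : PowerSeries.coeff K (ex a) = a ^ K / (K.factorial : ℝ) := by
  simp [ex, PowerSeries.coeff_rescale, PowerSeries.coeff_exp, div_eq_mul_inv]

lemma ex_mul (a b : ℝ) : ex a * ex b = ex (a + b) := PowerSeries.exp_mul_exp_eq_exp_add a b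

lemma ex_zero : ex 0 = 1 := by simp [ex]

lemma ex_one : ex 1 = PowerSeries.exp ℝ := by simp [ex]

lemma ex_pow (a : ℝ) (k : ℕ) : ex a ^ k = ex (k * a) := by
  induction k with
  | zero => simp [ex_zero]
  | succ k ih => rw [pow_succ, ih, ex_mul]; congr 1; push_cast; ring

lemma X_mul_H : PowerSeries.X * H = E := by
  ext n
  cases n with
  | zero => rw [PowerSeries.coeff_zero_X_mul, E, map_sub, coeff_ex, coeff_ex]; simp
  | succ n => rw [PowerSeries.coeff_succ_X_mul]; simp [H]

lemma V_mul_E : V * E = PowerSeries.X := by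
  have h1 : bernoulliPowerSeries ℝ * (ex 1 - 1) = PowerSeries.X := by
    rw [ex_one]; exact bernoulliPowerSeries_mul_exp_sub_one ℝ
  have h2 : 2 * (PowerSeries.rescale (1/2 : ℝ) (bernoulliPowerSeries ℝ) * (ex (1/2) - 1))
      = PowerSeries.X := by
    have := congrArg (PowerSeries.rescale (1/2 : ℝ)) (bernoulliPowerSeries_mul_exp_sub_one ℝ)
    rw [map_mul, map_sub, map_one] at this
    change PowerSeries.rescale (1/2 : ℝ) (bernoulliPowerSeries ℝ) * (ex (1/2) - 1) = _ at this
    rw [this]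
    ext n
    rw [show (2 : PowerSeries ℝ) = PowerSeries.C (2:ℝ) from (map_ofNat PowerSeries.C 2).symm]
    rw [PowerSeries.coeff_C_mul, PowerSeries.coeff_rescale, PowerSeries.coeff_X]
    split_ifs with h
    · subst h; norm_num
    · simp
  have h3 : ex (1/2) * ex (1/2) = ex 1 := by rw [ex_mul]; norm_num
  have h4 : ex (1/2) * ex (-(1/2)) = 1 := by rw [ex_mul]; simp [ex_zero]
  rw [← h3] at h1
  unfold V E
  generalize PowerSeries.rescale (1/2 : ℝ) (bernoulliPowerSeries ℝ) = B at *
  generalize bernoulliPowerSeries ℝ = B' at *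
  generalize ex (1/2) = a at *
  generalize ex (-(1/2)) = b at *
  linear_combination (1 + b) * h2 - b * h1 + (-2 * B + B' * a) * h4

lemma V_mul_H : V * H = 1 := by
  have h : PowerSeries.X * (V * H) = PowerSeries.X * 1 := by
    rw [mul_left_comm, X_mul_H, V_mul_E, mul_one]
  exact mul_left_cancel₀ PowerSeries.X_ne_zero h

lemma coeff_V (s : ℕ) : PowerSeries.coeff (2 * s) V =
    (2 - 2 ^ (2 * s)) * ((bernoulli (2 * s) : ℚ) : ℝ) / (((2 * s).factorial : ℝ) * 2 ^ (2 * s)) := by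
  rw [V, map_sub, show (2 : PowerSeries ℝ) = PowerSeries.C (2:ℝ) from (map_ofNat PowerSeries.C 2).symm,
    PowerSeries.coeff_C_mul, PowerSeries.coeff_rescale]
  simp only [bernoulliPowerSeries, PowerSeries.coeff_mk]
  simp
  have := Nat.factorial_ne_zero (2 * s)
  field_simp

lemma X_sq_dvd : (PowerSeries.X : PowerSeries ℝ) ^ 2 ∣ H ^ 2 - 1 := by
  have h0 : PowerSeries.coeff 0 H = 1 := by
    simp only [H, E, PowerSeries.coeff_mk, map_sub, coeff_ex]; norm_num
  have h1 : PowerSeries.coeff 1 H = 0 := by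
    simp only [H, E, PowerSeries.coeff_mk, map_sub, coeff_ex]; norm_num
  have : (PowerSeries.X : PowerSeries ℝ) ^ 2 ∣ H - 1 := by
    rw [PowerSeries.X_pow_dvd_iff]
    intro m hm
    interval_cases m
    · rw [map_sub, h0]; simp
    · rw [map_sub, h1]; simp [PowerSeries.coeff_one]
  rw [show H ^ 2 - 1 = (H - 1) * (H + 1) by ring]
  exact this.mul_right _

/-- `[t^{2s}] H^{2m-1}`. -/
noncomputable def hc (s m : ℕ) : ℝ := PowerSeries.coeff (2 * s) (V * (H ^ 2) ^ m)

lemma hc_eq (s m : ℕ) : hc s m =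
    ∑ i ∈ range (s + 1), (m.choose i : ℝ) * PowerSeries.coeff (2 * s) (V * (H ^ 2 - 1) ^ i) := by
  have hz : ∀ i, s < i → PowerSeries.coeff (2 * s) (V * (H ^ 2 - 1) ^ i) = 0 := by
    intro i hi
    have hd : (PowerSeries.X : PowerSeries ℝ) ^ (2 * i) ∣ V * (H ^ 2 - 1) ^ i := by
      rw [pow_mul]; exact (pow_dvd_pow_of_dvd X_sq_dvd i).mul_left _
    exact PowerSeries.X_pow_dvd_iff.1 hd _ (by omega)
  have h1 : hc s m =
    ∑ i ∈ range (m + 1), (m.choose i : ℝ) * PowerSeries.coeff (2 * s) (V * (H ^ 2 - 1) ^ i) := by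
    unfold hc
    conv_lhs => rw [show H ^ 2 = (H ^ 2 - 1) + 1 by ring, add_pow, mul_sum, map_sum]
    refine sum_congr rfl fun i _ => ?_
    rw [one_pow, mul_one, ← mul_assoc, mul_comm (V * _),
      show ((m.choose i : ℕ) : PowerSeries ℝ) = PowerSeries.C (m.choose i : ℝ) by simp,
      PowerSeries.coeff_C_mul]
  rw [h1]
  have e1 : ∑ i ∈ range (m + 1), (m.choose i : ℝ) * PowerSeries.coeff (2 * s) (V * (H ^ 2 - 1) ^ i)
    = ∑ i ∈ range (m + s + 1),
      (m.choose i : ℝ) * PowerSeries.coeff (2 * s) (V * (H ^ 2 - 1) ^ i) := by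
    refine sum_subset (fun x hx => ?_) fun x _ hx => ?_
    · simp only [mem_range] at *; omega
    · rw [Nat.choose_eq_zero_of_lt]; · simp
      simp only [mem_range] at *; omega
  rw [e1]
  symm
  refine sum_subset (fun x hx => ?_) fun x _ hx => ?_
  · simp only [mem_range] at *; omega
  · rw [hz]; · simp
    simp only [mem_range] at *; omega

/-- `(2(m+s))! m! / ((m+s)! (2m)!)`. -/
noncomputable def R (s m : ℕ) : ℝ := ∏ i ∈ range s, (2 * (2 * (m : ℝ) + 2 * i + 1))

lemma R_eq (s m : ℕ) : R s m * (((m + s).factorial : ℝ) * ((2 * m).factorial : ℝ)) =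
    ((2 * (m + s)).factorial : ℝ) * (m.factorial : ℝ) := by
  induction s with
  | zero => simp [R, mul_comm]
  | succ s ih =>
    have : R (s + 1) m = R s m * (2 * (2 * (m : ℝ) + 2 * s + 1)) := by
      rw [R, prod_range_succ, ← R]
    rw [this, ← add_assoc, show 2 * (m + s + 1) = 2 * (m + s) + 1 + 1 by ring,
      Nat.factorial_succ, Nat.factorial_succ (2 * (m + s) + 1), Nat.factorial_succ (2 * (m + s))]
    push_cast
    linear_combination ((2 * (2 * (m : ℝ) + 2 * s + 1)) * (m + s + 1)) * ih

lemma exists_poly (s : ℕ) : ∃ P : Polynomial ℝ, P.natDegree ≤ 2 * s ∧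
    ∀ m : ℕ, P.eval (m : ℝ) = R s m * hc s m := by
  refine ⟨(∏ i ∈ range s, (Polynomial.C 4 * Polynomial.X + Polynomial.C (4 * (i:ℝ) + 2))) *
    ∑ i ∈ range (s + 1), Polynomial.C (PowerSeries.coeff (2 * s) (V * (H ^ 2 - 1) ^ i)
      / (i.factorial : ℝ)) * descPochhammer ℝ i, ?_, ?_⟩
  · refine Polynomial.natDegree_mul_le.trans ?_
    have h1 : (∏ i ∈ range s, (Polynomial.C (4:ℝ) * Polynomial.X
        + Polynomial.C (4 * (i:ℝ) + 2))).natDegree ≤ s := by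
      refine (Polynomial.natDegree_prod_le _ _).trans ?_
      refine (sum_le_card_nsmul _ _ 1 fun i _ => Polynomial.natDegree_linear_le).trans ?_
      simp
    have h2 : (∑ i ∈ range (s + 1), Polynomial.C (PowerSeries.coeff (2 * s) (V * (H ^ 2 - 1) ^ i)
      / (i.factorial : ℝ)) * descPochhammer ℝ i).natDegree ≤ s := by
      refine Polynomial.natDegree_sum_le_of_forall_le _ _ fun i hi => ?_
      refine (Polynomial.natDegree_C_mul_le _ _).trans ?_
      rw [descPochhammer_natDegree]
      simp only [mem_range] at hi; omega
    omega
  · intro m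
    rw [Polynomial.eval_mul, hc_eq, Polynomial.eval_prod, Polynomial.eval_finsetSum]
    congr 1
    · refine prod_congr rfl fun i _ => ?_
      simp; ring
    · refine sum_congr rfl fun i _ => ?_
      rw [Polynomial.eval_mul, Polynomial.eval_C, descPochhammer_eval_eq_descFactorial,
        Nat.descFactorial_eq_factorial_mul_choose]
      have := Nat.factorial_ne_zero i
      push_cast
      field_simp

lemma alt_sum (s N : ℕ) (h : 2 * s ≤ N) :
    ∑ j ∈ range (N + 1), ((N + 1).choose (j + 1) : ℝ) * (-1) ^ j * (R s (j + 1) * hc s (j + 1))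
      = R s 0 * hc s 0 := by
  obtain ⟨P, hd, hP⟩ := exists_poly s
  have h0 := congrFun (Polynomial.fwdDiff_iter_eq_zero_of_degree_lt
    (show P.natDegree < N + 1 by omega)) 0
  rw [fwdDiff_iter_eq_sum_shift, sum_range_succ'] at h0
  simp only [zero_add, nsmul_eq_mul, mul_one, Pi.zero_apply, zsmul_eq_mul, hP] at h0
  push_cast at h0
  have h1 := congrArg (fun z => (-1:ℝ) ^ N * z) h0
  simp only [mul_add, mul_sum, mul_zero] at h1
  have h2 : ∑ i ∈ range (N + 1), (-1:ℝ) ^ N * ((-1) ^ (N - i)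
      * ((N + 1).choose (i + 1) : ℝ) * (R s (i + 1) * hc s (i + 1))) =
      ∑ j ∈ range (N + 1), ((N + 1).choose (j + 1) : ℝ) * (-1) ^ j
        * (R s (j + 1) * hc s (j + 1)) := by
    refine sum_congr rfl fun i hi => ?_
    obtain ⟨k, rfl⟩ := Nat.exists_eq_add_of_le (Nat.lt_succ_iff.1 (mem_range.1 hi))
    rw [show i + k - i = k by omega]
    have : (-1:ℝ) ^ (k + k) = 1 := Even.neg_one_pow ⟨k, rfl⟩
    rw [pow_add] at this
    rw [pow_add]
    linear_combination ((-1:ℝ) ^ i * ((i + k + 1).choose (i + 1) : ℝ)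
      * (R s (i + 1) * hc s (i + 1))) * this
  rw [h2] at h1
  have h3 : (-1:ℝ) ^ (N + N) = 1 := Even.neg_one_pow ⟨N, rfl⟩
  simp only [Nat.choose_zero_right, Nat.cast_one, pow_succ] at h1
  rw [pow_add] at h3
  simp at h1
  linear_combination h1 + (R s 0 * hc s 0) * h3

/-- central differences of powers -/
lemma diff_pow (M K : ℕ) :
    ∑ i ∈ range (M + 1), (-1 : ℝ) ^ i * (M.choose i : ℝ) * ((M : ℝ) / 2 - i) ^ K =
      (K.factorial : ℝ) * PowerSeries.coeff K (E ^ M) := by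
  have h : E ^ M = ∑ i ∈ range (M + 1),
      PowerSeries.C ((-1 : ℝ) ^ i * (M.choose i : ℝ)) * ex ((M : ℝ) / 2 - i) := by
    rw [E, sub_eq_neg_add, add_pow]
    refine sum_congr rfl fun i hi => ?_
    have hi' : i ≤ M := Nat.lt_succ_iff.1 (mem_range.1 hi)
    rw [neg_pow, ex_pow, ex_pow, mul_assoc ((-1) ^ i), ex_mul, Nat.cast_sub hi']
    rw [show (i : ℝ) * -(1/2) + ((M:ℝ) - i) * (1/2) = (M : ℝ) / 2 - i by ring]
    simp only [map_mul, map_pow, map_neg, map_one, map_natCast]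
    ring
  rw [h, map_sum, mul_sum]
  refine sum_congr rfl fun i _ => ?_
  rw [PowerSeries.coeff_C_mul, coeff_ex]
  have := Nat.factorial_ne_zero K
  field_simp

lemma coeff_E_lt (M K : ℕ) (h : K < M) : PowerSeries.coeff K (E ^ M) = 0 := by
  rw [← X_mul_H, mul_pow, PowerSeries.coeff_X_pow_mul', if_neg (by omega)]

lemma coeff_E (j s : ℕ) :
    PowerSeries.coeff (2 * (j + s) + 1) (E ^ (2 * j + 1)) = hc s (j + 1) := by
  rw [← X_mul_H, mul_pow, PowerSeries.coeff_X_pow_mul', if_pos (by omega), hc,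
    show 2 * (j + s) + 1 - (2 * j + 1) = 2 * s by omega,
    show V * (H ^ 2) ^ (j + 1) = (V * H) * H ^ (2 * j + 1) by ring, V_mul_H, one_mul]

lemma diff_f (j n : ℕ) :
    ∑ i ∈ range (2 * j + 1 + 1), (-1 : ℝ) ^ i * ((2 * j + 1).choose i : ℝ) *
      ((((2 * j + 1 : ℕ) : ℝ) / 2 - i) * ((((2 * j + 1 : ℕ) : ℝ) / 2 - i) ^ 2 - 1/4) ^ (j + n)) =
    ∑ s ∈ range (n + 1), ((j + n).choose (j + s) : ℝ) * (-(1/4)) ^ (n - s) *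
      ((2 * (j + s) + 1).factorial : ℝ) * hc s (j + 1) := by
  have h1 : ∀ x : ℝ, x * (x ^ 2 - 1/4) ^ (j + n) = ∑ q ∈ range (j + n + 1),
      ((j + n).choose q : ℝ) * (-(1/4)) ^ (j + n - q) * x ^ (2 * q + 1) := by
    intro x
    rw [sub_eq_add_neg, add_pow, mul_sum]
    refine sum_congr rfl fun q _ => ?_
    ring
  simp_rw [h1, mul_sum]
  rw [sum_comm]
  have h2 : ∀ q, ∑ i ∈ range (2 * j + 1 + 1), (-1 : ℝ) ^ i * ((2 * j + 1).choose i : ℝ) *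
      (((j + n).choose q : ℝ) * (-(1/4)) ^ (j + n - q) *
        (((2 * j + 1 : ℕ) : ℝ) / 2 - i) ^ (2 * q + 1)) =
      ((j + n).choose q : ℝ) * (-(1/4)) ^ (j + n - q) * (((2 * q + 1).factorial : ℝ) *
        PowerSeries.coeff (2 * q + 1) (E ^ (2 * j + 1))) := by
    intro q
    rw [← diff_pow, mul_sum]
    refine sum_congr rfl fun i _ => ?_
    ring
  simp_rw [h2]
  rw [add_assoc, sum_range_add, sum_eq_zero, zero_add]
  · refine sum_congr rfl fun s hs => ?_
    rw [coeff_E, show j + n - (j + s) = n - s by omega]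
    ring
  · intro q hq
    rw [coeff_E_lt _ _ (by simp only [mem_range] at hq; omega)]
    simp

lemma sum_Icc (F : ℕ → ℝ) (j : ℕ) : ∑ k ∈ Icc 1 j, F k = ∑ k ∈ range j, F (k + 1) := by
  induction j with
  | zero => simp
  | succ j ih => rw [Finset.sum_Icc_succ_top (by omega), ih, sum_range_succ]

lemma inner (j N : ℕ) (hN : 1 ≤ N) :
    ∑ k ∈ Icc 1 j, (-1 : ℝ) ^ k * (Nat.choose (2 * j + 2 - 1) (j - k)) * sphMu k 2 *
        (sphLam k 2 : ℝ) ^ N =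
    (-1) ^ j * ∑ i ∈ range (2 * j + 1 + 1), (-1 : ℝ) ^ i * ((2 * j + 1).choose i : ℝ) *
      ((((2 * j + 1 : ℕ) : ℝ) / 2 - i) * ((((2 * j + 1 : ℕ) : ℝ) / 2 - i) ^ 2 - 1/4) ^ N) := by
  set g : ℕ → ℝ := fun i => (-1 : ℝ) ^ i * ((2 * j + 1).choose i : ℝ) *
      ((((2 * j + 1 : ℕ) : ℝ) / 2 - i) * ((((2 * j + 1 : ℕ) : ℝ) / 2 - i) ^ 2 - 1/4) ^ N) with hg
  have hsplit : ∑ i ∈ range (2 * j + 1 + 1), g i = 2 * ∑ i ∈ range (j + 1), g i := by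
    rw [show 2 * j + 1 + 1 = (j + 1) + (j + 1) by ring, sum_range_add, two_mul]
    congr 1
    rw [← sum_range_reflect]
    refine sum_congr rfl fun i hi => ?_
    have hi' : i ≤ j := Nat.lt_succ_iff.1 (mem_range.1 hi)
    obtain ⟨k, rfl⟩ := Nat.exists_eq_add_of_le hi'
    simp only [hg]
    rw [show i + k + 1 + (i + k + 1 - 1 - i) = i + 2 * k + 1 by omega,
      Nat.choose_symm_of_eq_add (show 2 * (i + k) + 1 = (i + 2 * k + 1) + i by ring)]
    rw [show (-1:ℝ) ^ (i + 2 * k + 1) = - (-1) ^ i by rw [pow_succ, pow_add, pow_mul]; simp]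
    push_cast
    rw [show ((2 * ((i:ℝ) + k) + 1) / 2 - (i + 2 * k + 1)) = -((2 * ((i:ℝ) + k) + 1) / 2 - i) by
      ring, neg_sq]
    ring
  rw [hsplit, ← sum_range_reflect, sum_range_succ']
  have hz : g (j + 1 - 1 - 0) = 0 := by
    simp only [hg]
    rw [show j + 1 - 1 - 0 = j by omega]
    push_cast
    rw [show (((2 * (j:ℝ) + 1) / 2 - j) ^ 2 - 1/4) = 0 by ring, zero_pow (by omega)]
    simp
  rw [hz, add_zero, sum_Icc, mul_sum, mul_sum]
  refine sum_congr rfl fun k hk => ?_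
  have hk' : k + 1 ≤ j := mem_range.1 hk
  obtain ⟨i, rfl⟩ := Nat.exists_eq_add_of_le hk'
  have hmu : sphMu (k + 1) 2 = 2 * (k + 1 : ℝ) + 1 := by
    have := Nat.factorial_ne_zero (k + 1)
    simp only [sphMu, Nat.succ_ne_zero, if_false, Nat.add_sub_cancel]
    push_cast
    field_simp
    simp
    ring
  have hlam : (sphLam (k + 1) 2 : ℝ) = (k + 1) * (k + 1 + 1) := by
    simp only [sphLam, show k + 1 + 2 - 1 = k + 1 + 1 by omega]; push_cast; ring
  rw [hmu, hlam]
  simp only [hg]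
  rw [show k + 1 + i + 1 - 1 - (k + 1) = i by omega, show k + 1 + i - (k + 1) = i by omega,
    show 2 * (k + 1 + i) + 2 - 1 = 2 * (k + 1 + i) + 1 by omega]
  push_cast
  rw [show (((2 * ((k:ℝ) + 1 + i) + 1) / 2 - i) ^ 2 - 1/4) = (k + 1) * (k + 1 + 1) by ring]
  have : (-1:ℝ) ^ (i + i) = 1 := Even.neg_one_pow ⟨i, rfl⟩
  rw [pow_add] at this
  rw [pow_add _ (k + 1) i]
  linear_combination (-((-1:ℝ) ^ (k + 1) * ((2 * (k + 1 + i) + 1).choose i : ℝ)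
    * (2 * (k + 1 : ℝ) + 1) * (((k:ℝ) + 1) * (k + 1 + 1)) ^ N)) * this

lemma coef (n ω j s : ℕ) (hj : j ≤ ω) (hs : s ≤ n) :
    2 * ((ω + 1).factorial : ℝ) / (((ω - j).factorial : ℝ) * ((j + n).factorial : ℝ)
      * ((2 * j + 2).factorial : ℝ)) *
      (((j + n).choose (j + s) : ℝ) * ((2 * (j + s) + 1).factorial : ℝ)) =
    ((ω + 1).choose (j + 1) : ℝ) * R s (j + 1) / ((n - s).factorial : ℝ) := by
  have hR := R_eq s (j + 1)
  rw [show 2 * (j + 1 + s) = (2 * (j + s) + 1) + 1 by ring, Nat.factorial_succ (2 * (j + s) + 1),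
    show j + 1 + s = (j + s) + 1 by ring, Nat.factorial_succ (j + s),
    show 2 * (j + 1) = 2 * j + 2 by ring] at hR
  rw [Nat.cast_choose ℝ (show j + s ≤ j + n by omega),
    Nat.cast_choose ℝ (show j + 1 ≤ ω + 1 by omega),
    show j + n - (j + s) = n - s by omega, show ω + 1 - (j + 1) = ω - j by omega]
  push_cast at hR
  have h1 : ((ω - j).factorial : ℝ) ≠ 0 := by positivity
  have h2 : ((j + n).factorial : ℝ) ≠ 0 := by positivity
  have h3 : ((2 * j + 2).factorial : ℝ) ≠ 0 := by positivity
  have h4 : ((j + s).factorial : ℝ) ≠ 0 := by positivity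
  have h5 : ((n - s).factorial : ℝ) ≠ 0 := by positivity
  have h6 : ((j + 1).factorial : ℝ) ≠ 0 := by positivity
  have h7 : ((j : ℝ) + s + 1) ≠ 0 := by positivity
  have hR' : R s (j + 1) * ((j + s).factorial : ℝ) * ((2 * j + 2).factorial : ℝ)
      = 2 * ((2 * (j + s) + 1).factorial : ℝ) * ((j + 1).factorial : ℝ) := by
    apply mul_left_cancel₀ h7
    linear_combination hR
  field_simp
  linear_combination -hR'

end HeatS2

/-- `A_{n,2}(ω) = (1/(n!2^{2n})) Σ_{r=0}^n (-1)^r C(n,r)(2-2^{2r})B_{2r}`. -/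
theorem heat_invariants_S2 (n ω : ℕ) (hn : 1 ≤ n) (hω : 2 * n ≤ ω) :
    A n 2 ω =
      (1 / ((Nat.factorial n : ℝ) * 2 ^ (2 * n))) *
        ∑ r ∈ Finset.range (n + 1),
          (-1 : ℝ) ^ r * (Nat.choose n r : ℝ) * (2 - 2 ^ (2 * r)) *
            ((bernoulli (2 * r) : ℚ) : ℝ) := by
  have hstep : A n 2 ω = ∑ j ∈ range (ω + 1), ∑ s ∈ range (n + 1),
      (-1 : ℝ) ^ n * ((-(1/4)) ^ (n - s) / ((n - s).factorial : ℝ)) *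
        (((ω + 1).choose (j + 1) : ℝ) * (-1) ^ j * (HeatS2.R s (j + 1) * HeatS2.hc s (j + 1))) := by
    have hG : Real.Gamma ((ω : ℝ) + (2 : ℕ) / 2 + 1) = ((ω + 1).factorial : ℝ) := by
      rw [← Real.Gamma_nat_eq_factorial]; push_cast; norm_num
    have hA : A n 2 ω = ∑ j ∈ range (ω + 1),
      (2 * (-1 : ℝ) ^ n * Real.Gamma ((ω : ℝ) + (2 : ℕ) / 2 + 1) /
      (Nat.factorial (ω - j) * Nat.factorial (j + n) * Nat.factorial (2 * j + 2))) *
      ∑ k ∈ Icc 1 j, (-1 : ℝ) ^ k * (Nat.choose (2 * j + 2 - 1) (j - k)) * sphMu k 2 *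
        (sphLam k 2 : ℝ) ^ (j + n) := by
      rw [sum_range_succ', A, HeatS2.sum_Icc]
      simp
    rw [hA, hG]
    refine sum_congr rfl fun j hj => ?_
    rw [HeatS2.inner j (j + n) (by omega), HeatS2.diff_f, mul_sum, mul_sum]
    refine sum_congr rfl fun s hs => ?_
    have hc := HeatS2.coef n ω j s (Nat.lt_succ_iff.1 (mem_range.1 hj))
      (Nat.lt_succ_iff.1 (mem_range.1 hs))
    linear_combination ((-1 : ℝ) ^ n * (-1) ^ j * (-(1/4)) ^ (n - s) * HeatS2.hc s (j + 1)) * hc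
  rw [hstep, sum_comm, mul_sum]
  refine sum_congr rfl fun s hs => ?_
  have hs' : s ≤ n := Nat.lt_succ_iff.1 (mem_range.1 hs)
  rw [← mul_sum, HeatS2.alt_sum s ω (by omega)]
  have hR := HeatS2.R_eq s 0
  have hh : HeatS2.hc s 0 = PowerSeries.coeff (2 * s) HeatS2.V := by simp [HeatS2.hc]
  rw [hh, HeatS2.coeff_V, Nat.cast_choose ℝ hs']
  simp only [zero_add, mul_zero, Nat.factorial_zero, Nat.cast_one, mul_one] at hR
  rw [← hR]
  obtain ⟨t, rfl⟩ := Nat.exists_eq_add_of_le hs'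
  rw [show s + t - s = t by omega]
  have h1 : (s.factorial : ℝ) ≠ 0 := by positivity
  have h2 : (t.factorial : ℝ) ≠ 0 := by positivity
  have h3 : ((s + t).factorial : ℝ) ≠ 0 := by positivity
  have h4 : HeatS2.R s 0 ≠ 0 := by
    intro h0
    rw [h0, zero_mul] at hR
    exact absurd hR.symm (by positivity)
  have h5 : (-(1/4) : ℝ) ^ t = (-1) ^ t / 2 ^ (2 * t) := by
    rw [show (-(1/4) : ℝ) = (-1) / 2 ^ 2 by norm_num, div_pow, ← pow_mul]
  have h6 : (-1:ℝ) ^ (t + t) = 1 := Even.neg_one_pow ⟨t, rfl⟩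
  rw [pow_add] at h6
  rw [h5, pow_add (-1 : ℝ) s t, mul_add 2 s t, pow_add (2 : ℝ) (2 * s) (2 * t)]
  generalize (2:ℝ) ^ (2 * s) = p at *
  field_simp
  rw [sq, h6, one_mul]
end

section
/- For every integer N ≥ 0, as t → 0+ one has Σ_{k=0}^∞ (k+1)² e^{-t k(k+2)} = Σ_{n=0}^{N} (√π/(4 · n!)) t^{n-3/2} + o(t^{N-3/2}); that is, the heat trace coefficients of the 3-sphere are a_{n,3} = √π/(4 · n!). -/
open Finset Real

/-- `Σ_{n ≥ 1} exp (-t n²)`. -/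
noncomputable def gSum (t : ℝ) : ℝ := ∑' k : ℕ, Real.exp (-(t * ((k : ℝ) + 1) ^ 2))

/-- `Σ_{n ≥ 1} n² exp (-t n²)`. -/
noncomputable def fSum (t : ℝ) : ℝ :=
  ∑' k : ℕ, ((k : ℝ) + 1) ^ 2 * Real.exp (-(t * ((k : ℝ) + 1) ^ 2))

lemma summable_f {t : ℝ} (ht : 0 < t) :
    Summable fun k : ℕ => ((k : ℝ) + 1) ^ 2 * Real.exp (-(t * ((k : ℝ) + 1) ^ 2)) := by
  have h := (summable_nat_add_iff 1).2 (Real.summable_pow_mul_exp_neg_nat_mul 2 ht)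
  refine Summable.of_nonneg_of_le (fun k => by positivity) (fun k => ?_) h
  push_cast
  gcongr
  have : (0 : ℝ) ≤ k := by positivity
  nlinarith [mul_nonneg ht.le this, mul_nonneg (mul_nonneg ht.le this) this]

lemma g_le_f (t : ℝ) (k : ℕ) : Real.exp (-(t * ((k : ℝ) + 1) ^ 2)) ≤
    ((k : ℝ) + 1) ^ 2 * Real.exp (-(t * ((k : ℝ) + 1) ^ 2)) := by
  have : (0 : ℝ) ≤ k := by positivity
  exact le_mul_of_one_le_left (by positivity) (by nlinarith)

lemma summable_g {t : ℝ} (ht : 0 < t) :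
    Summable fun k : ℕ => Real.exp (-(t * ((k : ℝ) + 1) ^ 2)) :=
  Summable.of_nonneg_of_le (fun k => by positivity) (g_le_f t) (summable_f ht)

lemma hasDerivAt_g {t : ℝ} (ht : 0 < t) : HasDerivAt gSum (-fSum t) t := by
  have h := hasDerivAt_tsum_of_isPreconnected (𝕜 := ℝ) (F := ℝ) (t := Set.Ioi (t / 2))
    (g := fun (k : ℕ) (t : ℝ) => Real.exp (-(t * ((k : ℝ) + 1) ^ 2)))
    (g' := fun (k : ℕ) (t : ℝ) => -(((k : ℝ) + 1) ^ 2 * Real.exp (-(t * ((k : ℝ) + 1) ^ 2))))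
    (u := fun k : ℕ => ((k : ℝ) + 1) ^ 2 * Real.exp (-(t / 2 * ((k : ℝ) + 1) ^ 2)))
    (y₀ := t) (y := t)
    (summable_f (half_pos ht)) isOpen_Ioi isPreconnected_Ioi ?_ ?_ (half_lt_self ht)
    (summable_g ht) (half_lt_self ht)
  · rw [tsum_neg] at h
    exact h
  · intro n y _
    have h1 := (((hasDerivAt_id y).mul_const (((n : ℝ) + 1) ^ 2)).neg).exp
    refine h1.congr_deriv ?_
    simp only [id, Pi.neg_apply]
    ring_nf
  · intro n y hy
    have hy : t / 2 < y := hy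
    rw [norm_neg, Real.norm_of_nonneg (by positivity)]
    gcongr

lemma tsum_int_g {t : ℝ} (ht : 0 < t) :
    ∑' n : ℤ, Real.exp (-(t * (n : ℝ) ^ 2)) = 1 + 2 * gSum t := by
  have h1 : HasSum _ (gSum t) := (summable_g ht).hasSum
  have h := HasSum.of_add_one_of_neg_add_one
    (f := fun n : ℤ => Real.exp (-(t * (n : ℝ) ^ 2))) (m := gSum t) (m' := gSum t)
    (by push_cast; exact h1)
    (by
      push_cast
      convert h1 using 4
      ring)
  rw [h.tsum_eq]
  simp
  ring

lemma theta_eq {t : ℝ} (ht : 0 < t) :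
    1 + 2 * gSum t = √π * t ^ (-(1 / 2) : ℝ) * (1 + 2 * gSum (π ^ 2 * t⁻¹)) := by
  have h := Real.tsum_exp_neg_mul_int_sq (a := t / π) (by positivity)
  rw [← tsum_int_g ht, ← tsum_int_g (by positivity)]
  convert h using 2
  · ext n
    congr 1
    field_simp
  · rw [Real.div_rpow ht.le pi_pos.le, Real.rpow_neg ht.le, ← Real.sqrt_eq_rpow π]
    field_simp
  · congr 1
    ext n
    congr 1
    field_simp

lemma f_eq {t : ℝ} (ht : 0 < t) :
    fSum t = √π / 4 * t ^ (-(3 / 2) : ℝ) + (√π / 2 * (t ^ (-(3 / 2) : ℝ) * gSum (π ^ 2 * t⁻¹))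
      - √π * π ^ 2 * (t ^ (-(5 / 2) : ℝ) * fSum (π ^ 2 * t⁻¹))) := by
  have h1 : HasDerivAt (fun t => 1 + 2 * gSum t) (2 * (-fSum t)) t :=
    ((hasDerivAt_g ht).const_mul 2).const_add 1
  have h2 : HasDerivAt (fun t => gSum (π ^ 2 * t⁻¹))
      (-fSum (π ^ 2 * t⁻¹) * (π ^ 2 * (-(t ^ 2)⁻¹))) t :=
    HasDerivAt.comp (h₂ := gSum) (h := fun t => π ^ 2 * t⁻¹) t
      (hasDerivAt_g (t := π ^ 2 * t⁻¹) (by positivity))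
      ((hasDerivAt_inv ht.ne').const_mul (π ^ 2))
  have h3 := ((Real.hasDerivAt_rpow_const (x := t) (p := -(1 / 2)) (Or.inl ht.ne')).const_mul
    (√π)).mul ((h2.const_mul 2).const_add 1)
  have h4 := h1.unique (h3.congr_of_eventuallyEq (by
    filter_upwards [lt_mem_nhds ht] with s hs
    exact theta_eq hs))
  have e1 : t ^ (-(1 / 2) - 1 : ℝ) = t ^ (-(3 / 2) : ℝ) := by norm_num
  have e2 : t ^ (-(1 / 2) : ℝ) * (t ^ 2)⁻¹ = t ^ (-(5 / 2) : ℝ) := by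
    rw [← Real.rpow_natCast, ← Real.rpow_neg ht.le, ← Real.rpow_add ht]
    norm_num
  rw [e1] at h4
  rw [← e2]
  linear_combination (-1 / 2) * h4

lemma f_bound {s : ℝ} (hs : 1 ≤ s) :
    fSum s ≤ (fSum 1 * Real.exp 1) * Real.exp (-s) := by
  unfold fSum
  rw [mul_assoc, ← tsum_mul_right]
  refine (summable_f (by linarith)).tsum_le_tsum (fun k => ?_) ((summable_f one_pos).mul_right _)
  rw [mul_assoc, ← Real.exp_add, ← Real.exp_add]
  gcongr
  have : (0 : ℝ) ≤ k := by positivity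
  have h2 : (1 : ℝ) ≤ ((k : ℝ) + 1) ^ 2 := by nlinarith
  nlinarith

lemma f_nonneg (s : ℝ) : 0 ≤ fSum s := tsum_nonneg fun k => by positivity

lemma g_nonneg (s : ℝ) : 0 ≤ gSum s := tsum_nonneg fun k => by positivity

lemma f_isBigO : fSum =O[Filter.atTop] fun s => Real.exp (-1 * s) := by
  refine Asymptotics.IsBigO.of_bound (fSum 1 * Real.exp 1) ?_
  filter_upwards [Filter.eventually_ge_atTop 1] with s hs
  rw [Real.norm_of_nonneg (f_nonneg s), Real.norm_of_nonneg (by positivity)]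
  simpa using f_bound hs

lemma g_isBigO : gSum =O[Filter.atTop] fun s => Real.exp (-1 * s) := by
  refine Asymptotics.IsBigO.trans (Asymptotics.IsBigO.of_bound 1 ?_) f_isBigO
  filter_upwards [Filter.eventually_ge_atTop 1] with s hs
  rw [Real.norm_of_nonneg (g_nonneg s), Real.norm_of_nonneg (f_nonneg s), one_mul]
  have hs' : 0 < s := by linarith
  exact (summable_g hs').tsum_le_tsum (g_le_f s) (summable_f hs')

lemma small {h : ℝ → ℝ} (hh : h =O[Filter.atTop] fun s => Real.exp (-1 * s)) (p q : ℝ) :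
    (fun t : ℝ => t ^ p * h (π ^ 2 * t⁻¹)) =o[nhdsWithin 0 (Set.Ioi 0)] fun t : ℝ => t ^ q := by
  have h1 := hh.trans_isLittleO (isLittleO_exp_neg_mul_rpow_atTop one_pos (p - q))
  have ht : Filter.Tendsto (fun t : ℝ => π ^ 2 * t⁻¹) (nhdsWithin 0 (Set.Ioi 0)) Filter.atTop :=
    tendsto_inv_nhdsGT_zero.const_mul_atTop (by positivity)
  have h2 := (Asymptotics.isBigO_refl (fun t : ℝ => t ^ p) (nhdsWithin 0 (Set.Ioi 0))).mul_isLittleO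
    (h1.comp_tendsto ht)
  refine h2.trans_isBigO (Asymptotics.IsBigO.of_bound ((π ^ 2) ^ (p - q)) ?_)
  filter_upwards [self_mem_nhdsWithin] with t ht
  have ht : 0 < t := ht
  rw [Real.norm_of_nonneg (by simp only [Function.comp]; positivity),
    Real.norm_of_nonneg (by positivity)]
  simp only [Function.comp]
  rw [Real.mul_rpow (by positivity) (by positivity), Real.inv_rpow ht.le, ← Real.rpow_neg ht.le,
    mul_left_comm, ← Real.rpow_add ht]
  apply le_of_eq
  congr 2
  ring

/-- the heat trace of `S³` satisfies, as `t → 0+`,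
`Σ_{k=0}^∞ (k+1)² e^{-t k(k+2)} = Σ_{n=0}^{N} (√π/(4 n!)) t^{n-3/2} + o(t^{N-3/2})`. -/
theorem heat_trace_S3 (N : ℕ) :
    (fun t : ℝ =>
        (∑' k : ℕ, ((k : ℝ) + 1) ^ 2 * Real.exp (-(t * (k * (k + 2))))) -
          ∑ n ∈ Finset.range (N + 1),
            (Real.sqrt π / (4 * Nat.factorial n)) * t ^ ((n : ℝ) - 3 / 2))
      =o[nhdsWithin 0 (Set.Ioi 0)] fun t : ℝ => t ^ ((N : ℝ) - 3 / 2) := by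
  have hE : (fun t : ℝ => Real.exp t) =O[nhdsWithin 0 (Set.Ioi 0)] fun _ => (1 : ℝ) :=
    ((Real.continuous_exp.tendsto 0).mono_left nhdsWithin_le_nhds).isBigO_one ℝ
  have hR := hE.mul_isLittleO
    (((small g_isBigO (-(3 / 2)) ((N : ℝ) - 3 / 2)).const_mul_left (√π / 2)).sub
      ((small f_isBigO (-(5 / 2)) ((N : ℝ) - 3 / 2)).const_mul_left (√π * π ^ 2)))
  have hT := (Asymptotics.isBigO_refl (fun t : ℝ => t ^ (-(3 / 2) : ℝ))
    (nhdsWithin 0 (Set.Ioi 0))).mul_isLittleO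
    ((Real.exp_sub_sum_range_succ_isLittleO_pow N).mono nhdsWithin_le_nhds)
  have hT2 := (hT.const_mul_left (√π / 4)).congr'
    (g₂ := fun t : ℝ => t ^ ((N : ℝ) - 3 / 2)) Filter.EventuallyEq.rfl (by
      filter_upwards [self_mem_nhdsWithin] with t ht
      have ht : 0 < t := ht
      rw [← Real.rpow_natCast, ← Real.rpow_add ht]
      congr 1
      ring)
  simp only [one_mul] at hR
  refine (hT2.add hR).congr' ?_ Filter.EventuallyEq.rfl
  filter_upwards [self_mem_nhdsWithin] with t ht
  have ht : 0 < t := ht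
  have h1 : (∑' k : ℕ, ((k : ℝ) + 1) ^ 2 * Real.exp (-(t * (k * (k + 2)))))
      = Real.exp t * fSum t := by
    unfold fSum
    rw [← tsum_mul_left]
    congr 1
    ext k
    rw [mul_left_comm (Real.exp t), ← Real.exp_add]
    congr 2
    ring
  have h2 : ∑ n ∈ Finset.range (N + 1),
      (Real.sqrt π / (4 * Nat.factorial n)) * t ^ ((n : ℝ) - 3 / 2)
      = √π / 4 * t ^ (-(3 / 2) : ℝ) * ∑ n ∈ Finset.range (N + 1), t ^ n / (Nat.factorial n : ℝ) := by
    rw [Finset.mul_sum]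
    refine Finset.sum_congr rfl fun n _ => ?_
    rw [sub_eq_add_neg, Real.rpow_add ht, Real.rpow_natCast]
    field_simp
  rw [h1, h2, f_eq ht]
  ring
end

section
/- For all integers t ≥ 1 and ω' ≥ 2t+1: Σ_{j=1}^{ω'} [(-1)^j / ((ω'-j)! (j+t-1)! (2j+1)!)] · Σ_{p=0}^{2j} (-1)^p binom(2j,p) (p-j)^{2j+2t} = 0. -/
open Finset

/-- the exponential series of `a x` -/
noncomputable def zE (a : ℚ) : PowerSeries ℚ := PowerSeries.rescale a (PowerSeries.exp ℚ)

lemma zE_coeff (a : ℚ) (n : ℕ) : PowerSeries.coeff n (zE a) = a ^ n / (n.factorial : ℚ) := by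
  simp [zE, PowerSeries.coeff_rescale, PowerSeries.coeff_exp, div_eq_mul_inv]

lemma zE_mul (a b : ℚ) : zE a * zE b = zE (a + b) :=
  PowerSeries.exp_mul_exp_eq_exp_add a b

lemma zE_zero : zE 0 = 1 := by
  ext n
  rw [zE_coeff, PowerSeries.coeff_one]
  rcases n with _ | n <;> simp

lemma zE_pow (a : ℚ) (n : ℕ) : zE a ^ n = zE (n * a) := by
  induction n with
  | zero => simp [zE_zero]
  | succ n ih => rw [pow_succ, ih, zE_mul]; congr 1; push_cast; ring

lemma zE_H : ∃ H : PowerSeries ℚ,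
    zE (-1) * (zE 1 - 1) ^ 2 = PowerSeries.X ^ 2 * (1 + PowerSeries.X ^ 2 * H) := by
  have h1 : zE (-1) * (zE 1 - 1) ^ 2 = zE 1 + zE (-1) - 2 := by
    have h : zE (-1) * zE 1 = 1 := by rw [zE_mul]; simp [zE_zero]
    linear_combination (zE 1 - 2) * h
  have h2 : PowerSeries.X ^ 4 ∣ (zE 1 + zE (-1) - 2 - PowerSeries.X ^ 2 : PowerSeries ℚ) := by
    rw [PowerSeries.X_pow_dvd_iff]
    intro m hm
    have e : (2 : PowerSeries ℚ) = PowerSeries.C (2 : ℚ) := (map_ofNat _ 2).symm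
    rw [e]
    simp only [map_add, map_sub, zE_coeff, PowerSeries.coeff_X_pow, PowerSeries.coeff_C]
    interval_cases m <;> norm_num [Nat.factorial]
  obtain ⟨H, hH⟩ := h2
  refine ⟨H, ?_⟩
  rw [h1]
  linear_combination hH

lemma z_inner (j n : ℕ) :
    PowerSeries.coeff n ((zE (-1) * (zE 1 - 1) ^ 2) ^ j) * (n.factorial : ℚ) =
      ∑ p ∈ range (2 * j + 1), (-1 : ℚ) ^ p * (Nat.choose (2 * j) p : ℚ) *
            ((((p : ℤ) - (j : ℤ)) ^ n : ℤ) : ℚ) := by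
  have h : (zE (-1) * (zE 1 - 1) ^ 2) ^ j =
      ∑ p ∈ range (2 * j + 1), PowerSeries.C ((-1 : ℚ) ^ p * (Nat.choose (2 * j) p : ℚ)) *
        zE ((p : ℚ) - j) := by
    rw [mul_pow, ← pow_mul, sub_eq_add_neg, add_pow, zE_pow, mul_sum]
    refine sum_congr rfl fun p hp => ?_
    have hp' : p ≤ 2 * j := by simpa [Nat.lt_succ_iff] using hp
    have hs : (-1 : PowerSeries ℚ) ^ (2 * j - p) = (-1) ^ p := by
      obtain ⟨q, hq⟩ := Nat.exists_eq_add_of_le hp'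
      rw [hq, Nat.add_sub_cancel_left]
      have : Even (p + q) := ⟨j, by omega⟩
      rcases Nat.even_or_odd p with h | h
      · rw [h.neg_one_pow, ((Nat.even_add.1 this).1 h).neg_one_pow]
      · have hq' : Odd q := by
          rw [← Nat.not_even_iff_odd] at h ⊢
          exact fun hh => h ((Nat.even_add.1 this).2 hh)
        rw [h.neg_one_pow, hq'.neg_one_pow]
    have hz : zE ((p : ℚ) - j) = zE ((j : ℚ) * -1) * zE ((p : ℚ) * 1) := by
      rw [zE_mul]; congr 1; ring
    rw [hs, zE_pow, hz]
    simp only [map_mul, map_pow, map_neg, map_one, map_natCast]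
    ring
  rw [h, map_sum, sum_mul]
  refine sum_congr rfl fun p _ => ?_
  rw [PowerSeries.coeff_C_mul, zE_coeff]
  have : (n.factorial : ℚ) ≠ 0 := by exact_mod_cast n.factorial_ne_zero
  field_simp
  push_cast
  ring

lemma z_choose (k : ℕ) : ∃ P : Polynomial ℚ, P.natDegree ≤ k ∧
    ∀ j : ℕ, P.eval (j : ℚ) = (j.choose k : ℚ) := by
  refine ⟨Polynomial.C ((k.factorial : ℚ)⁻¹) * descPochhammer ℚ k, ?_, fun j => ?_⟩
  · refine (Polynomial.natDegree_C_mul_le _ _).trans ?_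
    rw [descPochhammer_natDegree]
  · have : (k.factorial : ℚ) ≠ 0 := by exact_mod_cast k.factorial_ne_zero
    rw [Polynomial.eval_mul, Polynomial.eval_C, descPochhammer_eval_eq_descFactorial,
      Nat.descFactorial_eq_factorial_mul_choose]
    push_cast
    field_simp

lemma z_poly (t : ℕ) (ht : 1 ≤ t) : ∃ P : Polynomial ℚ, P.natDegree ≤ t ∧ P.eval 0 = 0 ∧
    ∀ j : ℕ, P.eval (j : ℚ) * ((2 * j + 2 * t).factorial : ℚ) =
      ∑ p ∈ range (2 * j + 1), (-1 : ℚ) ^ p * (Nat.choose (2 * j) p : ℚ) *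
            ((((p : ℤ) - (j : ℤ)) ^ (2 * j + 2 * t) : ℤ) : ℚ) := by
  obtain ⟨H, hH⟩ := zE_H
  choose B hB1 hB2 using z_choose
  have key : ∀ j : ℕ, (∑ k ∈ range (t + 1),
      Polynomial.C (PowerSeries.coeff (2 * t) ((PowerSeries.X ^ 2 * H) ^ k)) * B k).eval (j : ℚ)
      = PowerSeries.coeff (2 * t) ((1 + PowerSeries.X ^ 2 * H) ^ j) := by
    intro j
    have hz : ∀ k, t < k → PowerSeries.coeff (2 * t) ((PowerSeries.X ^ 2 * H) ^ k) = 0 := by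
      intro k hk
      rw [mul_pow, ← pow_mul]
      rw [PowerSeries.coeff_X_pow_mul', if_neg (by omega)]
    rw [add_comm (1 : PowerSeries ℚ), add_pow, Polynomial.eval_finsetSum, map_sum]
    have h1 : ∀ k, PowerSeries.coeff (2 * t)
        ((PowerSeries.X ^ 2 * H) ^ k * 1 ^ (j - k) * (j.choose k : PowerSeries ℚ)) =
        PowerSeries.coeff (2 * t) ((PowerSeries.X ^ 2 * H) ^ k) * (j.choose k : ℚ) := by
      intro k
      have e : (j.choose k : PowerSeries ℚ) = PowerSeries.C (j.choose k : ℚ) := by simp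
      rw [one_pow, mul_one, e, PowerSeries.coeff_mul_C]
    simp only [h1, Polynomial.eval_mul, Polynomial.eval_C, hB2]
    have a1 := sum_subset (s₁ := range (t + 1)) (s₂ := range (t + j + 1))
      (f := fun k => PowerSeries.coeff (2 * t) ((PowerSeries.X ^ 2 * H) ^ k) * (j.choose k : ℚ))
      (by intro x; simp only [mem_range]; omega)
      (by
        intro x _ hx
        simp only [mem_range] at hx
        simp only [hz x (by omega), zero_mul])
    have a2 := sum_subset (s₁ := range (j + 1)) (s₂ := range (t + j + 1))
      (f := fun k => PowerSeries.coeff (2 * t) ((PowerSeries.X ^ 2 * H) ^ k) * (j.choose k : ℚ))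
      (by intro x; simp only [mem_range]; omega)
      (by
        intro x _ hx
        simp only [mem_range] at hx
        simp only [Nat.choose_eq_zero_of_lt (show j < x by omega), Nat.cast_zero, mul_zero])
    rw [a1, a2]
  refine ⟨∑ k ∈ range (t + 1),
      Polynomial.C (PowerSeries.coeff (2 * t) ((PowerSeries.X ^ 2 * H) ^ k)) * B k,
      ?_, ?_, fun j => ?_⟩
  rotate_left 2
  · rw [key j, ← z_inner, hH, mul_pow, ← pow_mul, add_comm (2 * j), PowerSeries.coeff_X_pow_mul]
  · refine Polynomial.natDegree_sum_le_of_forall_le _ _ fun k hk => ?_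
    simp only [mem_range] at hk
    exact (Polynomial.natDegree_C_mul_le _ _).trans ((hB1 k).trans (by omega))
  · have := key 0
    rw [Nat.cast_zero] at this
    rw [this, pow_zero, PowerSeries.coeff_one, if_neg (by omega)]

lemma z_fact (s : ℕ) : ∃ A : Polynomial ℚ, A.natDegree ≤ s ∧ ∀ j : ℕ,
    ((2 * j + 2 * s + 1).factorial : ℚ) * (j.factorial : ℚ) =
      ((j + s).factorial : ℚ) * ((2 * j + 1).factorial : ℚ) * A.eval (j : ℚ) := by
  induction s with
  | zero => exact ⟨1, by simp, fun j => by simp; ring⟩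
  | succ s ih =>
    obtain ⟨A, hA, h⟩ := ih
    refine ⟨A * (Polynomial.C 4 * Polynomial.X + Polynomial.C (4 * s + 6 : ℚ)), ?_, fun j => ?_⟩
    · exact Polynomial.natDegree_mul_le.trans
        (Nat.add_le_add hA Polynomial.natDegree_linear_le)
    · have e1 : 2 * j + 2 * (s + 1) + 1 = 2 * j + 2 * s + 1 + 1 + 1 := by ring
      rw [e1, ← add_assoc j s 1, Nat.factorial_succ, Nat.factorial_succ (2 * j + 2 * s + 1),
        Nat.factorial_succ (j + s)]
      simp only [Polynomial.eval_mul, Polynomial.eval_add, Polynomial.eval_C, Polynomial.eval_X]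
      push_cast
      linear_combination ((2 * j + 2 * s + 3 : ℚ) * (2 * j + 2 * s + 2)) * h j

lemma z_diff (Q : Polynomial ℚ) (n : ℕ) (h : Q.natDegree < n) :
    ∑ j ∈ range (n + 1), (-1 : ℚ) ^ j * (n.choose j : ℚ) * Q.eval (j : ℚ) = 0 := by
  have h1 := Polynomial.fwdDiff_iter_eq_zero_of_degree_lt (P := Q) (n := n) h
  have h2 := fwdDiff_iter_eq_sum_shift (1 : ℚ) Q.eval n 0
  rw [h1] at h2
  have h3 : ∑ j ∈ range (n + 1), (-1 : ℚ) ^ j * (n.choose j : ℚ) * Q.eval (j : ℚ) =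
      (-1) ^ n * ∑ k ∈ range (n + 1), ((-1 : ℤ) ^ (n - k) * n.choose k) • Q.eval (0 + k • (1 : ℚ)) := by
    rw [mul_sum]
    refine sum_congr rfl fun k hk => ?_
    have hk' : k ≤ n := by simpa [Nat.lt_succ_iff] using hk
    obtain ⟨q, rfl⟩ := Nat.exists_eq_add_of_le hk'
    have hq : ((-1 : ℚ) ^ q) * (-1) ^ q = 1 := by rw [← mul_pow]; simp
    simp only [Nat.add_sub_cancel_left, zsmul_eq_mul, nsmul_eq_mul, zero_add, mul_one, pow_add]
    push_cast
    linear_combination (-((-1 : ℚ) ^ k * ((k + q).choose k : ℚ) * Q.eval (k : ℚ))) * hq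
  rw [h3, ← h2]
  simp

/-- for `t ≥ 1` and `ω' ≥ 2t+1`,
`Σ_{j=1}^{ω'} [(-1)^j/((ω'-j)!(j+t-1)!(2j+1)!)] Σ_{p=0}^{2j} (-1)^p C(2j,p)(p-j)^{2j+2t} = 0`. -/
theorem zeil_sum_vanishes (t ω' : ℕ) (ht : 1 ≤ t) (hω : 2 * t + 1 ≤ ω') :
    ∑ j ∈ Finset.Icc 1 ω',
      ((-1 : ℚ) ^ j /
          ((Nat.factorial (ω' - j) : ℚ) * Nat.factorial (j + t - 1) *
            Nat.factorial (2 * j + 1))) *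
        ∑ p ∈ range (2 * j + 1),
          (-1 : ℚ) ^ p * (Nat.choose (2 * j) p : ℚ) *
            ((((p : ℤ) - (j : ℤ)) ^ (2 * j + 2 * t) : ℤ) : ℚ) = 0 := by
  obtain ⟨P, hP, hP0, hPj⟩ := z_poly t ht
  obtain ⟨s, rfl⟩ : ∃ s, t = s + 1 := ⟨t - 1, by omega⟩
  obtain ⟨A, hA, hAj⟩ := z_fact s
  have hd := z_diff (P * (A * (Polynomial.C 2 * Polynomial.X + Polynomial.C (2 * s + 2 : ℚ)))) ω' (by
    have h1 := Polynomial.natDegree_mul_le (p := P)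
      (q := A * (Polynomial.C 2 * Polynomial.X + Polynomial.C (2 * s + 2 : ℚ)))
    have h2 := Polynomial.natDegree_mul_le (p := A)
      (q := Polynomial.C 2 * Polynomial.X + Polynomial.C (2 * s + 2 : ℚ))
    have h3 := Polynomial.natDegree_linear_le (a := (2 : ℚ)) (b := (2 * s + 2 : ℚ))
    omega)
  rw [range_eq_Ico, sum_eq_sum_Ico_succ_bot (by omega)] at hd
  simp only [Nat.cast_zero, Polynomial.eval_mul, hP0, zero_mul, mul_zero, zero_add] at hd
  have hI : Finset.Icc 1 ω' = Finset.Ico 1 (ω' + 1) := by ext x; simp only [mem_Icc, mem_Ico]; omega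
  rw [hI, ← mul_zero ((ω'.factorial : ℚ)⁻¹), ← hd, mul_sum]
  refine sum_congr rfl fun j hj => ?_
  have hj' : j ≤ ω' := by simp only [mem_Ico] at hj; omega
  rw [← hPj j, Nat.cast_choose ℚ hj']
  have e1 : 2 * j + 2 * (s + 1) = 2 * j + 2 * s + 1 + 1 := by ring
  have e2 : j + (s + 1) - 1 = j + s := by omega
  rw [e1, e2, Nat.factorial_succ (2 * j + 2 * s + 1)]
  have hf := hAj j
  have n1 : (ω'.factorial : ℚ) ≠ 0 := by exact_mod_cast Nat.factorial_ne_zero _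
  have n2 : ((ω' - j).factorial : ℚ) ≠ 0 := by exact_mod_cast Nat.factorial_ne_zero _
  have n3 : ((j + s).factorial : ℚ) ≠ 0 := by exact_mod_cast Nat.factorial_ne_zero _
  have n4 : ((2 * j + 1).factorial : ℚ) ≠ 0 := by exact_mod_cast Nat.factorial_ne_zero _
  have n5 : (j.factorial : ℚ) ≠ 0 := by exact_mod_cast Nat.factorial_ne_zero _
  have hf' : ((2 * j + 2 * s + 1).factorial : ℚ) =
      ((j + s).factorial : ℚ) * ((2 * j + 1).factorial : ℚ) * A.eval (j : ℚ) / (j.factorial : ℚ) := by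
    rw [← hf]; field_simp
  simp only [Polynomial.eval_add, Polynomial.eval_mul, Polynomial.eval_C, Polynomial.eval_X]
  push_cast
  rw [hf']
  field_simp
  ring
end
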